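/- arXiv:1902.04819 — 4 statements merged into one kernel-verified Lean document; each statement's English description precedes it below -/
import Mathlib

section
/- L¹ convolution with a homogeneous kernel lands in weak Lebesgue space: let n ≥ 1 and let K be a kernel of type α on ℝⁿ with 0 < α < n. Then there exists a constant C > 0 such that for every f ∈ L¹(ℝⁿ) the convolution f ∗ K (defined a.e. by (f∗K)(x) = ∫ f(y) K(x−y) dy) satisfies ‖f ∗ K‖_{M^{n/(n−α)}} ≤ C ‖f‖_{L¹}. In particular, for every 1 ≤ p < n/(n−α), f ∗ K belongs to L^p_loc(ℝⁿ) ⊆ L¹_loc(ℝⁿ). -/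
noncomputable section
open MeasureTheory ENNReal

/-- A kernel of type `a` on `ℝⁿ` (Definition 3.3, Euclidean case): a function that is
smooth away from the origin and positively homogeneous of degree `a - n`. -/
def IsKernelOfType (n : ℕ) (a : ℝ) (K : EuclideanSpace ℝ (Fin n) → ℝ) : Prop :=
  ContDiffOn ℝ (⊤ : ℕ∞) K {(0 : EuclideanSpace ℝ (Fin n))}ᶜ ∧
  ∀ c : ℝ, 0 < c → ∀ x : EuclideanSpace ℝ (Fin n), x ≠ 0 →
    K (c • x) = c ^ (a - (n : ℝ)) * K x

/-- The `M^p` norm (Definition 3.8): the least `C` such that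
`∫_K |u| ≤ C |K|^{1/p'}` for every measurable `K` of finite measure; `sInf ∅ = ∞`. -/
def Mnorm {X : Type*} [MeasurableSpace X] (μ : Measure X) (p : ℝ) (u : X → ℝ) : ℝ≥0∞ :=
  sInf {C : ℝ≥0∞ | ∀ K : Set X, MeasurableSet K → μ K < ⊤ →
    ∫⁻ x in K, ENNReal.ofReal |u x| ∂μ ≤ C * μ K ^ ((p - 1) / p)}

section RieszKernel

variable {E : Type*} [NormedAddCommGroup E] [NormedSpace ℝ E] [FiniteDimensional ℝ E]
  [MeasurableSpace E] [BorelSpace E] (μ : Measure E) [μ.IsAddHaarMeasure]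

open Module Metric Set
open scoped Pointwise

theorem integrableOn_ball_norm_rpow_sub_finrank (hd : 1 ≤ finrank ℝ E) {b : ℝ} (hb : 0 < b)
    (r : ℝ) : IntegrableOn (fun x : E => ‖x‖ ^ (b - finrank ℝ E)) (ball 0 r) μ := by
  refine integrableOn_ball_of_norm_le_rpow (C := 1) (α := finrank ℝ E - b) hd (by linarith)
    (Filter.Eventually.of_forall fun x => ?_)
    (measurable_norm.pow_const _).aestronglyMeasurable
  rw [one_mul, neg_sub, Real.norm_of_nonneg (by positivity)]

theorem setIntegral_ball_norm_rpow_sub_finrank (b : ℝ) {r : ℝ} (hr : 0 < r) :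
    ∫ x in ball (0 : E) r, ‖x‖ ^ (b - finrank ℝ E) ∂μ =
      (∫ x in ball (0 : E) 1, ‖x‖ ^ (b - finrank ℝ E) ∂μ) * r ^ b := by
  have h := Measure.setIntegral_comp_smul_of_pos μ
    (fun x : E => ‖x‖ ^ (b - finrank ℝ E)) (ball 0 1) hr
  have hball : r • ball (0 : E) 1 = ball 0 r := by
    rw [_root_.smul_ball hr.ne', smul_zero, Real.norm_of_nonneg hr.le, mul_one]
  simp only [hball, norm_smul, Real.norm_of_nonneg hr.le, Real.mul_rpow hr.le (norm_nonneg _),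
    integral_const_mul, smul_eq_mul] at h
  rw [Real.rpow_sub hr, Real.rpow_natCast] at h
  have hpos : 0 < r ^ finrank ℝ E := pow_pos hr _
  field_simp at h
  linarith

/-- Among sets of given measure, the integral of the Riesz kernel `‖x - y‖ ^ (b - d)` is
controlled by the one over a ball. -/
theorem exists_setLIntegral_norm_sub_rpow_le (hd : 1 ≤ finrank ℝ E) {b : ℝ} (hb : 0 < b)
    (hbd : b < finrank ℝ E) :
    ∃ C : ℝ, 0 < C ∧ ∀ S : Set E, MeasurableSet S → μ S < ⊤ → ∀ y : E,
      ∫⁻ x in S, ENNReal.ofReal (‖x - y‖ ^ (b - finrank ℝ E)) ∂μ ≤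
        ENNReal.ofReal C * μ S ^ (b / finrank ℝ E) := by
  set d : ℝ := (finrank ℝ E : ℝ) with hd_def
  have hd0 : 0 < d := by rw [hd_def]; exact_mod_cast hd
  set c : ℝ := ∫ x in ball (0 : E) 1, ‖x‖ ^ (b - d) ∂μ with hc
  have hc0 : 0 ≤ c := integral_nonneg fun x => by positivity
  refine ⟨c + 1, by positivity, fun S hS hSfin y => ?_⟩
  rcases eq_or_ne (μ S) 0 with h0 | h0
  · rw [setLIntegral_measure_zero _ _ h0]
    exact zero_le
  set m : ℝ := (μ S).toReal with hm
  have hm0 : 0 < m := ENNReal.toReal_pos h0 hSfin.ne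
  have hmS : μ S = ENNReal.ofReal m := (ENNReal.ofReal_toReal hSfin.ne).symm
  set r : ℝ := m ^ (1 / d) with hr
  have hr0 : 0 < r := Real.rpow_pos_of_pos hm0 _
  have hnear : ∫⁻ x in ball y r, ENNReal.ofReal (‖x - y‖ ^ (b - d)) ∂μ =
      ENNReal.ofReal (c * r ^ b) := by
    rw [hc, ← setIntegral_ball_norm_rpow_sub_finrank μ b hr0,
      ofReal_integral_eq_lintegral_ofReal (integrableOn_ball_norm_rpow_sub_finrank μ hd hb r)
        (Filter.Eventually.of_forall fun x => by positivity),
      ← lintegral_indicator measurableSet_ball, ← lintegral_indicator measurableSet_ball]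
    refine Eq.trans (lintegral_congr fun x => ?_) (lintegral_sub_right_eq_self _ y)
    simp [indicator, dist_eq_norm, hd_def]
  have hfar : ∫⁻ x in S \ ball y r, ENNReal.ofReal (‖x - y‖ ^ (b - d)) ∂μ ≤
      ENNReal.ofReal (r ^ (b - d)) * μ S := by
    calc ∫⁻ x in S \ ball y r, ENNReal.ofReal (‖x - y‖ ^ (b - d)) ∂μ
        ≤ ∫⁻ _ in S \ ball y r, ENNReal.ofReal (r ^ (b - d)) ∂μ := by
          refine setLIntegral_mono' (hS.diff measurableSet_ball) fun x hx => ?_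
          refine ENNReal.ofReal_le_ofReal (Real.rpow_le_rpow_of_nonpos hr0 ?_ (by linarith))
          simpa [dist_eq_norm] using hx.2
      _ = ENNReal.ofReal (r ^ (b - d)) * μ (S \ ball y r) := setLIntegral_const _ _
      _ ≤ _ := by gcongr; exact sdiff_subset
  have hrb : r ^ b = m ^ (b / d) := by
    rw [hr, ← Real.rpow_mul hm0.le]; congr 1; ring
  have hrbd : r ^ (b - d) * m = m ^ (b / d) := by
    rw [hr, ← Real.rpow_mul hm0.le]
    nth_rewrite 2 [← Real.rpow_one m]
    rw [← Real.rpow_add hm0]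
    congr 1
    field_simp
    ring
  calc ∫⁻ x in S, ENNReal.ofReal (‖x - y‖ ^ (b - d)) ∂μ
      ≤ ∫⁻ x in ball y r ∪ (S \ ball y r), ENNReal.ofReal (‖x - y‖ ^ (b - d)) ∂μ :=
        lintegral_mono_set (by rw [union_sdiff_self]; exact subset_union_right)
    _ ≤ ENNReal.ofReal (c * r ^ b) + ENNReal.ofReal (r ^ (b - d)) * μ S := by
        refine (lintegral_union_le _ _ _).trans ?_
        rw [hnear]
        gcongr
    _ = ENNReal.ofReal (c + 1) * μ S ^ (b / d) := by
        rw [hmS, ENNReal.ofReal_rpow_of_pos hm0, ← ENNReal.ofReal_mul (by positivity), hrbd, hrb,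
          ← ENNReal.ofReal_add (by positivity) (by positivity),
          ← ENNReal.ofReal_mul (by positivity)]
        congr 1
        ring

end RieszKernel

theorem rpow_lintegral_mul_le {X : Type*} [MeasurableSpace X] {μ : Measure X} {f g : X → ℝ≥0∞}
    (hf : AEMeasurable f μ) (hg : AEMeasurable g μ) {p : ℝ} (hp : 1 ≤ p) :
    (∫⁻ x, f x * g x ∂μ) ^ p ≤ (∫⁻ x, f x ∂μ) ^ (p - 1) * ∫⁻ x, f x * g x ^ p ∂μ := by
  have hp0 : 0 < p := by linarith
  have hg' : AEMeasurable g (μ.withDensity f) := hg.mono' (withDensity_absolutelyContinuous μ f)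
  have h := eLpNorm'_le_eLpNorm'_mul_rpow_measure_univ (μ := μ.withDensity f) zero_lt_one hp
    hg'.aestronglyMeasurable
  have h1 : ∫⁻ x, g x ∂μ.withDensity f = ∫⁻ x, f x * g x ∂μ :=
    lintegral_withDensity_eq_lintegral_mul₀ hf hg
  have h2 : ∫⁻ x, g x ^ p ∂μ.withDensity f = ∫⁻ x, f x * g x ^ p ∂μ :=
    lintegral_withDensity_eq_lintegral_mul₀ hf (hg.pow_const p)
  simp only [eLpNorm'_eq_lintegral_enorm, enorm_eq_self, ENNReal.rpow_one, div_one, h1, h2,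
    withDensity_apply _ MeasurableSet.univ, Measure.restrict_univ] at h
  refine (ENNReal.rpow_le_rpow h hp0.le).trans_eq ?_
  rw [ENNReal.mul_rpow_of_nonneg _ _ hp0.le, ← ENNReal.rpow_mul, ← ENNReal.rpow_mul, mul_comm]
  congr 2
  · field_simp
  · rw [one_div_mul_cancel hp0.ne', ENNReal.rpow_one]

theorem setLIntegral_rpow_lintegral_mul_le {X Y : Type*} [MeasurableSpace X] [MeasurableSpace Y]
    {μ : Measure X} {ν : Measure Y} [SFinite μ] [SFinite ν] {f : Y → ℝ≥0∞}
    (hf : AEMeasurable f ν) {k : X → Y → ℝ≥0∞} (hk : Measurable (Function.uncurry k))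
    {p : ℝ} (hp : 1 ≤ p) {S : Set X} {B : ℝ≥0∞} (hB : ∀ y, ∫⁻ x in S, k x y ^ p ∂μ ≤ B) :
    ∫⁻ x in S, (∫⁻ y, f y * k x y ∂ν) ^ p ∂μ ≤ (∫⁻ y, f y ∂ν) ^ p * B := by
  set F := ∫⁻ y, f y ∂ν with hF
  have hkp : Measurable (Function.uncurry fun x y => k x y ^ p) := hk.pow_const p
  have hprod : AEMeasurable (Function.uncurry fun x y => f y * k x y ^ p)
      ((μ.restrict S).prod ν) :=
    (hf.comp_quasiMeasurePreserving Measure.quasiMeasurePreserving_snd).mul hkp.aemeasurable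
  calc ∫⁻ x in S, (∫⁻ y, f y * k x y ∂ν) ^ p ∂μ
      ≤ ∫⁻ x in S, F ^ (p - 1) * ∫⁻ y, f y * k x y ^ p ∂ν ∂μ :=
        lintegral_mono fun x =>
          rpow_lintegral_mul_le hf (hk.of_uncurry_left (x := x)).aemeasurable hp
    _ = F ^ (p - 1) * ∫⁻ y, f y * ∫⁻ x in S, k x y ^ p ∂μ ∂ν := by
        have hmeas : AEMeasurable (fun x => ∫⁻ y, f y * k x y ^ p ∂ν) (μ.restrict S) :=
          hprod.lintegral_prod_right'
        rw [lintegral_const_mul'' _ hmeas, lintegral_lintegral_swap hprod]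
        congr 1
        exact lintegral_congr fun y =>
          lintegral_const_mul _ (hkp.of_uncurry_right (y := y))
    _ ≤ F ^ (p - 1) * ∫⁻ y, f y * B ∂ν := by
        gcongr with y
        exact hB y
    _ = F ^ p * B := by
        rw [lintegral_mul_const'' _ hf, ← mul_assoc, ← hF]
        nth_rewrite 2 [← ENNReal.rpow_one F]
        rw [← ENNReal.rpow_add_of_nonneg _ _ (by linarith) zero_le_one, sub_add_cancel]

theorem IsKernelOfType.exists_abs_le {n : ℕ} {a : ℝ} {K : EuclideanSpace ℝ (Fin n) → ℝ}
    (hK : IsKernelOfType n a K) :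
    ∃ M : ℝ, 0 < M ∧ ∀ x, x ≠ 0 → |K x| ≤ M * ‖x‖ ^ (a - (n : ℝ)) := by
  obtain ⟨M, hM⟩ := (isCompact_sphere (0 : EuclideanSpace ℝ (Fin n)) 1).exists_bound_of_continuousOn
    (hK.1.continuousOn.mono fun x hx => ne_zero_of_mem_unit_sphere ⟨x, hx⟩)
  refine ⟨max M 1, by positivity, fun x hx => ?_⟩
  have hx0 : 0 < ‖x‖ := norm_pos_iff.2 hx
  have hu : ‖‖x‖⁻¹ • x‖ = 1 := norm_smul_inv_norm (𝕜 := ℝ) hx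
  have hhom := hK.2 ‖x‖ hx0 (‖x‖⁻¹ • x) (norm_ne_zero_iff.1 (by rw [hu]; exact one_ne_zero))
  rw [smul_inv_smul₀ hx0.ne'] at hhom
  rw [hhom, abs_mul, abs_of_pos (Real.rpow_pos_of_pos hx0 _), mul_comm]
  gcongr
  exact (hM _ (by simpa using hu)).trans (le_max_left _ _)

theorem IsKernelOfType.exists_setLIntegral_rpow_conv_le {n : ℕ} (hn : 1 ≤ n) {a : ℝ}
    (han : a < n) {K : EuclideanSpace ℝ (Fin n) → ℝ} (hK : IsKernelOfType n a K) {p : ℝ}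
    (hp : 1 ≤ p) (hpn : p * (n - a) < n) :
    ∃ C : ℝ, 0 < C ∧ ∀ f : EuclideanSpace ℝ (Fin n) → ℝ, AEMeasurable f volume →
      ∀ S : Set (EuclideanSpace ℝ (Fin n)), MeasurableSet S → volume S < ⊤ →
        ∫⁻ x in S, ENNReal.ofReal |∫ y, f y * K (x - y)| ^ p ≤
          (∫⁻ y, ‖f y‖ₑ) ^ p * (ENNReal.ofReal C * volume S ^ ((n - p * (n - a)) / n)) := by
  have hp0 : 0 < p := by linarith
  have : Nonempty (Fin n) := ⟨⟨0, hn⟩⟩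
  obtain ⟨M, hM0, hM⟩ := hK.exists_abs_le
  obtain ⟨c, hc0, hc⟩ := exists_setLIntegral_norm_sub_rpow_le
    (volume : Measure (EuclideanSpace ℝ (Fin n))) (by simpa using hn)
    (b := n - p * (n - a)) (by linarith)
    (by rw [finrank_euclideanSpace_fin]; nlinarith)
  simp only [finrank_euclideanSpace_fin] at hc
  refine ⟨M ^ p * c, by positivity, fun f hf S hS hSfin => ?_⟩
  set k : EuclideanSpace ℝ (Fin n) → EuclideanSpace ℝ (Fin n) → ℝ≥0∞ :=
    fun x y => ENNReal.ofReal (M * ‖x - y‖ ^ (a - (n : ℝ))) with hk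
  have hkmeas : Measurable (Function.uncurry k) := by
    unfold Function.uncurry
    fun_prop
  have hpoint (x) : ENNReal.ofReal |∫ y, f y * K (x - y)| ≤ ∫⁻ y, ‖f y‖ₑ * k x y := by
    rw [← Real.norm_eq_abs, ofReal_norm]
    refine (enorm_integral_le_lintegral_enorm _).trans (lintegral_mono_ae ?_)
    filter_upwards [compl_mem_ae_iff.2 (measure_singleton x)] with y hy
    rw [enorm_mul]
    gcongr
    rw [← ofReal_norm, Real.norm_eq_abs]
    exact ENNReal.ofReal_le_ofReal (hM _ (sub_ne_zero.2 (Ne.symm hy)))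
  refine (lintegral_mono fun x => ENNReal.rpow_le_rpow (hpoint x) hp0.le).trans
    (setLIntegral_rpow_lintegral_mul_le hf.enorm hkmeas hp fun y => ?_)
  have hkp (x) : k x y ^ p =
      ENNReal.ofReal (M ^ p) * ENNReal.ofReal (‖x - y‖ ^ (n - p * (n - a) - n)) := by
    rw [hk, ENNReal.ofReal_rpow_of_nonneg (by positivity) hp0.le,
      Real.mul_rpow hM0.le (by positivity), ENNReal.ofReal_mul (by positivity),
      ← Real.rpow_mul (norm_nonneg _)]
    congr 3
    ring
  simp only [hkp]
  rw [lintegral_const_mul' _ _ ENNReal.ofReal_ne_top, ENNReal.ofReal_mul (by positivity), mul_assoc]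
  gcongr
  exact hc S hS hSfin y

/-- **L¹ convolution with a homogeneous kernel lands in weak Lebesgue space**
(Lemma 3.11, Euclidean case): if `K` is a kernel of type `a ∈ (0,n)` then
`‖f ∗ K‖_{M^{n/(n-a)}} ≤ C ‖f‖₁` for all `f ∈ L¹(ℝⁿ)`; in particular `f ∗ K` lies in
`L^p_loc ⊆ L¹_loc` for every `1 ≤ p < n/(n-a)`. -/
theorem conv_kernel_weak_type (n : ℕ) (hn : 1 ≤ n) (a : ℝ) (ha0 : 0 < a)
    (han : a < n) (K : EuclideanSpace ℝ (Fin n) → ℝ) (hK : IsKernelOfType n a K) :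
    ∃ C : ℝ, 0 < C ∧
      ∀ f : EuclideanSpace ℝ (Fin n) → ℝ, Integrable f volume →
        Mnorm volume ((n : ℝ) / ((n : ℝ) - a)) (fun x => ∫ y, f y * K (x - y)) ≤
            ENNReal.ofReal (C * ∫ y, |f y|) ∧
          ∀ p : ℝ, 1 ≤ p → p < (n : ℝ) / ((n : ℝ) - a) →
            ∀ A : Set (EuclideanSpace ℝ (Fin n)), IsCompact A →
              (∫⁻ x in A, ENNReal.ofReal (|∫ y, f y * K (x - y)| ^ p)) < ⊤ ∧
              (∫⁻ x in A, ENNReal.ofReal |∫ y, f y * K (x - y)|) < ⊤ := by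
  have hn0 : (0 : ℝ) < n := by exact_mod_cast hn
  have hna : 0 < n - a := sub_pos.2 han
  have hone : (1 : ℝ) < n / (n - a) := by rw [lt_div_iff₀ hna]; linarith
  obtain ⟨C, hC, hbound⟩ :=
    hK.exists_setLIntegral_rpow_conv_le hn han le_rfl (by linarith)
  refine ⟨C, hC, fun f hf => ⟨sInf_le fun S hS hSfin => ?_, fun p hp hpn A hA => ?_⟩⟩
  · have h := hbound f hf.aemeasurable S hS hSfin
    simp only [ENNReal.rpow_one] at h
    refine h.trans_eq ?_
    rw [← ofReal_integral_norm_eq_lintegral_enorm hf, ENNReal.ofReal_mul hC.le, ← mul_assoc,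
      mul_comm (ENNReal.ofReal C)]
    simp only [Real.norm_eq_abs]
    congr 2
    field_simp
  · have hfin {q : ℝ} (hq : 1 ≤ q) (hqn : q < (n : ℝ) / ((n : ℝ) - a)) :
        ∫⁻ x in A, ENNReal.ofReal |∫ y, f y * K (x - y)| ^ q < ⊤ := by
      have hq' : q * (n - a) < n := (lt_div_iff₀ hna).1 hqn
      obtain ⟨D, -, hD⟩ := hK.exists_setLIntegral_rpow_conv_le hn han hq hq'
      refine (hD f hf.aemeasurable A hA.measurableSet hA.measure_lt_top).trans_lt ?_
      exact ENNReal.mul_lt_top (ENNReal.rpow_lt_top_of_nonneg (by linarith) hf.2.ne)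
        (ENNReal.mul_lt_top ENNReal.ofReal_lt_top (ENNReal.rpow_lt_top_of_nonneg
          (div_nonneg (by linarith) hn0.le) hA.measure_lt_top.ne))
    refine ⟨?_, by simpa using hfin le_rfl hone⟩
    simpa only [ENNReal.ofReal_rpow_of_nonneg (abs_nonneg _) (zero_le_one.trans hp)]
      using hfin hp hpn
end
end

section
/- Decay at infinity of the convolution of a test function with a homogeneous kernel: let n ≥ 1, μ > 0, let g be a kernel of type μ on ℝⁿ, and let ψ be a smooth compactly supported function on ℝⁿ. Then ψ ∗ g is smooth on ℝⁿ, and for every multi-index β there exist constants C > 0 and R₀ > 0 such that |∂^β(ψ ∗ g)(x)| ≤ C |x|^{μ − n − |β|} for all |x| ≥ R₀. -/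
noncomputable section
open MeasureTheory ENNReal

open Metric in
/-- The `k`-th derivative of a function that is smooth away from the origin and positively
homogeneous of degree `a` is bounded by a multiple of `‖x‖ ^ (a - k)`. -/
theorem norm_iteratedFDeriv_le_of_homogeneous {E : Type*} [NormedAddCommGroup E]
    [NormedSpace ℝ E] [ProperSpace E] {g : E → ℝ} {a : ℝ}
    (hg : ContDiffOn ℝ (⊤ : ℕ∞) g {(0 : E)}ᶜ)
    (hhom : ∀ c : ℝ, 0 < c → ∀ x : E, x ≠ 0 → g (c • x) = c ^ a * g x) (k : ℕ) :
    ∃ M : ℝ, 0 ≤ M ∧ ∀ x : E, x ≠ 0 → ‖iteratedFDeriv ℝ k g x‖ ≤ M * ‖x‖ ^ (a - k) := by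
  have hopen : IsOpen ({(0 : E)}ᶜ) := isOpen_compl_singleton
  have hsm : ∀ x : E, x ≠ 0 → ContDiffAt ℝ (⊤ : ℕ∞) g x := fun x hx =>
    hg.contDiffAt (hopen.mem_nhds hx)
  have hcont : ContinuousOn (iteratedFDeriv ℝ k g) (sphere (0 : E) 1) := fun x hx =>
    ((hsm x (ne_of_mem_sphere hx one_ne_zero)).continuousAt_iteratedFDeriv
      (by exact_mod_cast le_top)).continuousWithinAt
  obtain ⟨M, hM⟩ := (isCompact_sphere (0 : E) 1).exists_bound_of_continuousOn hcont
  refine ⟨max M 0, le_max_right _ _, fun x hx => ?_⟩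
  have hc : 0 < ‖x‖ := norm_pos_iff.mpr hx
  set c := ‖x‖ with hcdef
  set w := c⁻¹ • x with hwdef
  have hw : w ≠ 0 := smul_ne_zero (inv_ne_zero hc.ne') hx
  have hwn : ‖w‖ = 1 := by
    rw [hwdef, norm_smul, norm_inv, Real.norm_of_nonneg hc.le, ← hcdef, inv_mul_cancel₀ hc.ne']
  have hcw : c • w = x := by rw [hwdef, smul_smul, mul_inv_cancel₀ hc.ne', one_smul]
  let L : E ≃L[ℝ] E := ContinuousLinearEquiv.smulLeft (Units.mk0 c hc.ne')
  have hL : ∀ v, L v = c • v := fun v => rfl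
  have hpre : L ⁻¹' {(0 : E)}ᶜ = {(0 : E)}ᶜ := by ext v; simp [hL, hc.ne']
  have h1 := L.iteratedFDerivWithin_comp_right g hopen.uniqueDiffOn (x := w)
    (by simp [hL, hcw, hx]) k
  rw [hpre, hL, hcw, iteratedFDerivWithin_of_isOpen k hopen hx] at h1
  have h2 : iteratedFDerivWithin ℝ k (g ∘ L) {(0 : E)}ᶜ w = c ^ a • iteratedFDeriv ℝ k g w := by
    rw [iteratedFDerivWithin_congr (f := c ^ a • g) (fun v hv => ?_) hw,
      iteratedFDerivWithin_of_isOpen k hopen hw, iteratedFDeriv_const_smul_apply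
        ((hsm w hw).of_le (by exact_mod_cast le_top))]
    simpa [hL] using hhom c hc v hv
  have h3 : iteratedFDeriv ℝ k g x = c ^ (a - k) • iteratedFDeriv ℝ k g w := by
    ext v
    have h4 := congrArg (fun T => T v) (h1.symm.trans h2)
    simp only [ContinuousMultilinearMap.compContinuousLinearMap_apply,
      ContinuousLinearEquiv.coe_coe, hL, ContinuousMultilinearMap.map_smul_univ,
      Finset.prod_const, Finset.card_univ, Fintype.card_fin, smul_eq_mul,
      smul_apply] at h4 ⊢
    rw [Real.rpow_sub hc, Real.rpow_natCast]
    field_simp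
    linarith
  rw [h3, norm_smul, Real.norm_of_nonneg (Real.rpow_nonneg hc.le _), mul_comm]
  gcongr
  exact (hM w (by simpa using hwn)).trans (le_max_left _ _)

section ConvolutionAwayFromSupport

variable {E F : Type*} [NormedAddCommGroup E]
  [NormedAddCommGroup F] [NormedSpace ℝ F] {ψ : E → ℝ} {R : ℝ}

theorem sub_ne_zero_of_mem_tsupport (hR : ∀ y ∈ tsupport ψ, ‖y‖ ≤ R) {x y : E} (hx : R < ‖x‖)
    (hy : y ∈ tsupport ψ) : x - y ≠ 0 := fun h => by
  rw [sub_eq_zero.mp h] at hx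
  exact (hR y hy).not_gt hx

theorem continuous_smul_comp_sub (hψ : Continuous ψ) (hR : ∀ y ∈ tsupport ψ, ‖y‖ ≤ R)
    {h : E → F} (hh : ∀ z, z ≠ 0 → ContinuousAt h z) {x : E} (hx : R < ‖x‖) :
    Continuous fun y => ψ y • h (x - y) := by
  refine continuous_of_tsupport fun y hy => hψ.continuousAt.smul ?_
  have hy' : y ∈ tsupport ψ := closure_mono (Function.support_smul_subset_left ψ _) hy
  exact ContinuousAt.comp (f := fun y => x - y)
    (hh _ (sub_ne_zero_of_mem_tsupport hR hx hy')) (by fun_prop)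

variable [MeasurableSpace E] [BorelSpace E] {ν : Measure E}
  [IsFiniteMeasureOnCompacts ν]

theorem integrable_smul_comp_sub (hψ : Continuous ψ) (hψc : HasCompactSupport ψ)
    (hR : ∀ y ∈ tsupport ψ, ‖y‖ ≤ R)
    {h : E → F} (hh : ∀ z, z ≠ 0 → ContinuousAt h z) {x : E} (hx : R < ‖x‖) :
    Integrable (fun y => ψ y • h (x - y)) ν :=
  (continuous_smul_comp_sub hψ hR hh hx).integrable_of_hasCompactSupport hψc.smul_right

variable [NormedSpace ℝ E] [FiniteDimensional ℝ E]

open Metric Filter Topology in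
theorem hasFDerivAt_integral_smul_comp_sub (hψ : Continuous ψ) (hψc : HasCompactSupport ψ)
    (hR : ∀ y ∈ tsupport ψ, ‖y‖ ≤ R) {h : E → F} (hh : ∀ z, z ≠ 0 → ContDiffAt ℝ 1 h z)
    {x₀ : E} (hx₀ : R < ‖x₀‖) :
    HasFDerivAt (fun x => ∫ y, ψ y • h (x - y) ∂ν) (∫ y, ψ y • fderiv ℝ h (x₀ - y) ∂ν) x₀ := by
  have := FiniteDimensional.proper ℝ E
  have hhc : ∀ z, z ≠ 0 → ContinuousAt h z := fun z hz => (hh z hz).continuousAt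
  have hfc : ∀ z, z ≠ 0 → ContinuousAt (fderiv ℝ h) z := fun z hz =>
    ((hh z hz).fderiv_right (m := 0) (by simp)).continuousAt
  set δ := (‖x₀‖ - R) / 2 with hδ
  have hδ0 : 0 < δ := by rw [hδ]; linarith
  have hball : ∀ x ∈ ball x₀ δ, ‖x₀‖ - δ < ‖x‖ ∧ ‖x‖ < ‖x₀‖ + δ := fun x hx => by
    have h1 : ‖x - x₀‖ < δ := mem_ball_iff_norm.mp hx
    have h2 := (abs_le.mp (abs_norm_sub_norm_le x x₀))
    constructor <;> linarith
  have hK : IsCompact (closedBall (0 : E) (‖x₀‖ + δ + R) \ ball 0 δ) :=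
    (isCompact_closedBall _ _).diff isOpen_ball
  obtain ⟨B, hB⟩ := hK.exists_bound_of_continuousOn (f := fderiv ℝ h) fun z hz =>
    (hfc z (by rintro rfl; exact hz.2 (mem_ball_self hδ0))).continuousWithinAt
  have hzero : ∀ y, y ∉ tsupport ψ → ψ y = 0 := fun y hy => image_eq_zero_of_notMem_tsupport hy
  refine hasFDerivAt_integral_of_dominated_of_fderiv_le (𝕜 := ℝ)
    (F' := fun x y => ψ y • fderiv ℝ h (x - y)) (bound := fun y => ‖ψ y‖ * B)
    (ball_mem_nhds x₀ hδ0) ?_ (integrable_smul_comp_sub hψ hψc hR hhc hx₀)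
    (integrable_smul_comp_sub hψ hψc hR hfc hx₀).aestronglyMeasurable ?_
    ((hψ.integrable_of_hasCompactSupport hψc).norm.mul_const B) ?_
  · filter_upwards [ball_mem_nhds x₀ hδ0] with x hx
    exact (integrable_smul_comp_sub hψ hψc hR hhc
      (by linarith [(hball x hx).1])).aestronglyMeasurable
  · refine Eventually.of_forall fun y x hx => ?_
    by_cases hy : y ∈ tsupport ψ
    · rw [norm_smul]
      gcongr
      have h1 := hball x hx
      have h2 := hR y hy
      refine hB _ ⟨?_, ?_⟩
      · rw [mem_closedBall_zero_iff]
        linarith [norm_sub_le x y]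
      · rw [mem_ball_zero_iff, not_lt]
        linarith [norm_sub_norm_le x y]
    · simp [hzero y hy]
  · refine Eventually.of_forall fun y x hx => ?_
    by_cases hy : y ∈ tsupport ψ
    · have hne := sub_ne_zero_of_mem_tsupport hR (by linarith [(hball x hx).1] : R < ‖x‖) hy
      have h1 := ((hh _ hne).differentiableAt one_ne_zero).hasFDerivAt
      exact ((hasFDerivAt_comp_sub y).mpr h1).const_smul (ψ y)
    · simpa [hzero y hy] using hasFDerivAt_const (0 : F) x

open Filter Topology in
theorem iteratedFDeriv_integral_smul_comp_sub (hψ : Continuous ψ) (hψc : HasCompactSupport ψ)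
    (hR : ∀ y ∈ tsupport ψ, ‖y‖ ≤ R) {h : E → F}
    (hh : ∀ z, z ≠ 0 → ContDiffAt ℝ (⊤ : ℕ∞) h z) (k : ℕ) {x : E} (hx : R < ‖x‖) :
    iteratedFDeriv ℝ k (fun x => ∫ y, ψ y • h (x - y) ∂ν) x =
      ∫ y, ψ y • iteratedFDeriv ℝ k h (x - y) ∂ν := by
  induction k generalizing x with
  | zero =>
    simp only [iteratedFDeriv_zero_eq_comp, Function.comp_apply, ← map_smul]
    exact ((continuousMultilinearCurryFin0 ℝ E
      F).symm.toContinuousLinearEquiv.integral_comp_comm _).symm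
  | succ k ih =>
    have hev : iteratedFDeriv ℝ k (fun x => ∫ y, ψ y • h (x - y) ∂ν) =ᶠ[𝓝 x]
        fun x => ∫ y, ψ y • iteratedFDeriv ℝ k h (x - y) ∂ν := by
      filter_upwards [(isOpen_lt continuous_const continuous_norm).mem_nhds hx] with z hz
      exact ih hz
    have hd := hasFDerivAt_integral_smul_comp_sub (ν := ν) hψ hψc hR
      (h := iteratedFDeriv ℝ k h)
      (fun z hz => (hh z hz).iteratedFDeriv_right (by exact_mod_cast le_top)) hx
    simp only [iteratedFDeriv_succ_eq_comp_left, Function.comp_apply, ← map_smul]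
    rw [hev.fderiv_eq, hd.fderiv]
    exact (ContinuousLinearEquiv.integral_comp_comm (μ := ν) (𝕜 := ℝ)
      (E := E →L[ℝ] E [×k]→L[ℝ] F) (F := E [×(k + 1)]→L[ℝ] F) (continuousMultilinearCurryLeftEquiv ℝ
        (fun _ : Fin (k + 1) => E) F).symm.toContinuousLinearEquiv _).symm

end ConvolutionAwayFromSupport

theorem rpow_le_two_rpow_abs_mul_rpow {r t s : ℝ} (hr : 0 < r) (h1 : r / 2 ≤ t)
    (h2 : t ≤ 2 * r) : t ^ s ≤ 2 ^ |s| * r ^ s := by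
  have ht : 0 < t := by linarith
  rcases le_total 0 s with hs | hs
  · rw [abs_of_nonneg hs, ← Real.mul_rpow two_pos.le hr.le]
    exact Real.rpow_le_rpow ht.le h2 hs
  · calc t ^ s ≤ (r / 2) ^ s := Real.rpow_le_rpow_of_nonpos (by positivity) h1 hs
      _ = 2 ^ |s| * r ^ s := by
        rw [abs_of_nonpos hs, Real.div_rpow hr.le two_pos.le, Real.rpow_neg two_pos.le]
        field_simp

theorem IsKernelOfType.locallyIntegrable {n : ℕ} (hn : 1 ≤ n) {a : ℝ} (ha : 0 < a)
    {K : EuclideanSpace ℝ (Fin n) → ℝ} (hK : IsKernelOfType n a K) : LocallyIntegrable K := by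
  obtain ⟨M, -, hM⟩ := norm_iteratedFDeriv_le_of_homogeneous hK.1 hK.2 0
  have : Nonempty (Fin n) := ⟨⟨0, hn⟩⟩
  have hae : ∀ᵐ x : EuclideanSpace ℝ (Fin n), x ≠ 0 := by simp [ae_iff]
  refine locallyIntegrable_of_norm_le_rpow (C := M) (α := n - a) (by simpa using hn)
    (by simpa using ha) ?_ ?_
  · filter_upwards [hae] with x hx
    simpa using hM x hx
  · have h := hK.1.continuousOn.aestronglyMeasurable
      (measurableSet_singleton _).compl (μ := volume)
    rwa [Measure.restrict_eq_self_of_ae_mem (by simpa using hae)] at h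

/-- **Decay at infinity of the convolution of a test function with a homogeneous
kernel** (Lemma 3.4, Euclidean case): if `g` is a kernel of type `μ > 0` and `ψ` is
smooth and compactly supported, then `ψ ∗ g` is smooth and, for every differentiation
order `k` (every multi-index `β` with `|β| = k`), there are `C, R₀ > 0` with
`|∂^β(ψ ∗ g)(x)| ≤ C |x|^{μ-n-|β|}` for `|x| ≥ R₀`. -/
theorem conv_test_kernel_decay (n : ℕ) (hn : 1 ≤ n) (m : ℝ) (hm : 0 < m)
    (g : EuclideanSpace ℝ (Fin n) → ℝ) (hg : IsKernelOfType n m g)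
    (ψ : EuclideanSpace ℝ (Fin n) → ℝ) (hψ : ContDiff ℝ (⊤ : ℕ∞) ψ)
    (hψc : HasCompactSupport ψ) :
    ContDiff ℝ (⊤ : ℕ∞) (fun x => ∫ y, ψ y * g (x - y)) ∧
    ∀ k : ℕ, ∃ C R₀ : ℝ, 0 < C ∧ 0 < R₀ ∧
      ∀ x : EuclideanSpace ℝ (Fin n), R₀ ≤ ‖x‖ →
        ‖iteratedFDeriv ℝ k (fun x => ∫ y, ψ y * g (x - y)) x‖ ≤
          C * ‖x‖ ^ (m - (n : ℝ) - (k : ℝ)) := by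
  have hsm : ∀ z, z ≠ 0 → ContDiffAt ℝ (⊤ : ℕ∞) g z := fun z hz =>
    hg.1.contDiffAt (isOpen_compl_singleton.mem_nhds hz)
  refine ⟨hψc.contDiff_convolution_left (ContinuousLinearMap.mul ℝ ℝ) hψ
    (hg.locallyIntegrable hn hm), fun k => ?_⟩
  obtain ⟨M, hM0, hM⟩ := norm_iteratedFDeriv_le_of_homogeneous hg.1 hg.2 k
  obtain ⟨R, hR0, hR⟩ := hψc.isCompact.isBounded.exists_pos_norm_le
  set s : ℝ := m - n - k
  have hI : 0 ≤ ∫ y, ‖ψ y‖ := integral_nonneg fun _ => norm_nonneg _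
  refine ⟨(∫ y, ‖ψ y‖) * (M * 2 ^ |s|) + 1, 2 * R, by positivity, by positivity, fun x hx => ?_⟩
  have hx0 : 0 < ‖x‖ := by linarith
  have heq := iteratedFDeriv_integral_smul_comp_sub (ν := volume) hψ.continuous hψc hR hsm k
    (x := x) (by linarith)
  simp only [smul_eq_mul] at heq
  rw [heq]
  calc ‖∫ y, ψ y • iteratedFDeriv ℝ k g (x - y)‖
      ≤ ∫ y, ‖ψ y‖ * (M * (2 ^ |s| * ‖x‖ ^ s)) := by
        refine norm_integral_le_of_norm_le
          ((hψ.continuous.integrable_of_hasCompactSupport hψc).norm.mul_const _)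
          (Filter.Eventually.of_forall fun y => ?_)
        by_cases hy : y ∈ tsupport ψ
        · have hyR := hR y hy
          rw [norm_smul]
          gcongr
          refine (hM _ (sub_ne_zero_of_mem_tsupport hR (by linarith) hy)).trans ?_
          gcongr
          exact rpow_le_two_rpow_abs_mul_rpow hx0 (by linarith [norm_sub_norm_le x y])
            (by linarith [norm_sub_le x y])
        · simp [image_eq_zero_of_notMem_tsupport hy]
    _ = (∫ y, ‖ψ y‖) * (M * 2 ^ |s|) * ‖x‖ ^ s := by rw [integral_mul_const]; ring
    _ ≤ ((∫ y, ‖ψ y‖) * (M * 2 ^ |s|) + 1) * ‖x‖ ^ s := by gcongr; linarith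
end
end

section
/- Shell estimate for convolutions with zero-average L¹ data: let n ≥ 1, let K be a kernel of type α on ℝⁿ with 0 < α < n, and let f ∈ L¹(ℝⁿ) satisfy ∫_{ℝⁿ} f(y) dy = 0. Then R^{−α} ∫_{R < |x| < 2R} |(K ∗ f)(x)| dx → 0 as R → ∞. -/
noncomputable section
open MeasureTheory ENNReal

/-- The spherical shell of inner radius `R` and outer radius `2 * R`. -/
def shell (n : ℕ) (R : ℝ) : Set (EuclideanSpace ℝ (Fin n)) :=
  {x | R < ‖x‖ ∧ ‖x‖ < 2 * R}

lemma measurableSet_shell (n : ℕ) (R : ℝ) : MeasurableSet (shell n R) :=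
  (measurableSet_lt measurable_const measurable_norm).inter
    (measurableSet_lt measurable_norm measurable_const)

lemma volume_shell_ne_top (n : ℕ) (R : ℝ) : volume (shell n R) ≠ ∞ := by
  refine ne_top_of_le_ne_top (measure_ball_lt_top (x := 0) (r := 2 * R)).ne
    (measure_mono fun x hx => ?_)
  simpa using hx.2

lemma setLIntegral_shell_eq {n : ℕ} {R : ℝ} (hR : 0 < R)
    {g : EuclideanSpace ℝ (Fin n) → ℝ≥0∞} (hg : Measurable g) :
    ∫⁻ x in shell n R, g x = ENNReal.ofReal (R ^ n) * ∫⁻ z in shell n 1, g (R • z) := by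
  have hpre : (R • ·) ⁻¹' shell n R = shell n 1 := by
    ext z
    simp only [shell, Set.mem_preimage, Set.mem_ofPred_eq, norm_smul, Real.norm_eq_abs,
      abs_of_pos hR]
    constructor
    · rintro ⟨h1, h2⟩; constructor <;> nlinarith
    · rintro ⟨h1, h2⟩; constructor <;> nlinarith
  have h := setLIntegral_map (μ := volume) (measurableSet_shell n R) hg
    (measurable_const_smul (α := EuclideanSpace ℝ (Fin n)) R)
  rw [hpre, Measure.map_addHaar_smul _ hR.ne', Measure.restrict_smul, lintegral_smul_measure,
    finrank_euclideanSpace_fin, abs_of_pos (by positivity), smul_eq_mul] at h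
  rw [← h, ← mul_assoc, ← ENNReal.ofReal_mul (by positivity), mul_inv_cancel₀ (by positivity),
    ENNReal.ofReal_one, one_mul]

lemma exists_abs_le_rpow_norm {n : ℕ} {s : ℝ} {K : EuclideanSpace ℝ (Fin n) → ℝ}
    (hc : ContinuousOn K {0}ᶜ) (h0 : K 0 = 0)
    (hom : ∀ c : ℝ, 0 < c → ∀ x, K (c • x) = c ^ s * K x) :
    ∃ M : ℝ, 0 ≤ M ∧ ∀ x, |K x| ≤ M * ‖x‖ ^ s := by
  obtain ⟨M, hM⟩ := (isCompact_sphere (0 : EuclideanSpace ℝ (Fin n)) 1).exists_bound_of_continuousOn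
    (hc.mono fun x hx => by
      rintro rfl
      simp at hx)
  refine ⟨max M 0, le_max_right _ _, fun x => ?_⟩
  rcases eq_or_ne x 0 with rfl | hx
  · rw [h0, abs_zero]
    positivity
  · have hpos := norm_pos_iff.2 hx
    have hx' : x = ‖x‖ • (‖x‖⁻¹ • x) := by rw [smul_smul, mul_inv_cancel₀ hpos.ne', one_smul]
    have hu : |K (‖x‖⁻¹ • x)| ≤ max M 0 :=
      (hM _ (by simp [norm_smul, hpos.ne'])).trans (le_max_left _ _)
    calc |K x| = ‖x‖ ^ s * |K (‖x‖⁻¹ • x)| := by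
          conv_lhs => rw [hx', hom _ hpos, abs_mul, abs_of_pos (Real.rpow_pos_of_pos hpos _)]
      _ ≤ ‖x‖ ^ s * max M 0 := by gcongr
      _ = _ := mul_comm _ _

/-- The `L¹` norm on the unit shell of the increment of `K` by the translation `w`. -/
def shellModulus (n : ℕ) (K : EuclideanSpace ℝ (Fin n) → ℝ) (w : EuclideanSpace ℝ (Fin n)) :
    ℝ≥0∞ :=
  ∫⁻ z in shell n 1, ‖K (z - w) - K z‖ₑ

lemma measurable_shellModulus {n : ℕ} {K : EuclideanSpace ℝ (Fin n) → ℝ} (hm : Measurable K) :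
    Measurable (shellModulus n K) := by
  unfold shellModulus
  refine Measurable.lintegral_prod_right' (f := fun p : EuclideanSpace ℝ (Fin n) ×
    EuclideanSpace ℝ (Fin n) => ‖K (p.2 - p.1) - K p.2‖ₑ) ?_
  fun_prop

lemma enorm_le_of_norm_ge_half {n : ℕ} {M s : ℝ} (hM : 0 ≤ M) (hs : s ≤ 0)
    {K : EuclideanSpace ℝ (Fin n) → ℝ}
    (hb : ∀ x, |K x| ≤ M * ‖x‖ ^ s) {x : EuclideanSpace ℝ (Fin n)} (hx : 1 / 2 ≤ ‖x‖) :
    ‖K x‖ₑ ≤ ENNReal.ofReal (M * (1 / 2) ^ s) := by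
  rw [← ofReal_norm]
  refine ENNReal.ofReal_le_ofReal ((hb x).trans ?_)
  gcongr ?_ * ?_
  exact Real.rpow_le_rpow_of_nonpos (by norm_num) hx hs

lemma tendsto_shellModulus {n : ℕ} {M s : ℝ} (hM : 0 ≤ M) (hs : s ≤ 0)
    {K : EuclideanSpace ℝ (Fin n) → ℝ} (hm : Measurable K) (hc : ContinuousOn K {0}ᶜ)
    (hb : ∀ x, |K x| ≤ M * ‖x‖ ^ s) :
    Filter.Tendsto (shellModulus n K) (nhds 0) (nhds 0) := by
  set C := ENNReal.ofReal (M * (1 / 2) ^ s) with hC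
  have key := tendsto_lintegral_filter_of_dominated_convergence
    (μ := (volume : Measure (EuclideanSpace ℝ (Fin n))).restrict (shell n 1))
    (l := nhds (0 : EuclideanSpace ℝ (Fin n))) (F := fun w z => ‖K (z - w) - K z‖ₑ)
    (f := fun _ => 0) (fun _ => C + C) ?_ ?_ ?_ ?_
  · rw [lintegral_zero] at key
    exact key
  · exact Filter.Eventually.of_forall fun w => by fun_prop
  · filter_upwards [Metric.ball_mem_nhds (0 : EuclideanSpace ℝ (Fin n)) one_half_pos] with w hw
    filter_upwards [ae_restrict_mem (measurableSet_shell n 1)] with z hz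
    have hw' : ‖w‖ < 1 / 2 := by simpa using hw
    refine enorm_sub_le.trans (add_le_add (enorm_le_of_norm_ge_half hM hs hb ?_)
      (enorm_le_of_norm_ge_half hM hs hb ?_))
    · have := norm_sub_norm_le z w
      linarith [hz.1]
    · linarith [hz.1]
  · simpa [hC] using ENNReal.mul_ne_top (by simp) (volume_shell_ne_top n 1)
  · filter_upwards [ae_restrict_mem (measurableSet_shell n 1)] with z hz
    have hz0 : z ≠ 0 := norm_pos_iff.1 (one_pos.trans hz.1)
    have hcz : ContinuousAt K (z - 0) := by
      rw [sub_zero]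
      exact hc.continuousAt (isOpen_compl_singleton.mem_nhds hz0)
    have hcw : ContinuousAt (fun w => ‖K (z - w) - K z‖ₑ) 0 :=
      ((hcz.comp (f := fun w => z - w) (by fun_prop)).sub continuousAt_const).enorm
    simpa [ContinuousAt] using hcw

lemma exists_shellModulus_le {n : ℕ} (hn : 1 ≤ n) {M s : ℝ} (hM : 0 ≤ M) (hs : s ≤ 0)
    (hns : 0 < s + n) {K : EuclideanSpace ℝ (Fin n) → ℝ} (hm : Measurable K)
    (hb : ∀ x, |K x| ≤ M * ‖x‖ ^ s) :
    ∃ C : ℝ≥0∞, C ≠ ∞ ∧ ∀ w, shellModulus n K w ≤ C := by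
  have : Nonempty (Fin n) := ⟨⟨0, hn⟩⟩
  have hint : IntegrableOn (fun x : EuclideanSpace ℝ (Fin n) => M * ‖x‖ ^ s)
      (Metric.ball 0 1) := by
    refine Integrable.const_mul ?_ M
    refine (integrableOn_fun_norm_addHaar volume (f := fun t : ℝ => t ^ s)).2 ?_
    rw [finrank_euclideanSpace_fin]
    refine ((intervalIntegral.integrableOn_Ioo_rpow_iff (s := s + n - 1) one_pos).2
      (by linarith)).congr_fun (fun t ht => ?_) measurableSet_Ioo
    simp only [smul_eq_mul]
    rw [← Real.rpow_natCast, ← Real.rpow_add ht.1, Nat.cast_sub hn]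
    congr 1
    push_cast
    ring
  have hK : IntegrableOn K (Metric.ball 0 1) :=
    hint.mono' hm.aestronglyMeasurable (Filter.Eventually.of_forall hb)
  set A := ∫⁻ x in Metric.ball (0 : EuclideanSpace ℝ (Fin n)) 1, ‖K x‖ₑ
  set D := ENNReal.ofReal (M * (1 / 2) ^ s) with hD
  have hbound : ∀ w, ∫⁻ z in shell n 1, ‖K (z - w)‖ₑ ≤ A + D * volume (shell n 1) := by
    intro w
    calc ∫⁻ z in shell n 1, ‖K (z - w)‖ₑ
        ≤ ∫⁻ z in shell n 1, ((Metric.ball 0 1).indicator (fun x => ‖K x‖ₑ) (z - w) + D) := by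
          refine lintegral_mono fun z => ?_
          by_cases hz : z - w ∈ Metric.ball (0 : EuclideanSpace ℝ (Fin n)) 1
          · rw [Set.indicator_of_mem hz]
            exact le_self_add
          · rw [Set.indicator_of_notMem hz, zero_add]
            refine enorm_le_of_norm_ge_half hM hs hb ?_
            have : 1 ≤ ‖z - w‖ := by simpa using hz
            linarith
      _ = (∫⁻ z in shell n 1, (Metric.ball 0 1).indicator (fun x => ‖K x‖ₑ) (z - w)) +
            D * volume (shell n 1) := by
          rw [lintegral_add_right _ measurable_const, setLIntegral_const]
      _ ≤ (∫⁻ z, (Metric.ball 0 1).indicator (fun x => ‖K x‖ₑ) (z - w)) +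
            D * volume (shell n 1) := by
          gcongr
          exact Measure.restrict_le_self
      _ = A + D * volume (shell n 1) := by
          rw [lintegral_sub_right_eq_self ((Metric.ball 0 1).indicator fun x => ‖K x‖ₑ) w,
            lintegral_indicator measurableSet_ball]
  have hfin : A + D * volume (shell n 1) ≠ ∞ :=
    ENNReal.add_ne_top.2 ⟨hK.2.ne, ENNReal.mul_ne_top (by simp [hD]) (volume_shell_ne_top n 1)⟩
  refine ⟨_, ENNReal.add_ne_top.2 ⟨hfin, hfin⟩, fun w => ?_⟩
  calc shellModulus n K w
      ≤ ∫⁻ z in shell n 1, (‖K (z - w)‖ₑ + ‖K (z - 0)‖ₑ) :=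
        lintegral_mono fun z => by
          rw [sub_zero]
          exact enorm_sub_le
    _ = (∫⁻ z in shell n 1, ‖K (z - w)‖ₑ) + ∫⁻ z in shell n 1, ‖K (z - 0)‖ₑ :=
        lintegral_add_left (by fun_prop) _
    _ ≤ _ := add_le_add (hbound w) (hbound 0)

/-- A convolution with zero-average data is controlled by the increments of the kernel. -/
lemma enorm_integral_le_of_integral_eq_zero {n : ℕ} {K f : EuclideanSpace ℝ (Fin n) → ℝ}
    (hf : Integrable f) (hf0 : ∫ y, f y = 0) (x : EuclideanSpace ℝ (Fin n)) :
    ‖∫ y, K (x - y) * f y‖ₑ ≤ ∫⁻ y, ‖K (x - y) - K x‖ₑ * ‖f y‖ₑ := by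
  by_cases hi : Integrable fun y => K (x - y) * f y
  · have h : ∫ y, K (x - y) * f y = ∫ y, (K (x - y) - K x) * f y := by
      simp_rw [sub_mul]
      rw [integral_sub hi (hf.const_mul _), integral_const_mul, hf0, mul_zero, sub_zero]
    rw [h]
    refine (enorm_integral_le_lintegral_enorm _).trans_eq ?_
    simp_rw [enorm_mul]
  · rw [integral_undef hi, enorm_zero]
    exact zero_le

lemma setLIntegral_shell_sub {n : ℕ} {a R : ℝ} (hR : 0 < R)
    {K : EuclideanSpace ℝ (Fin n) → ℝ} (hm : Measurable K)
    (hom : ∀ c : ℝ, 0 < c → ∀ x, K (c • x) = c ^ (a - n) * K x)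
    (y : EuclideanSpace ℝ (Fin n)) :
    ENNReal.ofReal (R ^ (-a)) * ∫⁻ x in shell n R, ‖K (x - y) - K x‖ₑ =
      shellModulus n K (R⁻¹ • y) := by
  rw [setLIntegral_shell_eq hR (by fun_prop)]
  have h : ∀ z, ‖K (R • z - y) - K (R • z)‖ₑ =
      ENNReal.ofReal (R ^ (a - n)) * ‖K (z - R⁻¹ • y) - K z‖ₑ := by
    intro z
    have hz : R • z - y = R • (z - R⁻¹ • y) := by
      rw [smul_sub, smul_smul, mul_inv_cancel₀ hR.ne', one_smul]
    rw [hz, hom R hR, hom R hR, ← mul_sub, enorm_mul,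
      Real.enorm_of_nonneg (Real.rpow_nonneg hR.le _)]
  simp_rw [h]
  rw [lintegral_const_mul _ (by fun_prop), ← mul_assoc, ← mul_assoc,
    ← ENNReal.ofReal_mul (by positivity), ← ENNReal.ofReal_mul (by positivity),
    ← Real.rpow_natCast, ← Real.rpow_add hR, ← Real.rpow_add hR,
    show -a + n + (a - n) = (0 : ℝ) by ring, Real.rpow_zero, ENNReal.ofReal_one, one_mul]
  rfl

lemma enorm_shell_integral_le {n : ℕ} {a R : ℝ} (hR : 0 < R)
    {K f : EuclideanSpace ℝ (Fin n) → ℝ} (hm : Measurable K)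
    (hom : ∀ c : ℝ, 0 < c → ∀ x, K (c • x) = c ^ (a - n) * K x)
    (hf : Integrable f) (hf0 : ∫ y, f y = 0) :
    ‖R ^ (-a) * ∫ x in shell n R, |∫ y, K (x - y) * f y|‖ₑ ≤
      ∫⁻ y, shellModulus n K (R⁻¹ • y) * ‖f y‖ₑ := by
  rw [enorm_mul, Real.enorm_of_nonneg (Real.rpow_nonneg hR.le _)]
  calc ENNReal.ofReal (R ^ (-a)) * ‖∫ x in shell n R, |∫ y, K (x - y) * f y|‖ₑ
      ≤ ENNReal.ofReal (R ^ (-a)) *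
          ∫⁻ x in shell n R, ∫⁻ y, ‖K (x - y) - K x‖ₑ * ‖f y‖ₑ := by
        gcongr
        refine (enorm_integral_le_lintegral_enorm _).trans (lintegral_mono fun x => ?_)
        rw [Real.enorm_abs]
        exact enorm_integral_le_of_integral_eq_zero hf hf0 x
    _ = ENNReal.ofReal (R ^ (-a)) *
          ∫⁻ y, ∫⁻ x in shell n R, ‖K (x - y) - K x‖ₑ * ‖f y‖ₑ := by
        rw [lintegral_lintegral_swap]
        have h1 : Measurable fun p : EuclideanSpace ℝ (Fin n) × EuclideanSpace ℝ (Fin n) =>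
            ‖K (p.1 - p.2) - K p.1‖ₑ := by fun_prop
        exact h1.aemeasurable.mul hf.1.comp_snd.enorm
    _ = ∫⁻ y, shellModulus n K (R⁻¹ • y) * ‖f y‖ₑ := by
        rw [← lintegral_const_mul' _ _ ENNReal.ofReal_ne_top]
        refine lintegral_congr fun y => ?_
        rw [lintegral_mul_const _ (by fun_prop), ← mul_assoc, setLIntegral_shell_sub hR hm hom]

lemma tendsto_lintegral_shellModulus {n : ℕ} (hn : 1 ≤ n) {M s : ℝ} (hM : 0 ≤ M) (hs : s ≤ 0)
    (hns : 0 < s + n) {K f : EuclideanSpace ℝ (Fin n) → ℝ} (hm : Measurable K)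
    (hc : ContinuousOn K {0}ᶜ) (hb : ∀ x, |K x| ≤ M * ‖x‖ ^ s) (hf : Integrable f) :
    Filter.Tendsto (fun R : ℝ => ∫⁻ y, shellModulus n K (R⁻¹ • y) * ‖f y‖ₑ)
      Filter.atTop (nhds 0) := by
  obtain ⟨C, hC, hCb⟩ := exists_shellModulus_le hn hM hs hns hm hb
  have hmeas := measurable_shellModulus hm
  have key := tendsto_lintegral_filter_of_dominated_convergence'
    (μ := (volume : Measure (EuclideanSpace ℝ (Fin n))))
    (l := Filter.atTop (α := ℝ)) (F := fun R y => shellModulus n K (R⁻¹ • y) * ‖f y‖ₑ)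
    (f := fun _ => 0) (fun y => C * ‖f y‖ₑ) ?_ ?_ ?_ ?_
  · simpa using key
  · exact Filter.Eventually.of_forall fun R =>
      (hmeas.comp (measurable_const_smul R⁻¹)).aemeasurable.mul hf.1.enorm
  · exact Filter.Eventually.of_forall fun R => Filter.Eventually.of_forall fun y => by
      gcongr
      exact hCb _
  · rw [lintegral_const_mul' _ _ hC]
    exact ENNReal.mul_ne_top hC hf.2.ne
  · refine Filter.Eventually.of_forall fun y => ?_
    have hy : Filter.Tendsto (fun R : ℝ => R⁻¹ • y) Filter.atTop (nhds 0) := by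
      simpa using (tendsto_inv_atTop_zero (𝕜 := ℝ)).smul_const y
    simpa using ENNReal.Tendsto.mul_const ((tendsto_shellModulus hM hs hm hc hb).comp hy)
      (Or.inr enorm_ne_top)

/-- **Shell estimate for convolutions with zero-average `L¹` data** (Theorem 3.14,
Euclidean case): if `K` is a kernel of type `a ∈ (0,n)` and `f ∈ L¹(ℝⁿ)` has vanishing
integral, then `R^{-a} ∫_{R<|x|<2R} |K ∗ f| dx → 0` as `R → ∞`. -/
theorem shell_estimate (n : ℕ) (hn : 1 ≤ n) (a : ℝ) (ha0 : 0 < a) (han : a < n)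
    (K : EuclideanSpace ℝ (Fin n) → ℝ) (hK : IsKernelOfType n a K)
    (f : EuclideanSpace ℝ (Fin n) → ℝ) (hf : Integrable f volume)
    (hf0 : (∫ y, f y) = 0) :
    Filter.Tendsto
      (fun R : ℝ => R ^ (-a) *
        ∫ x in {x : EuclideanSpace ℝ (Fin n) | R < ‖x‖ ∧ ‖x‖ < 2 * R},
          |∫ y, K (x - y) * f y|)
      Filter.atTop (nhds 0) := by
  classical
  set L : EuclideanSpace ℝ (Fin n) → ℝ := ({0}ᶜ : Set _).indicator K with hL
  have hLK : ∀ x ≠ 0, L x = K x := fun x hx => Set.indicator_of_mem (by simpa using hx) K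
  have hL0 : L 0 = 0 := Set.indicator_of_notMem (by simp) K
  have hLc : ContinuousOn L {0}ᶜ := hK.1.continuousOn.congr hLK
  have hLm : Measurable L := by
    rw [hL, ← Set.piecewise_eq_indicator]
    exact hK.1.continuousOn.measurable_piecewise continuousOn_const
      (measurableSet_singleton 0).compl
  have hLhom : ∀ c : ℝ, 0 < c → ∀ x, L (c • x) = c ^ (a - n) * L x := by
    intro c hc x
    rcases eq_or_ne x 0 with rfl | hx
    · simp [hL0]
    · rw [hLK x hx, hLK _ (smul_ne_zero hc.ne' hx), hK.2 c hc x hx]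
  have hconv : ∀ x, ∫ y, K (x - y) * f y = ∫ y, L (x - y) * f y := by
    have : Nonempty (Fin n) := ⟨⟨0, hn⟩⟩
    intro x
    refine integral_congr_ae ?_
    filter_upwards [Measure.ae_ne volume x] with y hy
    rw [hLK _ (sub_ne_zero.2 hy.symm)]
  obtain ⟨M, hM, hb⟩ := exists_abs_le_rpow_norm hLc hL0 hLhom
  simp_rw [hconv]
  rw [tendsto_zero_iff_enorm_tendsto_zero]
  refine tendsto_of_tendsto_of_tendsto_of_le_of_le' tendsto_const_nhds
    (tendsto_lintegral_shellModulus hn hM (by linarith) (by linarith) hLm hLc hb hf)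
    (Filter.Eventually.of_forall fun _ => zero_le) ?_
  filter_upwards [Filter.eventually_gt_atTop 0] with R hR
  exact enorm_shell_integral_le hR hLm hLhom hf hf0
end
end

section
/- Local Sobolev mapping property of truncated kernels of type 1: let n ≥ 2, 1 < p < ∞, let s ≥ 1 be an integer, let χ₀ be a fixed smooth compactly supported function on ℝⁿ, let K be a kernel of type 1 on ℝⁿ, let ψ be a smooth compactly supported function with ψ ≡ 1 in a neighborhood of the origin, and let D ⊂ ℝⁿ be a bounded open set. Then there exists a constant C such that for every smooth function f on ℝⁿ with Σ_{|β| ≤ s−1} ‖∂^β f‖_{L^p(ℝⁿ)} < ∞, one has Σ_{|β| ≤ s} ‖∂^β((χ₀ f) ∗ (ψK))‖_{L^p(D)} ≤ C · Σ_{|β| ≤ s−1} ‖∂^β f‖_{L^p(ℝⁿ)}. -/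
noncomputable section
open MeasureTheory ENNReal

section

variable {n : ℕ}

/-- Symbol-type bounds of degree `a`, up to second order, away from the origin. -/
def SymbolBound (a A : ℝ) (m : EuclideanSpace ℝ (Fin n) → ℝ) : Prop :=
  ∀ x, x ≠ 0 → ∀ i : ℕ, i ≤ 2 → ‖iteratedFDeriv ℝ i m x‖ ≤ A * ‖x‖ ^ (a - (i : ℝ))

theorem SymbolBound.nonneg {a A : ℝ} {m : EuclideanSpace ℝ (Fin n) → ℝ}
    (hm : SymbolBound a A m) {x : EuclideanSpace ℝ (Fin n)} (hx : x ≠ 0) : 0 ≤ A := by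
  have h := (norm_nonneg _).trans (hm x hx 0 (by norm_num))
  exact nonneg_of_mul_nonneg_left h (Real.rpow_pos_of_pos (norm_pos_iff.2 hx) _)

theorem SymbolBound.mul {a b A B : ℝ} {m₁ m₂ : EuclideanSpace ℝ (Fin n) → ℝ}
    (h₁ : SymbolBound a A m₁) (h₂ : SymbolBound b B m₂)
    (c₁ : ContDiffOn ℝ 2 m₁ {0}ᶜ) (c₂ : ContDiffOn ℝ 2 m₂ {0}ᶜ) :
    SymbolBound (a + b) (4 * A * B) (fun x => m₁ x * m₂ x) := by
  intro x hx i hi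
  have ho : IsOpen ({0}ᶜ : Set (EuclideanSpace ℝ (Fin n))) := isOpen_compl_singleton
  have hxm : x ∈ ({0}ᶜ : Set (EuclideanSpace ℝ (Fin n))) := hx
  have key := norm_iteratedFDerivWithin_mul_le c₁ c₂ ho.uniqueDiffOn hxm (n := i)
    (by exact_mod_cast hi)
  have hA := h₁.nonneg hx
  have hB := h₂.nonneg hx
  have hx' := norm_pos_iff.2 hx
  rw [iteratedFDerivWithin_of_isOpen i ho hxm] at key
  refine key.trans ?_
  calc ∑ j ∈ Finset.range (i + 1), (i.choose j : ℝ) * ‖iteratedFDerivWithin ℝ j m₁ {0}ᶜ x‖ *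
        ‖iteratedFDerivWithin ℝ (i - j) m₂ {0}ᶜ x‖
      ≤ ∑ j ∈ Finset.range (i + 1), (i.choose j : ℝ) * (A * B * ‖x‖ ^ (a + b - (i : ℝ))) := by
        refine Finset.sum_le_sum fun j hj => ?_
        have hji : j ≤ i := Nat.lt_succ_iff.1 (Finset.mem_range.1 hj)
        rw [mul_assoc]
        refine mul_le_mul_of_nonneg_left ?_ (by positivity)
        rw [iteratedFDerivWithin_of_isOpen j ho hxm, iteratedFDerivWithin_of_isOpen (i - j) ho hxm]
        refine (mul_le_mul (h₁ x hx j (hji.trans hi)) (h₂ x hx (i - j) (by omega))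
          (norm_nonneg _) (by positivity)).trans (le_of_eq ?_)
        rw [mul_mul_mul_comm, ← Real.rpow_add hx']
        congr 2
        push_cast [hji]
        ring
    _ = 2 ^ i * (A * B * ‖x‖ ^ (a + b - (i : ℝ))) := by
        rw [← Finset.sum_mul]
        congr 1
        exact_mod_cast Nat.sum_range_choose i
    _ ≤ 4 * (A * B * ‖x‖ ^ (a + b - (i : ℝ))) := by
        refine mul_le_mul_of_nonneg_right ?_ (by positivity)
        calc (2 : ℝ) ^ i ≤ 2 ^ 2 := pow_le_pow_right₀ (by norm_num) hi
          _ = 4 := by norm_num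
    _ = _ := by ring

theorem SymbolBound.comp_smul {A : ℝ} {η : EuclideanSpace ℝ (Fin n) → ℝ}
    (h : SymbolBound 0 A η) (c : ContDiff ℝ (⊤ : ℕ∞) η) {r : ℝ} (hr : 0 < r) :
    SymbolBound 0 A (fun x => η (r • x)) := by
  intro x hx i hi
  have hx' := norm_pos_iff.2 hx
  rw [iteratedFDeriv_comp_const_smul r (c.of_le (by exact_mod_cast le_top)), norm_smul,
    norm_pow, Real.norm_of_nonneg hr.le]
  refine (mul_le_mul_of_nonneg_left (h (r • x) (smul_ne_zero hr.ne' hx) i hi)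
    (by positivity)).trans (le_of_eq ?_)
  rw [norm_smul, Real.norm_of_nonneg hr.le, Real.mul_rpow hr.le hx'.le, zero_sub,
    Real.rpow_neg hr.le, Real.rpow_natCast]
  field_simp

theorem exists_symbolBound_zero {η : EuclideanSpace ℝ (Fin n) → ℝ}
    (c : ContDiff ℝ (⊤ : ℕ∞) η) (hc : HasCompactSupport η) :
    ∃ A, 0 ≤ A ∧ SymbolBound 0 A η := by
  have : ∀ i : ℕ, ∃ A, 0 ≤ A ∧ ∀ x, ‖x‖ ^ i * ‖iteratedFDeriv ℝ i η x‖ ≤ A := by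
    intro i
    have hcont : Continuous fun x => ‖x‖ ^ i * ‖iteratedFDeriv ℝ i η x‖ :=
      (continuous_norm.pow i).mul
        (c.continuous_iteratedFDeriv (by exact_mod_cast le_top)).norm
    obtain ⟨A, hA⟩ := hcont.bounded_above_of_compact_support
      (((hc.iteratedFDeriv i).norm).mul_left)
    refine ⟨A, (norm_nonneg _).trans (hA 0), fun x => (le_abs_self _).trans (hA x)⟩
  choose A hA0 hA using this
  refine ⟨A 0 + A 1 + A 2, by linarith [hA0 0, hA0 1, hA0 2], fun x hx i hi => ?_⟩
  have hx' := norm_pos_iff.2 hx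
  rw [zero_sub, Real.rpow_neg hx'.le, Real.rpow_natCast, ← div_eq_mul_inv, le_div_iff₀
    (by positivity), mul_comm]
  refine (hA i x).trans ?_
  interval_cases i <;> linarith [hA0 0, hA0 1, hA0 2]

theorem SymbolBound.one_sub {A : ℝ} {η : EuclideanSpace ℝ (Fin n) → ℝ}
    (h : SymbolBound 0 A η) (c : ContDiff ℝ (⊤ : ℕ∞) η) :
    SymbolBound 0 (1 + A) (fun x => 1 - η x) := by
  intro x hx i hi
  have hx' := norm_pos_iff.2 hx
  have e : (fun x => 1 - η x) = (fun _ => (1 : ℝ)) - η := rfl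
  rw [e, iteratedFDeriv_sub contDiff_const (c.of_le (by exact_mod_cast le_top))]
  refine (norm_sub_le _ _).trans ?_
  rw [add_mul]
  refine add_le_add ?_ (h x hx i hi)
  rcases Nat.eq_zero_or_pos i with rfl | hi0
  · simp
  · rw [iteratedFDeriv_const_of_ne hi0.ne']
    simp only [Pi.zero_apply, norm_zero]
    positivity

theorem IsKernelOfType.exists_symbolBound {K : EuclideanSpace ℝ (Fin n) → ℝ} {a : ℝ}
    (hK : IsKernelOfType n a K) : ∃ A, 0 ≤ A ∧ SymbolBound (a - n) A K := by
  have ho : IsOpen ({0}ᶜ : Set (EuclideanSpace ℝ (Fin n))) := isOpen_compl_singleton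
  have : ∀ i : ℕ, ∃ A, 0 ≤ A ∧ ∀ x ∈ Metric.sphere (0 : EuclideanSpace ℝ (Fin n)) 1,
      ‖iteratedFDeriv ℝ i K x‖ ≤ A := by
    intro i
    have hcont : ContinuousOn (iteratedFDeriv ℝ i K) (Metric.sphere 0 1) := by
      have h := (hK.1.continuousOn_iteratedFDerivWithin (m := i) (by exact_mod_cast le_top)
        ho.uniqueDiffOn).congr (g := iteratedFDeriv ℝ i K)
          fun x hx => (iteratedFDerivWithin_of_isOpen i ho hx).symm
      refine h.mono fun x hx => ?_
      rintro rfl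
      simp at hx
    obtain ⟨A, hA⟩ := (isCompact_sphere (0 : EuclideanSpace ℝ (Fin n)) 1).exists_bound_of_continuousOn
      hcont
    exact ⟨max A 0, le_max_right _ _, fun x hx => (hA x hx).trans (le_max_left _ _)⟩
  choose A hA0 hA using this
  refine ⟨A 0 + A 1 + A 2, by linarith [hA0 0, hA0 1, hA0 2], fun x hx i hi => ?_⟩
  have hx' := norm_pos_iff.2 hx
  have hmem : ‖x‖⁻¹ • x ∈ Metric.sphere (0 : EuclideanSpace ℝ (Fin n)) 1 := by
    simp [norm_smul, hx'.ne']
  let g : EuclideanSpace ℝ (Fin n) ≃L[ℝ] EuclideanSpace ℝ (Fin n) :=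
    ContinuousLinearEquiv.smulLeft (Units.mk0 ‖x‖⁻¹ (inv_ne_zero hx'.ne'))
  have hg : ∀ y, g y = ‖x‖⁻¹ • y := fun y => rfl
  have hpre : g ⁻¹' {0}ᶜ = {0}ᶜ := by
    ext y; simp
  have hgx : g x ∈ ({0}ᶜ : Set (EuclideanSpace ℝ (Fin n))) := by
    simpa using hx
  have e1 : iteratedFDeriv ℝ i K x =
      ‖x‖ ^ (a - n) • (iteratedFDeriv ℝ i K (g x)).compContinuousLinearMap fun _ => ↑g := by
    have h1 := g.iteratedFDerivWithin_comp_right K ho.uniqueDiffOn hgx i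
    rw [hpre, iteratedFDerivWithin_of_isOpen i ho (show x ∈ {0}ᶜ from hx),
      iteratedFDerivWithin_of_isOpen i ho hgx] at h1
    rw [← h1]
    have hcd : ContDiffAt ℝ i (K ∘ g) x := by
      refine ContDiffAt.comp x ?_ g.contDiff.contDiffAt
      exact (hK.1.contDiffAt (ho.mem_nhds hgx)).of_le (by exact_mod_cast le_top)
    rw [← iteratedFDeriv_const_smul_apply hcd]
    refine Filter.EventuallyEq.eq_of_nhds (Filter.EventuallyEq.iteratedFDeriv (𝕜 := ℝ) ?_ i)
    filter_upwards [ho.mem_nhds (show x ∈ {0}ᶜ from hx)] with y hy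
    have := hK.2 ‖x‖ hx' (‖x‖⁻¹ • y) (smul_ne_zero (inv_ne_zero hx'.ne') hy)
    rw [smul_smul, mul_inv_cancel₀ hx'.ne', one_smul] at this
    simpa [hg] using this
  rw [e1, norm_smul, Real.norm_of_nonneg (by positivity)]
  have hgn : ‖(g : EuclideanSpace ℝ (Fin n) →L[ℝ] EuclideanSpace ℝ (Fin n))‖ ≤ ‖x‖⁻¹ := by
    refine ContinuousLinearMap.opNorm_le_bound _ (by positivity) fun y => ?_
    simp [hg, norm_smul]
  have h2 := ContinuousMultilinearMap.norm_compContinuousLinearMap_le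
    (iteratedFDeriv ℝ i K (g x)) (fun _ => (g : EuclideanSpace ℝ (Fin n) →L[ℝ] _))
  rw [Finset.prod_const, Finset.card_univ, Fintype.card_fin] at h2
  have h3 : ‖iteratedFDeriv ℝ i K (g x)‖ ≤ A 0 + A 1 + A 2 := by
    refine (hA i _ hmem).trans ?_
    interval_cases i <;> linarith [hA0 0, hA0 1, hA0 2]
  have hS : 0 ≤ A 0 + A 1 + A 2 := (norm_nonneg _).trans h3
  calc _ ≤ ‖x‖ ^ (a - n) * ((A 0 + A 1 + A 2) * (‖x‖⁻¹) ^ i) := by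
        refine mul_le_mul_of_nonneg_left (h2.trans ?_) (by positivity)
        gcongr
    _ = _ := by
        rw [Real.rpow_sub hx' (a - n), Real.rpow_natCast, inv_pow]
        ring

end

section

variable {n : ℕ}

theorem integrable_rpow_norm_closedBall (hn : 2 ≤ n) {r : ℝ} (hr : 0 < r) :
    Integrable (fun x : EuclideanSpace ℝ (Fin n) =>
      (Set.Iic r).indicator (fun t : ℝ => t ^ (1 - (n : ℝ))) ‖x‖) ∧
    ∫ x : EuclideanSpace ℝ (Fin n),
      (Set.Iic r).indicator (fun t : ℝ => t ^ (1 - (n : ℝ))) ‖x‖ =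
        n * volume.real (Metric.ball (0 : EuclideanSpace ℝ (Fin n)) 1) * r := by
  have : Nonempty (Fin n) := ⟨⟨0, by omega⟩⟩
  have e : Set.EqOn (fun y : ℝ => y ^ (Module.finrank ℝ (EuclideanSpace ℝ (Fin n)) - 1) •
      (Set.Iic r).indicator (fun t : ℝ => t ^ (1 - (n : ℝ))) y)
      ((Set.Iic r).indicator fun _ => 1) (Set.Ioi 0) := by
    intro y (hy : 0 < y)
    by_cases h : y ≤ r
    · simp only [finrank_euclideanSpace, Fintype.card_fin, Set.indicator_of_mem (Set.mem_Iic.2 h),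
        smul_eq_mul]
      rw [← Real.rpow_natCast, ← Real.rpow_add hy, Nat.cast_sub (by omega)]
      simp
    · simp [Set.indicator, h]
  constructor
  · rw [integrable_fun_norm_addHaar, integrableOn_congr_fun e measurableSet_Ioi, IntegrableOn,
      integrable_indicator_iff measurableSet_Iic, IntegrableOn,
      Measure.restrict_restrict measurableSet_Iic, Set.inter_comm, Set.Ioi_inter_Iic]
    simp
  · rw [integral_fun_norm_addHaar volume (Set.indicator _ _), setIntegral_congr_fun measurableSet_Ioi e,
      setIntegral_indicator measurableSet_Iic, Set.Ioi_inter_Iic]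
    simp [hr.le, mul_assoc]

theorem integrable_rpow_norm_compl_ball (hn : 2 ≤ n) {r : ℝ} (hr : 0 < r) :
    Integrable (fun x : EuclideanSpace ℝ (Fin n) =>
      (Set.Ici r).indicator (fun t : ℝ => t ^ (-1 - (n : ℝ))) ‖x‖) ∧
    ∫ x : EuclideanSpace ℝ (Fin n),
      (Set.Ici r).indicator (fun t : ℝ => t ^ (-1 - (n : ℝ))) ‖x‖ =
        n * volume.real (Metric.ball (0 : EuclideanSpace ℝ (Fin n)) 1) / r := by
  have : Nonempty (Fin n) := ⟨⟨0, by omega⟩⟩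
  have e : Set.EqOn (fun y : ℝ => y ^ (Module.finrank ℝ (EuclideanSpace ℝ (Fin n)) - 1) •
      (Set.Ici r).indicator (fun t : ℝ => t ^ (-1 - (n : ℝ))) y)
      ((Set.Ici r).indicator fun y => y ^ (-2 : ℝ)) (Set.Ioi 0) := by
    intro y (hy : 0 < y)
    by_cases h : r ≤ y
    · simp only [finrank_euclideanSpace, Fintype.card_fin, Set.indicator_of_mem (Set.mem_Ici.2 h),
        smul_eq_mul]
      rw [← Real.rpow_natCast, ← Real.rpow_add hy, Nat.cast_sub (by omega)]
      congr 1
      push_cast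
      ring
    · simp [Set.indicator, h]
  have hi : Set.Ioi 0 ∩ Set.Ici r = Set.Ici r :=
    Set.inter_eq_right.2 fun y hy => hr.trans_le hy
  constructor
  · rw [integrable_fun_norm_addHaar, integrableOn_congr_fun e measurableSet_Ioi, IntegrableOn,
      integrable_indicator_iff measurableSet_Ici, IntegrableOn,
      Measure.restrict_restrict measurableSet_Ici, Set.inter_comm, hi, ← IntegrableOn,
      integrableOn_Ici_iff_integrableOn_Ioi]
    exact integrableOn_Ioi_rpow_of_lt (by norm_num) hr
  · rw [integral_fun_norm_addHaar volume (Set.indicator _ _), setIntegral_congr_fun measurableSet_Ioi e,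
      setIntegral_indicator measurableSet_Ici, hi, integral_Ici_eq_integral_Ioi,
      integral_Ioi_rpow_of_lt (by norm_num) hr]
    norm_num [Real.rpow_neg_one]
    ring

end

section

variable {n : ℕ}

open FourierTransform in
theorem norm_sq_mul_norm_fourier_le {F : EuclideanSpace ℝ (Fin n) → ℂ}
    (hF : ContDiff ℝ (⊤ : ℕ∞) F) (hc : HasCompactSupport F) (ξ : EuclideanSpace ℝ (Fin n)) :
    ‖ξ‖ ^ 2 * ‖𝓕 F ξ‖ ≤ ∫ x, ‖iteratedFDeriv ℝ 2 F x‖ := by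
  have hFint : ∀ i : ℕ, Integrable (iteratedFDeriv ℝ i F) := fun i =>
    (hF.continuous_iteratedFDeriv (by exact_mod_cast le_top)).integrable_of_hasCompactSupport
      (hc.iteratedFDeriv i)
  rcases eq_or_ne ξ 0 with rfl | hξ
  · simp only [norm_zero, ne_eq, OfNat.ofNat_ne_zero, not_false_eq_true, zero_pow, zero_mul]
    positivity
  have h := congrFun (Real.fourier_iteratedFDeriv (N := ⊤) hF (fun i _ => hFint i)
    (n := 2) le_top) ξ
  have h1 : ‖𝓕 (iteratedFDeriv ℝ 2 F) ξ‖ ≤ ∫ x, ‖iteratedFDeriv ℝ 2 F x‖ :=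
    VectorFourier.norm_fourierIntegral_le_integral_norm _ _ _ _ _
  rw [h] at h1
  have h2 := ContinuousMultilinearMap.le_opNorm
    (VectorFourier.fourierPowSMulRight (-innerSL ℝ) (𝓕 F) ξ 2) (fun _ => ξ)
  rw [VectorFourier.fourierPowSMulRight_apply] at h2
  have h5 : innerSL ℝ ξ ξ = ‖ξ‖ ^ 2 := real_inner_self_eq_norm_sq ξ
  simp only [norm_smul, norm_pow, norm_neg, norm_mul, Finset.prod_const, Finset.card_univ,
    Fintype.card_fin, neg_apply, h5, Complex.norm_real, Complex.norm_I, norm_norm,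
    Complex.norm_ofNat, mul_one, Real.norm_of_nonneg Real.pi_pos.le] at h2
  have hξ' : 0 < ‖ξ‖ ^ 2 := by positivity
  have h3 : ‖ξ‖ ^ 2 * (‖ξ‖ ^ 2 * ‖𝓕 F ξ‖) ≤ ‖ξ‖ ^ 2 * ∫ x, ‖iteratedFDeriv ℝ 2 F x‖ := by
    have h4 : (1 : ℝ) ≤ (2 * Real.pi) ^ 2 := by
      have := Real.pi_gt_three
      nlinarith
    calc ‖ξ‖ ^ 2 * (‖ξ‖ ^ 2 * ‖𝓕 F ξ‖) = 1 * ((‖ξ‖ ^ 2) ^ 2 * ‖𝓕 F ξ‖) := by ring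
      _ ≤ (2 * Real.pi) ^ 2 * ((‖ξ‖ ^ 2) ^ 2 * ‖𝓕 F ξ‖) := by gcongr
      _ ≤ _ := h2
      _ ≤ _ := by
        rw [mul_comm]
        gcongr
  exact le_of_mul_le_mul_left h3 hξ'

open FourierTransform in
theorem exists_norm_mul_norm_fourier_le (hn : 2 ≤ n) : ∃ C : ℝ, 0 ≤ C ∧
    ∀ (A : ℝ) (m : EuclideanSpace ℝ (Fin n) → ℝ), 0 ≤ A → ContDiff ℝ (⊤ : ℕ∞) m →
      HasCompactSupport m → SymbolBound (1 - n) A m →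
      ∀ ξ, ‖ξ‖ * ‖𝓕 (fun x => (m x : ℂ)) ξ‖ ≤ C * A := by
  let φ : ContDiffBump (0 : EuclideanSpace ℝ (Fin n)) := ⟨1, 2, one_pos, one_lt_two⟩
  have φs : ContDiff ℝ (⊤ : ℕ∞) φ := φ.contDiff
  obtain ⟨B, hB0, hB⟩ := exists_symbolBound_zero φs φ.hasCompactSupport
  set c : ℝ := n * volume.real (Metric.ball (0 : EuclideanSpace ℝ (Fin n)) 1) with hc
  have hc0 : 0 ≤ c := by positivity
  refine ⟨2 * c + 4 * (1 + B) * c, by positivity, fun A m hA hm hmc hmA ξ => ?_⟩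
  rcases eq_or_ne ξ 0 with rfl | hξ
  · simp only [norm_zero, zero_mul]; positivity
  have hξ' := norm_pos_iff.2 hξ
  let φ' : EuclideanSpace ℝ (Fin n) → ℝ := fun x => φ (‖ξ‖ • x)
  have φ's : ContDiff ℝ (⊤ : ℕ∞) φ' := φs.comp (contDiff_const_smul _)
  have hB' : SymbolBound 0 (1 + B) fun x => 1 - φ' x := (hB.comp_smul φs hξ').one_sub φ's
  let m₁ : EuclideanSpace ℝ (Fin n) → ℂ := fun x => ((m x * φ' x : ℝ) : ℂ)
  let g : EuclideanSpace ℝ (Fin n) → ℝ := fun x => m x * (1 - φ' x)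
  let m₂ : EuclideanSpace ℝ (Fin n) → ℂ := fun x => ((m x * (1 - φ' x) : ℝ) : ℂ)
  have gs : ContDiff ℝ (⊤ : ℕ∞) g := hm.mul (contDiff_const.sub φ's)
  have gc : HasCompactSupport g := hmc.mul_right
  have s₁ : ContDiff ℝ (⊤ : ℕ∞) m₁ := Complex.ofRealCLM.contDiff.comp (hm.mul φ's)
  have s₂ : ContDiff ℝ (⊤ : ℕ∞) m₂ := Complex.ofRealCLM.contDiff.comp gs
  have c₁ : HasCompactSupport m₁ := (hmc.mul_right (f' := φ')).comp_left Complex.ofReal_zero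
  have c₂ : HasCompactSupport m₂ := gc.comp_left Complex.ofReal_zero
  have i₁ : Integrable m₁ := s₁.continuous.integrable_of_hasCompactSupport c₁
  have i₂ : Integrable m₂ := s₂.continuous.integrable_of_hasCompactSupport c₂
  have h2top : (2 : WithTop ℕ∞) ≤ ((⊤ : ℕ∞) : WithTop ℕ∞) :=
    WithTop.coe_le_coe.2 (le_top : (2 : ℕ∞) ≤ ⊤)
  have nontriv : Nonempty (Fin n) := ⟨⟨0, by omega⟩⟩
  have hae : ∀ᵐ x : EuclideanSpace ℝ (Fin n), x ≠ 0 := Measure.ae_ne volume 0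
  have b₁ : ‖𝓕 m₁ ξ‖ ≤ A * (c * (2 / ‖ξ‖)) := by
    obtain ⟨hi, he⟩ := integrable_rpow_norm_closedBall hn (r := 2 / ‖ξ‖) (by positivity)
    refine (VectorFourier.norm_fourierIntegral_le_integral_norm _ _ _ _ _).trans ?_
    rw [hc, ← he, ← integral_const_mul]
    refine integral_mono_ae i₁.norm (hi.const_mul A) ?_
    filter_upwards [hae] with x hx
    by_cases hx2 : ‖x‖ ≤ 2 / ‖ξ‖
    · rw [Set.indicator_of_mem (Set.mem_Iic.2 hx2)]
      have h0 := hmA x hx 0 (by norm_num)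
      rw [norm_iteratedFDeriv_zero, Nat.cast_zero, sub_zero] at h0
      simp only [m₁, Complex.norm_real, norm_mul]
      calc ‖m x‖ * ‖φ' x‖ ≤ ‖m x‖ * 1 := by
            gcongr
            rw [Real.norm_of_nonneg φ.nonneg]
            exact φ.le_one
        _ ≤ _ := by rwa [mul_one]
    · have : φ' x = 0 := by
        refine φ.zero_of_le_dist ?_
        rw [dist_zero_right, norm_smul, norm_norm]
        rw [not_le, div_lt_iff₀ hξ', mul_comm] at hx2
        exact hx2.le
      simp [m₁, this, hx2]
  have b₂ : ‖ξ‖ ^ 2 * ‖𝓕 m₂ ξ‖ ≤ 4 * A * (1 + B) * (c / (1 / ‖ξ‖)) := by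
    obtain ⟨hi, he⟩ := integrable_rpow_norm_compl_ball hn (r := 1 / ‖ξ‖) (by positivity)
    refine (norm_sq_mul_norm_fourier_le s₂ c₂ ξ).trans ?_
    rw [hc, ← he, ← integral_const_mul]
    refine integral_mono_ae ?_ (hi.const_mul _) ?_
    · exact ((s₂.continuous_iteratedFDeriv
        (by exact_mod_cast h2top)).integrable_of_hasCompactSupport (c₂.iteratedFDeriv 2)).norm
    filter_upwards [hae] with x hx
    have e : ‖iteratedFDeriv ℝ 2 m₂ x‖ = ‖iteratedFDeriv ℝ 2 g x‖ :=
      Complex.ofRealLI.norm_iteratedFDeriv_comp_left (f := g) gs.contDiffAt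
        (by exact_mod_cast h2top)
    rw [e]
    by_cases hx2 : 1 / ‖ξ‖ ≤ ‖x‖
    · rw [Set.indicator_of_mem (Set.mem_Ici.2 hx2)]
      refine (hmA.mul hB' (hm.of_le h2top).contDiffOn
        ((contDiff_const.sub φ's).of_le h2top).contDiffOn
        x hx 2 le_rfl).trans (le_of_eq ?_)
      congr 2
      push_cast
      ring
    · have : g =ᶠ[nhds x] fun _ => 0 := by
        have : Metric.ball (0 : EuclideanSpace ℝ (Fin n)) (1 / ‖ξ‖) ∈ nhds x :=
          Metric.isOpen_ball.mem_nhds (by simpa using hx2)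
        filter_upwards [this] with y hy
        have : φ' y = 1 := by
          refine φ.one_of_mem_closedBall ?_
          rw [mem_closedBall_zero_iff, norm_smul, norm_norm]
          rw [mem_ball_zero_iff, lt_div_iff₀ hξ', mul_comm] at hy
          exact hy.le
        simp [g, this]
      rw [(this.iteratedFDeriv ℝ 2).eq_of_nhds]
      rw [Set.indicator_of_notMem (s := Set.Ici (1 / ‖ξ‖)) hx2, iteratedFDeriv_const_of_ne two_ne_zero]
      simp
  have hsum : 𝓕 (fun x => (m x : ℂ)) ξ = 𝓕 m₁ ξ + 𝓕 m₂ ξ := by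
    have : (fun x => (m x : ℂ)) = m₁ + m₂ := by
      funext x
      simp only [m₁, m₂, Pi.add_apply]
      push_cast
      ring
    rw [this]
    exact congrFun (VectorFourier.fourierIntegral_add (e := Real.fourierChar) Real.continuous_fourierChar
      (L := innerₗ (EuclideanSpace ℝ (Fin n))) continuous_inner i₁ i₂) ξ
  rw [hsum]
  have b₂' : ‖ξ‖ * ‖𝓕 m₂ ξ‖ ≤ 4 * A * (1 + B) * c := by
    have : ‖ξ‖ * (‖ξ‖ * ‖𝓕 m₂ ξ‖) ≤ ‖ξ‖ * (4 * A * (1 + B) * c) := by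
      calc _ = ‖ξ‖ ^ 2 * ‖𝓕 m₂ ξ‖ := by ring
        _ ≤ _ := b₂
        _ = _ := by field_simp
    exact le_of_mul_le_mul_left this hξ'
  have b₁' : ‖ξ‖ * ‖𝓕 m₁ ξ‖ ≤ A * c * 2 := by
    calc _ ≤ ‖ξ‖ * (A * (c * (2 / ‖ξ‖))) := by gcongr
      _ = _ := by field_simp
  calc ‖ξ‖ * ‖𝓕 m₁ ξ + 𝓕 m₂ ξ‖ ≤ ‖ξ‖ * (‖𝓕 m₁ ξ‖ + ‖𝓕 m₂ ξ‖) := by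
        gcongr; exact norm_add_le _ _
    _ ≤ A * c * 2 + 4 * A * (1 + B) * c := by rw [mul_add]; gcongr
    _ = _ := by ring

open FourierTransform in
theorem norm_fourier_fderiv_apply_le {m : EuclideanSpace ℝ (Fin n) → ℝ}
    (hm : ContDiff ℝ (⊤ : ℕ∞) m) (hmc : HasCompactSupport m) (v ξ : EuclideanSpace ℝ (Fin n)) :
    ‖𝓕 (fun x => (fderiv ℝ m x v : ℂ)) ξ‖ ≤
      2 * Real.pi * ‖v‖ * (‖ξ‖ * ‖𝓕 (fun x => (m x : ℂ)) ξ‖) := by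
  let M : EuclideanSpace ℝ (Fin n) → ℂ := fun x => (m x : ℂ)
  have sM : ContDiff ℝ (⊤ : ℕ∞) M := Complex.ofRealCLM.contDiff.comp hm
  have cM : HasCompactSupport M := hmc.comp_left Complex.ofReal_zero
  have hd : ∀ x, fderiv ℝ M x v = (fderiv ℝ m x v : ℂ) := by
    intro x
    have h : HasFDerivAt m (fderiv ℝ m x) x :=
      (hm.differentiable (by simp) x).hasFDerivAt
    have := (Complex.ofRealCLM.hasFDerivAt (x := m x)).comp x h
    rw [show M = Complex.ofRealCLM ∘ m from rfl, this.fderiv]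
    rfl
  have hi : Integrable (fderiv ℝ M) :=
    (sM.continuous_fderiv (by simp)).integrable_of_hasCompactSupport (cM.fderiv ℝ)
  have h1 : 𝓕 (fun x => (fderiv ℝ m x v : ℂ)) ξ = 𝓕 (fderiv ℝ M) ξ v := by
    rw [Real.fourier_continuousLinearMap_apply hi]
    simp_rw [hd]
  rw [h1, Real.fourier_fderiv (sM.continuous.integrable_of_hasCompactSupport cM)
    (sM.differentiable (by simp)) hi, VectorFourier.fourierSMulRight_apply]
  simp only [norm_smul, norm_neg, norm_mul, Complex.norm_ofNat, Complex.norm_real,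
    Complex.norm_I, neg_apply, mul_one, Real.norm_of_nonneg Real.pi_pos.le]
  have : ‖innerSL ℝ ξ v‖ ≤ ‖ξ‖ * ‖v‖ := norm_inner_le_norm (𝕜 := ℝ) ξ v
  calc _ ≤ 2 * Real.pi * ((‖ξ‖ * ‖v‖) * ‖𝓕 M ξ‖) := by gcongr
    _ = _ := by ring

/-- The convolution of two real functions. -/
def convol (f k : EuclideanSpace ℝ (Fin n) → ℝ) (x : EuclideanSpace ℝ (Fin n)) : ℝ :=
  ∫ y, f y * k (x - y)

open FourierTransform in
theorem integral_convol_sq_le {f k : EuclideanSpace ℝ (Fin n) → ℝ}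
    (hf : ContDiff ℝ (⊤ : ℕ∞) f) (hfc : HasCompactSupport f)
    (hk : ContDiff ℝ (⊤ : ℕ∞) k) (hkc : HasCompactSupport k) {B : ℝ}
    (hB : ∀ ξ, ‖𝓕 (fun x => (k x : ℂ)) ξ‖ ≤ B) :
    ∫ x, ‖convol f k x‖ ^ 2 ≤ B ^ 2 * ∫ x, ‖f x‖ ^ 2 := by
  have hF : HasCompactSupport fun x => (f x : ℂ) := hfc.comp_left Complex.ofReal_zero
  have hK : HasCompactSupport fun x => (k x : ℂ) := hkc.comp_left Complex.ofReal_zero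
  let F := hF.toSchwartzMap (Complex.ofRealCLM.contDiff.comp hf)
  let G := hK.toSchwartzMap (Complex.ofRealCLM.contDiff.comp hk)
  have hFx : ∀ x, F x = (f x : ℂ) := fun _ => rfl
  have hGx : ∀ x, G x = (k x : ℂ) := fun _ => rfl
  let H := SchwartzMap.convolution (ContinuousLinearMap.mul ℂ ℂ) F G
  have e : ∀ x, H x = (convol f k x : ℂ) := by
    intro x
    rw [SchwartzMap.convolution_apply, convolution_def, convol, ← integral_complex_ofReal]
    refine integral_congr_ae (Filter.Eventually.of_forall fun y => ?_)
    change F y * G (x - y) = _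
    rw [hFx, hGx]
    push_cast
    rfl
  have e2 : ∀ ξ, 𝓕 H ξ = 𝓕 F ξ * 𝓕 (fun x => (k x : ℂ)) ξ := by
    intro ξ
    rw [SchwartzMap.fourier_convolution, SchwartzMap.pairing_apply_apply]
    rfl
  have h1 := SchwartzMap.integral_norm_sq_fourier H
  have h2 := SchwartzMap.integral_norm_sq_fourier F
  simp only [e, Complex.norm_real] at h1
  have h3 : ∫ x, ‖F x‖ ^ 2 = ∫ x, ‖f x‖ ^ 2 := by simp [hFx]
  rw [← h1, ← h3, ← h2, ← integral_const_mul]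
  refine integral_mono ?_ ?_ fun ξ => ?_
  · exact ((𝓕 H).memLp 2).integrable_norm_pow two_ne_zero
  · exact (((𝓕 F).memLp 2).integrable_norm_pow two_ne_zero).const_mul _
  · simp only [e2, norm_mul]
    rw [mul_pow, mul_comm]
    gcongr
    exact hB ξ

end

section

variable {n : ℕ}

theorem convol_eq_convolution (f k : EuclideanSpace ℝ (Fin n) → ℝ) :
    convol f k = convolution f k (ContinuousLinearMap.lsmul ℝ ℝ) volume := by
  funext x
  simp [convol, convolution_def]

theorem continuous_convol {f k : EuclideanSpace ℝ (Fin n) → ℝ} (hf : LocallyIntegrable f)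
    (hk : Continuous k) (hkc : HasCompactSupport k) : Continuous (convol f k) := by
  rw [convol_eq_convolution]
  exact HasCompactSupport.continuous_convolution_right (ContinuousLinearMap.lsmul ℝ ℝ) hkc hf hk

theorem hasCompactSupport_convol {f k : EuclideanSpace ℝ (Fin n) → ℝ} (hf : HasCompactSupport f)
    (hk : HasCompactSupport k) : HasCompactSupport (convol f k) := by
  rw [convol_eq_convolution]
  exact HasCompactSupport.convolution (ContinuousLinearMap.lsmul ℝ ℝ) hf hk

theorem integrable_convol_integrand {f k : EuclideanSpace ℝ (Fin n) → ℝ} (hf : LocallyIntegrable f)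
    (hk : Continuous k) (hkc : HasCompactSupport k) (x : EuclideanSpace ℝ (Fin n)) :
    Integrable fun y => f y * k (x - y) := by
  have := hkc.convolutionExists_right (ContinuousLinearMap.lsmul ℝ ℝ) hf hk x
  simpa [ConvolutionExistsAt] using this

theorem convol_sub {f g k : EuclideanSpace ℝ (Fin n) → ℝ} (hf : LocallyIntegrable f)
    (hg : LocallyIntegrable g) (hk : Continuous k) (hkc : HasCompactSupport k) 
    (x : EuclideanSpace ℝ (Fin n)) : convol (f - g) k x = convol f k x - convol g k x := by
  rw [convol, convol, convol, ← integral_sub (integrable_convol_integrand hf hk hkc x)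
    (integrable_convol_integrand hg hk hkc x)]
  simp [sub_mul]

/-- Hölder's inequality for a convolution, pointwise. -/
theorem enorm_convol_le {f k : EuclideanSpace ℝ (Fin n) → ℝ} {p q : ℝ≥0∞} [p.HolderConjugate q]
    (hf : AEStronglyMeasurable f) (hk : Continuous k) (x : EuclideanSpace ℝ (Fin n)) :
    ‖convol f k x‖ₑ ≤ eLpNorm f p volume * eLpNorm k q volume := by
  have hk' : eLpNorm (fun y => k (x - y)) q volume = eLpNorm k q volume :=
    eLpNorm_comp_measurePreserving hk.aestronglyMeasurable
      (Measure.measurePreserving_sub_left volume x)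
  calc ‖convol f k x‖ₑ ≤ ∫⁻ y, ‖f y * k (x - y)‖ₑ := enorm_integral_le_lintegral_enorm _
    _ = eLpNorm (f • fun y => k (x - y)) 1 volume := by
        rw [eLpNorm_one_eq_lintegral_enorm]; rfl
    _ ≤ eLpNorm f p volume * eLpNorm (fun y => k (x - y)) q volume :=
        eLpNorm_smul_le_mul_eLpNorm
          (hk.comp (continuous_const.sub continuous_id)).aestronglyMeasurable hf
    _ = _ := by rw [hk']

open FourierTransform in
theorem eLpNorm_two_convol_le {f k : EuclideanSpace ℝ (Fin n) → ℝ} (hf : MemLp f 2)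
    (hk : ContDiff ℝ (⊤ : ℕ∞) k) (hkc : HasCompactSupport k) {B : ℝ}
    (hB : ∀ ξ, ‖𝓕 (fun x => (k x : ℂ)) ξ‖ ≤ B) :
    eLpNorm (convol f k) 2 volume ≤ ENNReal.ofReal B * eLpNorm f 2 volume := by
  have hB0 : 0 ≤ B := (norm_nonneg _).trans (hB 0)
  have h0 : ∀ g : EuclideanSpace ℝ (Fin n) → ℝ, HasCompactSupport g → ContDiff ℝ (⊤ : ℕ∞) g →
      eLpNorm (convol g k) 2 volume ≤ ENNReal.ofReal B * eLpNorm g 2 volume := by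
    intro g hgc hg
    have hm : MemLp g 2 := hg.continuous.memLp_of_hasCompactSupport hgc
    have hm' : MemLp (convol g k) 2 :=
      (continuous_convol (hm.locallyIntegrable one_le_two) hk.continuous
        hkc).memLp_of_hasCompactSupport (hasCompactSupport_convol hgc hkc)
    rw [hm.eLpNorm_eq_integral_rpow_norm two_ne_zero ofNat_ne_top,
      hm'.eLpNorm_eq_integral_rpow_norm two_ne_zero ofNat_ne_top, ← ENNReal.ofReal_mul hB0]
    refine ENNReal.ofReal_le_ofReal ?_
    have := integral_convol_sq_le hg hgc hk hkc hB
    simp only [ENNReal.toReal_ofNat, Real.rpow_two]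
    rw [← one_div, ← Real.sqrt_eq_rpow, ← Real.sqrt_eq_rpow]
    refine (Real.sqrt_le_sqrt this).trans ?_
    rw [Real.sqrt_mul (sq_nonneg _), Real.sqrt_sq hB0]
  have hex : ∀ j : ℕ, ∃ g, HasCompactSupport g ∧ ContDiff ℝ (⊤ : ℕ∞) g ∧
      eLpNorm (f - g) 2 volume ≤ ENNReal.ofReal (1 / ((j : ℝ) + 1)) := fun j =>
    hf.exist_eLpNorm_sub_le ofNat_ne_top one_le_two (by positivity)
  choose g hgc hg hgf using hex
  have hlim : Filter.Tendsto (fun j => eLpNorm (f - g j) 2 volume) Filter.atTop (nhds 0) := by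
    refine tendsto_of_tendsto_of_tendsto_of_le_of_le tendsto_const_nhds ?_ (fun _ => zero_le) hgf
    have := (ENNReal.continuous_ofReal.tendsto 0).comp tendsto_one_div_add_atTop_nhds_zero_nat
    simpa [Function.comp_def] using this
  have hgm : ∀ j, MemLp (g j) 2 := fun j =>
    (hg j).continuous.memLp_of_hasCompactSupport (hgc j)
  have hfl := hf.locallyIntegrable one_le_two
  have hgl : ∀ j, LocallyIntegrable (g j) := fun j => (hgm j).locallyIntegrable one_le_two
  have hk2 : eLpNorm k 2 volume ≠ ∞ := (hk.continuous.memLp_of_hasCompactSupport hkc).2.ne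
  have hpt : ∀ x, Filter.Tendsto (fun j => convol (g j) k x) Filter.atTop
      (nhds (convol f k x)) := by
    intro x
    rw [tendsto_iff_edist_tendsto_0]
    have h2 : Filter.Tendsto (fun j => eLpNorm (f - g j) 2 volume * eLpNorm k 2 volume)
        Filter.atTop (nhds 0) := by
      simpa using ENNReal.Tendsto.mul_const hlim (Or.inr hk2)
    refine tendsto_of_tendsto_of_tendsto_of_le_of_le tendsto_const_nhds h2
      (fun _ => zero_le) fun j => ?_
    change edist (convol (g j) k x) (convol f k x) ≤ _
    rw [edist_comm, edist_eq_enorm_sub, ← convol_sub hfl (hgl j) hk.continuous hkc]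
    exact enorm_convol_le (hf.sub (hgm j)).1 hk.continuous x
  refine (Lp.eLpNorm_lim_le_liminf_eLpNorm (fun j =>
    (continuous_convol (hgl j) hk.continuous hkc).aestronglyMeasurable) _
    (Filter.Eventually.of_forall hpt)).trans ?_
  have hb : ∀ j, eLpNorm (convol (g j) k) 2 volume ≤
      ENNReal.ofReal B * (eLpNorm f 2 volume + eLpNorm (f - g j) 2 volume) := by
    intro j
    refine (h0 _ (hgc j) (hg j)).trans ?_
    gcongr
    calc eLpNorm (g j) 2 volume = eLpNorm (f - (f - g j)) 2 volume := by rw [_root_.sub_sub_cancel]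
      _ ≤ _ := eLpNorm_sub_le hf.1 (hf.sub (hgm j)).1 one_le_two
  refine (Filter.liminf_le_liminf (Filter.Eventually.of_forall hb)).trans ?_
  have : Filter.Tendsto (fun j => ENNReal.ofReal B * (eLpNorm f 2 volume +
      eLpNorm (f - g j) 2 volume)) Filter.atTop
      (nhds (ENNReal.ofReal B * (eLpNorm f 2 volume + 0))) :=
    ENNReal.Tendsto.const_mul (tendsto_const_nhds.add hlim) (Or.inr ofReal_ne_top)
  rw [this.liminf_eq, add_zero]

/-- The Hörmander condition for a derivative of a kernel with homogeneous symbol bounds. -/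
theorem lintegral_compl_ball_enorm_sub_le (hn : 2 ≤ n) : ∃ C : ℝ, 0 ≤ C ∧
    ∀ (A : ℝ) (m : EuclideanSpace ℝ (Fin n) → ℝ) (v : EuclideanSpace ℝ (Fin n)),
      ContDiff ℝ (⊤ : ℕ∞) m → SymbolBound (1 - n) A m → ∀ (y : EuclideanSpace ℝ (Fin n)) (r : ℝ),
      0 < r → ‖y‖ ≤ r → ∫⁻ x in {x | 2 * r ≤ ‖x‖},
        ‖fderiv ℝ m (x - y) v - fderiv ℝ m x v‖ₑ ≤ ENNReal.ofReal (C * (A * ‖v‖)) := by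
  refine ⟨2 ^ ((n:ℝ)+1) * (n * volume.real (Metric.ball (0 : EuclideanSpace ℝ (Fin n)) 1) / 2),
    by positivity, ?_⟩
  intro A m v hm hA y r hr hy
  have : Nonempty (Fin n) := ⟨⟨0, by omega⟩⟩
  have hA0 : 0 ≤ A := hA.nonneg (x := EuclideanSpace.single ⟨0, by omega⟩ 1) (by
    intro h; simpa using congrArg norm h)
  obtain ⟨hi, he⟩ := integrable_rpow_norm_compl_ball hn (r := 2 * r) (by positivity)
  have hk : ContDiff ℝ (⊤ : ℕ∞) (fderiv ℝ m) := hm.fderiv_right (by exact_mod_cast le_top)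
  have hkd : Differentiable ℝ fun x => fderiv ℝ m x v :=
    (hk.differentiable (by simp)).clm_apply (differentiable_const v)
  have hD : ∀ z, z ≠ 0 → ‖fderiv ℝ (fun x => fderiv ℝ m x v) z‖ ≤
      ‖v‖ * (A * ‖z‖ ^ (-1 - (n:ℝ))) := by
    intro z hz
    have h1 := hA z hz 2 le_rfl
    have e1 : fderiv ℝ (fun x => fderiv ℝ m x v) z = (fderiv ℝ (fderiv ℝ m) z).flip v := by
      have := ((hk.differentiable (by simp) z).hasFDerivAt).clm_apply (hasFDerivAt_const v z)
      rw [this.fderiv]; simp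
    have e2 : ‖fderiv ℝ (fderiv ℝ m) z‖ = ‖iteratedFDeriv ℝ 2 m z‖ := by
      rw [← norm_iteratedFDeriv_fderiv, norm_iteratedFDeriv_one]
    rw [e1, mul_comm]
    refine (ContinuousLinearMap.le_opNorm _ _).trans ?_
    gcongr
    rw [ContinuousLinearMap.opNorm_flip, e2]
    rwa [show (-1 - (n:ℝ)) = 1 - (n:ℝ) - ((2:ℕ):ℝ) by push_cast; ring]
  have hpt : ∀ x, 2 * r ≤ ‖x‖ → ‖fderiv ℝ m (x - y) v - fderiv ℝ m x v‖ₑ ≤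
      ENNReal.ofReal (2 ^ ((n:ℝ)+1) * (A * ‖v‖) * r *
        (Set.Ici (2 * r)).indicator (fun t : ℝ => t ^ (-1 - (n : ℝ))) ‖x‖) := by
    intro x hx
    have hx0 : 0 < ‖x‖ := by linarith
    rw [← ofReal_norm, Set.indicator_of_mem (Set.mem_Ici.2 hx)]
    refine ENNReal.ofReal_le_ofReal ?_
    have hc : ∀ z ∈ Metric.closedBall x r, ‖fderiv ℝ (fun x => fderiv ℝ m x v) z‖ ≤
        ‖v‖ * (A * (‖x‖ / 2) ^ (-1 - (n:ℝ))) := by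
      intro z hz
      rw [mem_closedBall_iff_norm] at hz
      have : ‖x‖ / 2 ≤ ‖z‖ := by
        have := norm_sub_norm_le x z
        rw [norm_sub_rev] at this
        linarith
      refine (hD z (norm_pos_iff.1 (by linarith))).trans ?_
      gcongr ‖v‖ * (A * ?_)
      exact Real.rpow_le_rpow_of_nonpos (by positivity) this (by linarith [(Nat.cast_nonneg n : (0:ℝ) ≤ n)])
    have := (convex_closedBall x r).norm_image_sub_le_of_norm_fderiv_le
      (fun z _ => hkd z) hc (Metric.mem_closedBall_self hr.le) (y := x - y) (by simpa using hy)
    refine this.trans ?_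
    rw [Real.div_rpow hx0.le zero_le_two, sub_sub_cancel_left, norm_neg]
    have e3 : (2:ℝ) ^ (-1 - (n:ℝ)) = (2 ^ ((n:ℝ) + 1))⁻¹ := by
      rw [← Real.rpow_neg zero_le_two]; congr 1; ring
    rw [e3, div_inv_eq_mul]
    calc _ ≤ ‖v‖ * (A * (‖x‖ ^ (-1 - (n:ℝ)) * 2 ^ ((n:ℝ) + 1))) * r := by gcongr
      _ = _ := by ring
  have hms : MeasurableSet {x : EuclideanSpace ℝ (Fin n) | 2 * r ≤ ‖x‖} :=
    (isClosed_le continuous_const continuous_norm).measurableSet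
  calc _ ≤ ∫⁻ x in {x | 2 * r ≤ ‖x‖}, ENNReal.ofReal (2 ^ ((n:ℝ)+1) * (A * ‖v‖) * r *
        (Set.Ici (2 * r)).indicator (fun t : ℝ => t ^ (-1 - (n : ℝ))) ‖x‖) :=
        setLIntegral_mono' hms hpt
    _ ≤ ∫⁻ x, ENNReal.ofReal (2 ^ ((n:ℝ)+1) * (A * ‖v‖) * r *
        (Set.Ici (2 * r)).indicator (fun t : ℝ => t ^ (-1 - (n : ℝ))) ‖(x : EuclideanSpace ℝ (Fin n))‖) :=
        setLIntegral_le_lintegral _ _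
    _ = ENNReal.ofReal (∫ x, 2 ^ ((n:ℝ)+1) * (A * ‖v‖) * r *
        (Set.Ici (2 * r)).indicator (fun t : ℝ => t ^ (-1 - (n : ℝ))) ‖(x : EuclideanSpace ℝ (Fin n))‖) := by
        rw [ofReal_integral_eq_lintegral_ofReal (hi.const_mul _)]
        refine Filter.Eventually.of_forall fun x => ?_
        refine mul_nonneg (by positivity) (Set.indicator_nonneg (fun t ht => ?_) _)
        exact Real.rpow_nonneg (le_trans (by positivity) (Set.mem_Ici.1 ht)) _
    _ = _ := by
        rw [integral_const_mul, he]
        congr 1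
        field_simp

end

section

variable {n : ℕ}

theorem volume_closedBall_mul (x : EuclideanSpace ℝ (Fin n)) {a r : ℝ} (ha : 0 ≤ a)
    (hr : 0 ≤ r) : volume (Metric.closedBall x (a * r)) =
      ENNReal.ofReal (a ^ n) * volume (Metric.closedBall x r) := by
  rw [Measure.addHaar_closedBall volume x hr, Measure.addHaar_closedBall volume x (by positivity),
    finrank_euclideanSpace_fin, mul_pow, ENNReal.ofReal_mul (by positivity), mul_assoc]

/-- A Calderón–Zygmund covering at height `l`: disjoint balls on which the average of `|f|` is at
least `l`, whose dilates have average at most `l`, together with disjoint sets inside the dilates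
which cover `{|f| > l}`. -/
theorem exists_calderonZygmund_covering (hn : 1 ≤ n) {f : EuclideanSpace ℝ (Fin n) → ℝ}
    (hf : Continuous f) (hfc : HasCompactSupport f) {l : ℝ≥0∞} (hl : l ≠ 0) (hl' : l ≠ ⊤) :
    ∃ (u : Set (EuclideanSpace ℝ (Fin n))) (r : EuclideanSpace ℝ (Fin n) → ℝ)
      (Q : u → Set (EuclideanSpace ℝ (Fin n))), u.Countable ∧ (∀ i : u, 0 < r i) ∧
      (∀ i, MeasurableSet (Q i)) ∧ Pairwise (Function.onFun Disjoint Q) ∧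
      (∀ i : u, Q i ⊆ Metric.closedBall (i : EuclideanSpace ℝ (Fin n)) (5 * r i)) ∧
      Pairwise (Function.onFun Disjoint fun i : u => Metric.closedBall (i : EuclideanSpace ℝ (Fin n)) (r i)) ∧
      (∀ i : u, l * volume (Metric.closedBall (i : EuclideanSpace ℝ (Fin n)) (r i)) ≤
        ∫⁻ y in Metric.closedBall (i : EuclideanSpace ℝ (Fin n)) (r i), ‖f y‖ₑ) ∧
      (∀ i : u, ∫⁻ y in Metric.closedBall (i : EuclideanSpace ℝ (Fin n)) (5 * r i), ‖f y‖ₑ ≤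
        l * volume (Metric.closedBall (i : EuclideanSpace ℝ (Fin n)) (5 * r i))) ∧
      ∀ z, z ∉ ⋃ i, Q i → ‖f z‖ₑ ≤ l := by
  let P : EuclideanSpace ℝ (Fin n) → ℝ → Prop := fun x r =>
    l * volume (Metric.closedBall x r) ≤ ∫⁻ y in Metric.closedBall x r, ‖f y‖ₑ
  have hI : ∫⁻ y, ‖f y‖ₑ ≠ ⊤ := (hf.integrable_of_hasCompactSupport hfc).2.ne
  have nontriv : Nonempty (Fin n) := ⟨⟨0, by omega⟩⟩
  obtain ⟨R, hR⟩ : ∃ R : ℝ, ∀ x r, 0 < r → P x r → r ≤ R := by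
    set V := volume (Metric.ball (0 : EuclideanSpace ℝ (Fin n)) 1)
    have hV : V ≠ 0 := (Metric.measure_ball_pos volume _ one_pos).ne'
    have hV' : V ≠ ⊤ := measure_ball_lt_top.ne
    refine ⟨max 1 ((∫⁻ y, ‖f y‖ₑ) / (l * V)).toReal, fun x r hr hP => ?_⟩
    rcases le_total r 1 with h1 | h1
    · exact h1.trans (le_max_left _ _)
    refine le_trans ?_ (le_max_right _ _)
    have h2 : ENNReal.ofReal (r ^ n) ≤ (∫⁻ y, ‖f y‖ₑ) / (l * V) := by
      rw [ENNReal.le_div_iff_mul_le (Or.inl (mul_ne_zero hl hV)) (Or.inl (mul_ne_top hl' hV'))]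
      refine le_trans (le_of_eq ?_) (hP.trans (setLIntegral_le_lintegral _ _))
      rw [Measure.addHaar_closedBall volume x hr.le, finrank_euclideanSpace_fin]
      ring
    have h3 : r ^ n ≤ ((∫⁻ y, ‖f y‖ₑ) / (l * V)).toReal :=
      (ENNReal.ofReal_le_iff_le_toReal (ENNReal.div_ne_top hI (mul_ne_zero hl hV))).1 h2
    exact (le_self_pow₀ h1 (by omega)).trans h3
  have hex : ∀ x, l < ‖f x‖ₑ → ∃ r, 0 < r ∧ P x r ∧ ¬ P x (5 * r) := by
    intro x hx
    have ho : IsOpen {z | l < ‖f z‖ₑ} := isOpen_lt continuous_const hf.enorm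
    obtain ⟨r₀, hr₀, hb⟩ := Metric.nhds_basis_closedBall.mem_iff.1 (ho.mem_nhds hx)
    have hP : P x r₀ := by
      change _ ≤ _
      rw [← setLIntegral_const]
      exact setLIntegral_mono' measurableSet_closedBall fun z hz => (hb hz).le
    by_contra! hcon
    have : ∀ k : ℕ, P x (5 ^ k * r₀) := by
      intro k
      induction k with
      | zero => simpa using hP
      | succ k ih => rw [pow_succ', mul_assoc]; exact hcon _ (by positivity) ih
    obtain ⟨k, hk⟩ := pow_unbounded_of_one_lt (R / r₀) (by norm_num : (1:ℝ) < 5)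
    rw [div_lt_iff₀ hr₀] at hk
    exact absurd (hR x _ (by positivity) (this k)) (not_le.2 hk)
  choose! r hr hP hP5 using hex
  obtain ⟨u, hut, hud, huc⟩ := Vitali.exists_disjoint_subfamily_covering_enlargement_closedBall
    {x | l < ‖f x‖ₑ} id r R (fun x hx => hR x _ (hr x hx) (hP x hx)) 5 (by norm_num)
  have hcount : u.Countable := hud.countable_of_nonempty_interior fun x hx =>
    ⟨x, Metric.ball_subset_interior_closedBall (Metric.mem_ball_self (hr x (hut hx)))⟩
  have : Countable u := hcount.to_subtype
  obtain ⟨e, he⟩ := exists_injective_nat u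
  let G : u → Set (EuclideanSpace ℝ (Fin n)) := fun i => Metric.closedBall (i : EuclideanSpace ℝ (Fin n)) (5 * r i)
  refine ⟨u, r, fun i => G i \ ⋃ j, ⋃ _ : e j < e i, G j, hcount, fun i => hr i (hut i.2), ?_, ?_,
    fun i => Set.sdiff_subset, ?_, fun i => hP i (hut i.2), fun i => (not_le.1 (hP5 i (hut i.2))).le, ?_⟩
  · exact fun i => measurableSet_closedBall.diff (MeasurableSet.iUnion fun j =>
      MeasurableSet.iUnion fun _ => measurableSet_closedBall)
  · intro i j hij
    rw [Function.onFun, Set.disjoint_left]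
    rintro z ⟨hz1, hz2⟩ ⟨hz3, hz4⟩
    simp only [Set.mem_iUnion, not_exists] at hz2 hz4
    rcases lt_trichotomy (e i) (e j) with h | h | h
    · exact hz4 i h hz1
    · exact hij (he h)
    · exact hz2 j h hz3
  · intro i j hij
    exact hud i.2 j.2 fun h => hij (Subtype.ext h)
  · intro z hz
    by_contra! hlt
    obtain ⟨b, hb, hzb⟩ := huc z hlt
    have hne : {m : ℕ | ∃ j : u, e j = m ∧ z ∈ G j}.Nonempty :=
      ⟨e ⟨b, hb⟩, ⟨b, hb⟩, rfl, hzb (Metric.mem_closedBall_self (hr z hlt).le)⟩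
    obtain ⟨j, hj, hzj⟩ := Nat.sInf_mem hne
    refine hz (Set.mem_iUnion.2 ⟨j, hzj, ?_⟩)
    simp only [Set.mem_iUnion, not_exists]
    intro j' hj' hz'
    have := Nat.sInf_le (s := {m : ℕ | ∃ j : u, e j = m ∧ z ∈ G j}) ⟨j', rfl, hz'⟩
    omega

end

section

variable {n : ℕ}

theorem meas_lt_le {α : Type*} [MeasurableSpace α] {μ : Measure α} {F : α → ℝ≥0∞}
    (hF : AEMeasurable F μ) {l : ℝ≥0∞} : l * μ {x | l < F x} ≤ ∫⁻ x, F x ∂μ := by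
  refine le_trans ?_ (mul_meas_ge_le_lintegral₀ hF l)
  gcongr
  intro h
  exact h.le

theorem lintegral_iUnion_le_of_disjoint {α ι : Type*} [MeasurableSpace α] [Countable ι] {μ : Measure α}
    {Q : ι → Set α} (hQ : ∀ i, MeasurableSet (Q i)) (hd : Pairwise (Function.onFun Disjoint Q))
    (F : α → ℝ≥0∞) : ∑' i, ∫⁻ y in Q i, F y ∂μ ≤ ∫⁻ y, F y ∂μ := by
  rw [← lintegral_iUnion hQ hd]
  exact setLIntegral_le_lintegral _ _

/-- Splitting `f` as a bounded function plus a sum of mean zero functions living on balls. -/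
theorem exists_calderonZygmund_decomposition (hn : 1 ≤ n) {f : EuclideanSpace ℝ (Fin n) → ℝ}
    (hf : Continuous f) (hfc : HasCompactSupport f) {l : ℝ≥0∞} (hl : l ≠ 0) (hl' : l ≠ ⊤) :
    ∃ (u : Set (EuclideanSpace ℝ (Fin n))) (r : EuclideanSpace ℝ (Fin n) → ℝ)
      (Q B : u → Set (EuclideanSpace ℝ (Fin n))) (g h : EuclideanSpace ℝ (Fin n) → ℝ),
      u.Countable ∧ (∀ i : u, 0 < r i) ∧
      (∀ i, MeasurableSet (Q i)) ∧ Pairwise (Function.onFun Disjoint Q) ∧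
      (∀ i : u, Q i ⊆ Metric.closedBall (i : EuclideanSpace ℝ (Fin n)) (5 * r i)) ∧
      (∀ i, MeasurableSet (B i)) ∧ Pairwise (Function.onFun Disjoint B) ∧
      (∀ i : u, B i ⊆ Metric.closedBall (i : EuclideanSpace ℝ (Fin n)) (5 * r i)) ∧
      l * ∑' i : u, volume (Metric.ball (i : EuclideanSpace ℝ (Fin n)) (10 * r i)) ≤
        ENNReal.ofReal (10 ^ n) * ∫⁻ y, ‖f y‖ₑ ∧
      Measurable g ∧ Measurable h ∧ ∫⁻ y, ‖h y‖ₑ ≤ ∫⁻ y, ‖f y‖ₑ ∧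
      g = (⋃ i, Q i)ᶜ.indicator f + h ∧ (∀ y, y ∉ ⋃ i, B i → h y = 0) ∧
      (∀ i, ∫ y in Q i, f y = ∫ y in B i, h y) ∧
      (∀ y, ‖g y‖ₑ ≤ ENNReal.ofReal (1 + 5 ^ n) * l) := by
  obtain ⟨u, r, Q, huc, hr, hQm, hQd, hQs, hBd, hlow, hup, hoff⟩ :=
    exists_calderonZygmund_covering hn hf hfc hl hl'
  have nontriv : Nonempty (Fin n) := ⟨⟨0, by omega⟩⟩
  have : Countable u := huc.to_subtype
  let B : u → Set (EuclideanSpace ℝ (Fin n)) := fun i => Metric.closedBall i (r i)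
  have hBm : ∀ i, MeasurableSet (B i) := fun i => measurableSet_closedBall
  have hBV : ∀ i, volume (B i) ≠ 0 := fun i => (Metric.measure_closedBall_pos volume _ (hr i)).ne'
  have hBV' : ∀ i, volume (B i) ≠ ⊤ := fun i => measure_closedBall_lt_top.ne
  have hfi : Integrable f := hf.integrable_of_hasCompactSupport hfc
  let c : u → ℝ := fun i => (∫ y in Q i, f y) / volume.real (B i)
  have hc0 : ∀ i, ‖c i‖ₑ * volume (B i) ≤ ∫⁻ y in Q i, ‖f y‖ₑ := by
    intro i
    have h1 : 0 < volume.real (B i) := ENNReal.toReal_pos (hBV i) (hBV' i)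
    have h2 : ‖c i‖ₑ * volume (B i) = ‖∫ y in Q i, f y‖ₑ := by
      rw [← ofReal_norm, ← ENNReal.ofReal_toReal (hBV' i), ← ENNReal.ofReal_mul (norm_nonneg _),
        norm_div, ← ofReal_norm]
      congr 1
      rw [Real.norm_of_nonneg h1.le]
      exact div_mul_cancel₀ _ h1.ne'
    rw [h2]
    exact enorm_integral_le_lintegral_enorm _
  have hc1 : ∀ i, ‖c i‖ₑ ≤ ENNReal.ofReal (5 ^ n) * l := by
    intro i
    have h1 : ‖c i‖ₑ * volume (B i) ≤ (ENNReal.ofReal (5 ^ n) * l) * volume (B i) := by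
      refine (hc0 i).trans ((lintegral_mono_set (hQs i)).trans ((hup i).trans (le_of_eq ?_)))
      rw [volume_closedBall_mul _ (by norm_num) (hr i).le]
      ring
    exact (ENNReal.mul_le_mul_iff_left (hBV i) (hBV' i)).1 h1
  obtain ⟨h, hhm, hh⟩ := exists_measurable_piecewise
    (fun o : Option u => o.elim (⋃ i, B i)ᶜ B)
    (by rintro (_ | i)
        · exact (MeasurableSet.iUnion hBm).compl
        · exact hBm i)
    (fun o : Option u => fun _ : EuclideanSpace ℝ (Fin n) => o.elim (0 : ℝ) c)
    (fun _ => measurable_const)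
    (by
      rintro (_ | i) (_ | j) hij y ⟨hy1, hy2⟩
      · rfl
      · exact absurd (Set.mem_iUnion.2 ⟨j, hy2⟩) hy1
      · exact absurd (Set.mem_iUnion.2 ⟨i, hy1⟩) hy2
      · by_cases h : i = j
        · rw [h]
        · exact absurd hy2 (Set.disjoint_left.1 (hBd h) hy1))
  have hh0 : ∀ y, y ∉ ⋃ i, B i → h y = 0 := fun y hy => hh none hy
  have hhc : ∀ i, ∀ y ∈ B i, h y = c i := fun i y hy => hh (some i) hy
  refine ⟨u, r, Q, B, (⋃ i, Q i)ᶜ.indicator f + h, h, huc, hr, hQm, hQd, hQs, hBm, hBd, 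
    fun i => Metric.closedBall_subset_closedBall (by linarith [hr i]), ?_, 
    (hf.measurable.indicator (MeasurableSet.iUnion hQm).compl).add hhm, hhm, ?_, rfl, hh0, ?_, ?_⟩
  · calc _ ≤ l * ∑' i : u, ENNReal.ofReal (10 ^ n) * volume (B i) := by
          gcongr with i
          refine (measure_mono Metric.ball_subset_closedBall).trans (le_of_eq ?_)
          exact volume_closedBall_mul _ (by norm_num) (hr i).le
      _ = ENNReal.ofReal (10 ^ n) * ∑' i : u, l * volume (B i) := by
          rw [ENNReal.tsum_mul_left, ENNReal.tsum_mul_left]; ring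
      _ ≤ ENNReal.ofReal (10 ^ n) * ∑' i : u, ∫⁻ y in B i, ‖f y‖ₑ := by
          gcongr with i
          exact hlow i
      _ ≤ _ := by
          gcongr
          exact lintegral_iUnion_le_of_disjoint hBm hBd _
  · have h1 : ∫⁻ y, ‖h y‖ₑ = ∫⁻ y in ⋃ i, B i, ‖h y‖ₑ := by
      rw [← lintegral_indicator (MeasurableSet.iUnion hBm)]
      congr 1
      funext y
      by_cases hy : y ∈ ⋃ i, B i
      · rw [Set.indicator_of_mem hy]
      · rw [Set.indicator_of_notMem hy, hh0 y hy, enorm_zero]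
    rw [h1, lintegral_iUnion hBm hBd]
    refine le_trans ?_ (lintegral_iUnion_le_of_disjoint hQm hQd _)
    refine ENNReal.tsum_le_tsum fun i => ?_
    rw [setLIntegral_congr_fun (hBm i) fun y hy => by rw [hhc i y hy], setLIntegral_const]
    exact hc0 i
  · intro i
    rw [setIntegral_congr_fun (hBm i) (hhc i), setIntegral_const, smul_eq_mul]
    exact (mul_div_cancel₀ _ (ENNReal.toReal_pos (hBV i) (hBV' i)).ne').symm
  · intro y
    rw [ENNReal.ofReal_add zero_le_one (by positivity), ENNReal.ofReal_one, add_mul, one_mul]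
    refine (enorm_add_le _ _).trans (add_le_add ?_ ?_)
    · by_cases hy : y ∈ (⋃ i, Q i)ᶜ
      · rw [Set.indicator_of_mem hy]; exact hoff y hy
      · rw [Set.indicator_of_notMem hy]; simp
    · by_cases hy : y ∈ ⋃ i, B i
      · obtain ⟨i, hi⟩ := Set.mem_iUnion.1 hy
        rw [hhc i y hi]; exact hc1 i
      · rw [hh0 y hy]; simp

end

section

variable {n : ℕ}

theorem lintegral_compl_ball_cancellation_le {k F : EuclideanSpace ℝ (Fin n) → ℝ} (hk : Continuous k)
    (hF : Measurable F) {H : ℝ≥0∞}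
    (hH : ∀ (y : EuclideanSpace ℝ (Fin n)) (r : ℝ), 0 < r → ‖y‖ ≤ r →
      ∫⁻ x in {x | 2 * r ≤ ‖x‖}, ‖k (x - y) - k x‖ₑ ≤ H)
    {c : EuclideanSpace ℝ (Fin n)} {r : ℝ} (hr : 0 < r) {Q : Set (EuclideanSpace ℝ (Fin n))}
    (hQm : MeasurableSet Q) (hQ : Q ⊆ Metric.closedBall c (5 * r)) :
    ∫⁻ x in (Metric.ball c (10 * r))ᶜ, ∫⁻ y in Q, ‖F y‖ₑ * ‖k (x - y) - k (x - c)‖ₑ ≤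
      H * ∫⁻ y in Q, ‖F y‖ₑ := by
  rw [lintegral_lintegral_swap]
  · rw [← lintegral_const_mul _ hF.enorm]
    refine setLIntegral_mono' hQm fun y hy => ?_
    rw [lintegral_const_mul]
    · rw [mul_comm]
      gcongr
      have hyr : ‖y - c‖ ≤ 5 * r := by simpa [dist_eq_norm] using hQ hy
      refine le_trans (le_of_eq ?_) (hH (y - c) (5 * r) (by positivity) hyr)
      have hm : MeasurableSet {x : EuclideanSpace ℝ (Fin n) | 2 * (5 * r) ≤ ‖x‖} :=
        (isClosed_le continuous_const continuous_norm).measurableSet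
      rw [← lintegral_indicator hm, ← lintegral_indicator measurableSet_ball.compl,
        ← lintegral_sub_right_eq_self
          ({x : EuclideanSpace ℝ (Fin n) | 2 * (5 * r) ≤ ‖x‖}.indicator _) c]
      congr 1
      funext x
      have e : x ∈ (Metric.ball c (10 * r))ᶜ ↔ x - c ∈ {x : EuclideanSpace ℝ (Fin n) | 2 * (5 * r) ≤ ‖x‖} := by
        simp only [Set.mem_compl_iff, Metric.mem_ball, not_lt, dist_eq_norm, Set.mem_ofPred_eq]
        ring_nf
      by_cases hx : x ∈ (Metric.ball c (10 * r))ᶜ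
      · rw [Set.indicator_of_mem hx, Set.indicator_of_mem (e.1 hx), sub_sub_sub_cancel_right]
      · rw [Set.indicator_of_notMem hx, Set.indicator_of_notMem (fun h => hx (e.2 h))]
    · exact Measurable.enorm (Continuous.measurable (by fun_prop))
  · refine Measurable.aemeasurable ?_
    refine Measurable.mul (hF.enorm.comp measurable_snd) ?_
    exact Measurable.enorm (Continuous.measurable (by fun_prop))

theorem enorm_setIntegral_le_cancellation {k F G : EuclideanSpace ℝ (Fin n) → ℝ} (hk : Continuous k)
    (hkc : HasCompactSupport k) (hF : Integrable F) (hG : Integrable G) 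
    {Q B : Set (EuclideanSpace ℝ (Fin n))}
    (h0 : ∫ y in Q, F y = ∫ y in B, G y) (c x : EuclideanSpace ℝ (Fin n)) :
    ‖(∫ y in Q, F y * k (x - y)) - ∫ y in B, G y * k (x - y)‖ₑ ≤
      (∫⁻ y in Q, ‖F y‖ₑ * ‖k (x - y) - k (x - c)‖ₑ) +
      ∫⁻ y in B, ‖G y‖ₑ * ‖k (x - y) - k (x - c)‖ₑ := by
  have i1 : ∀ {F : EuclideanSpace ℝ (Fin n) → ℝ} {S : Set (EuclideanSpace ℝ (Fin n))}, Integrable F → 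
      ∫ y in S, F y * (k (x - y) - k (x - c)) =
      (∫ y in S, F y * k (x - y)) - (∫ y in S, F y) * k (x - c) := by
    intro F S hF
    simp_rw [mul_sub]
    rw [integral_sub (integrable_convol_integrand hF.locallyIntegrable hk hkc x).integrableOn
      (hF.mul_const _).integrableOn, integral_mul_const]
  have : (∫ y in Q, F y * k (x - y)) - ∫ y in B, G y * k (x - y) =
      (∫ y in Q, F y * (k (x - y) - k (x - c))) - ∫ y in B, G y * (k (x - y) - k (x - c)) := by
    rw [i1 hF, i1 hG, h0]; ring
  rw [this]
  refine enorm_sub_le.trans (add_le_add ?_ ?_) <;>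
  · refine (enorm_integral_le_lintegral_enorm _).trans (le_of_eq ?_)
    simp only [enorm_mul]

/-- The weak type `(1,1)` bound for convolution with a Calderón–Zygmund kernel. -/
theorem weak_type_convol (hn : 1 ≤ n) {k f : EuclideanSpace ℝ (Fin n) → ℝ} (hk : Continuous k)
    (hkc : HasCompactSupport k) {B H : ℝ≥0∞}
    (hB : ∀ f : EuclideanSpace ℝ (Fin n) → ℝ, MemLp f 2 →
      eLpNorm (convol f k) 2 volume ≤ B * eLpNorm f 2 volume)
    (hH : ∀ (y : EuclideanSpace ℝ (Fin n)) (r : ℝ), 0 < r → ‖y‖ ≤ r →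
      ∫⁻ x in {x | 2 * r ≤ ‖x‖}, ‖k (x - y) - k x‖ₑ ≤ H)
    (hf : Continuous f) (hfc : HasCompactSupport f) {l : ℝ≥0∞} (hl : l ≠ 0) (hl' : l ≠ ⊤) :
    l * volume {x | 2 * l < ‖convol f k x‖ₑ} ≤
      (2 * ENNReal.ofReal (1 + 5 ^ n) * B ^ 2 + ENNReal.ofReal (10 ^ n) + 2 * H) * ∫⁻ y, ‖f y‖ₑ := by
  obtain ⟨u, r, Q, P, g, h, huc, hr, hQm, hQd, hQs, hPm, hPd, hPs, hvol, hgm, hhm, hhf, hg, hh0,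
    hmean, hgl⟩ := exists_calderonZygmund_decomposition hn hf hfc hl hl'
  have : Countable u := huc.to_subtype
  have hfi : Integrable f := hf.integrable_of_hasCompactSupport hfc
  have hI : ∫⁻ y, ‖f y‖ₑ ≠ ⊤ := hfi.2.ne
  have hhi : Integrable h := ⟨hhm.aestronglyMeasurable, hhf.trans_lt hfi.2⟩
  have hgi : Integrable g := by
    rw [hg]; exact (hfi.indicator (MeasurableSet.iUnion hQm).compl).add hhi
  have hg1 : ∫⁻ y, ‖g y‖ₑ ≤ 2 * ∫⁻ y, ‖f y‖ₑ := by
    calc ∫⁻ y, ‖g y‖ₑ ≤ ∫⁻ y, (‖f y‖ₑ + ‖h y‖ₑ) := by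
          refine lintegral_mono fun y => ?_
          rw [hg]
          refine (enorm_add_le _ _).trans ?_
          gcongr
          exact enorm_indicator_le_enorm_self _ _
      _ = (∫⁻ y, ‖f y‖ₑ) + ∫⁻ y, ‖h y‖ₑ := lintegral_add_left hf.measurable.enorm _
      _ ≤ _ := by rw [two_mul]; gcongr
  set M := ENNReal.ofReal (1 + 5 ^ n) with hM
  have hg2 : ∫⁻ y, ‖g y‖ₑ ^ (2:ℝ) ≤ M * l * (2 * ∫⁻ y, ‖f y‖ₑ) := by
    calc ∫⁻ y, ‖g y‖ₑ ^ (2:ℝ) ≤ ∫⁻ y, M * l * ‖g y‖ₑ := by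
          refine lintegral_mono fun y => ?_
          rw [ENNReal.rpow_two, sq]
          gcongr
          exact hgl y
      _ = M * l * ∫⁻ y, ‖g y‖ₑ := lintegral_const_mul _ hgm.enorm
      _ ≤ _ := by gcongr
  have e2 : ∀ F : EuclideanSpace ℝ (Fin n) → ℝ, eLpNorm F 2 volume ^ (2:ℝ) = ∫⁻ y, ‖F y‖ₑ ^ (2:ℝ) := by
    intro F
    have := eLpNorm_nnreal_pow_eq_lintegral (μ := volume) (f := F) (p := 2) two_ne_zero
    simpa using this
  have hgL2 : MemLp g 2 := by
    refine ⟨hgm.aestronglyMeasurable, ?_⟩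
    rw [← ENNReal.rpow_lt_top_iff_of_pos (two_pos : (0:ℝ) < 2), e2]
    refine hg2.trans_lt (mul_lt_top (mul_lt_top ofReal_lt_top hl'.lt_top) 
      (mul_lt_top ofNat_lt_top hI.lt_top))
  have hTg : Continuous (convol g k) := continuous_convol hgi.locallyIntegrable hk hkc
  have hfl := hfi.locallyIntegrable
  have hgl' := hgi.locallyIntegrable
  let b : EuclideanSpace ℝ (Fin n) → ℝ := f - g
  have hbi : Integrable b := hfi.sub hgi
  have hTb : Continuous (convol b k) := continuous_convol hbi.locallyIntegrable hk hkc
  set O : Set (EuclideanSpace ℝ (Fin n)) := ⋃ i : u, Metric.ball (i : EuclideanSpace ℝ (Fin n)) (10 * r i) with hO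
  have hOm : MeasurableSet O := MeasurableSet.iUnion fun _ => measurableSet_ball
  have hTbx : ∀ x, ‖convol b k x‖ₑ ≤ ∑' i : u,
      ((∫⁻ y in Q i, ‖f y‖ₑ * ‖k (x - y) - k (x - i)‖ₑ) +
      ∫⁻ y in P i, ‖h y‖ₑ * ‖k (x - y) - k (x - i)‖ₑ) := by
    intro x
    have hif := integrable_convol_integrand hfl hk hkc x
    have hih := integrable_convol_integrand hhi.locallyIntegrable hk hkc x
    have h1 : HasSum (fun i => ∫ y in Q i, f y * k (x - y)) (∫ y in ⋃ i, Q i, f y * k (x - y)) :=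
      hasSum_integral_iUnion hQm hQd hif.integrableOn
    have h2 : HasSum (fun i => ∫ y in P i, h y * k (x - y)) (∫ y in ⋃ i, P i, h y * k (x - y)) :=
      hasSum_integral_iUnion hPm hPd hih.integrableOn
    have h3 : convol b k x = (∫ y in ⋃ i, Q i, f y * k (x - y)) - ∫ y in ⋃ i, P i, h y * k (x - y) := by
      rw [setIntegral_eq_integral_of_forall_compl_eq_zero (s := ⋃ i, P i)
        (fun y hy => by rw [hh0 y hy, zero_mul]),
        ← integral_indicator (MeasurableSet.iUnion hQm), ← integral_sub
          (hif.indicator (MeasurableSet.iUnion hQm)) hih, convol]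
      congr 1
      funext y
      simp only [b, hg, Pi.sub_apply, Pi.add_apply]
      by_cases hy : y ∈ ⋃ i, Q i
      · rw [Set.indicator_of_mem hy, Set.indicator_of_notMem (not_not.2 hy)]; ring
      · rw [Set.indicator_of_notMem hy, Set.indicator_of_mem (Set.mem_compl hy)]; ring
    rw [h3, ← (h1.sub h2).tsum_eq]
    refine enorm_tsum_le_tsum_enorm.trans ?_
    exact ENNReal.tsum_le_tsum fun i => enorm_setIntegral_le_cancellation hk hkc hfi hhi (hmean i) i x
  have hb3 : ∫⁻ x in Oᶜ, ‖convol b k x‖ₑ ≤ 2 * H * ∫⁻ y, ‖f y‖ₑ := by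
    have hkm : ∀ c : EuclideanSpace ℝ (Fin n), Measurable fun p : EuclideanSpace ℝ (Fin n) × EuclideanSpace ℝ (Fin n) => 
        ‖k (p.1 - p.2) - k (p.1 - c)‖ₑ := fun c =>
      Measurable.enorm (Continuous.measurable (by fun_prop))
    have hmeas : ∀ {F : EuclideanSpace ℝ (Fin n) → ℝ} {S : Set (EuclideanSpace ℝ (Fin n))} {c : EuclideanSpace ℝ (Fin n)},
        Measurable F → Measurable fun x => ∫⁻ y in S, ‖F y‖ₑ * ‖k (x - y) - k (x - c)‖ₑ := by
      intro F S c hF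
      exact Measurable.lintegral_prod_right' (f := fun p : EuclideanSpace ℝ (Fin n) × EuclideanSpace ℝ (Fin n) => 
        ‖F p.2‖ₑ * ‖k (p.1 - p.2) - k (p.1 - c)‖ₑ) ((hF.enorm.comp measurable_snd).mul (hkm c))
    calc _ ≤ ∫⁻ x in Oᶜ, ∑' i : u, ((∫⁻ y in Q i, ‖f y‖ₑ * ‖k (x - y) - k (x - i)‖ₑ) +
            ∫⁻ y in P i, ‖h y‖ₑ * ‖k (x - y) - k (x - i)‖ₑ) := lintegral_mono hTbx
      _ = ∑' i : u, ((∫⁻ x in Oᶜ, ∫⁻ y in Q i, ‖f y‖ₑ * ‖k (x - y) - k (x - i)‖ₑ) +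
            ∫⁻ x in Oᶜ, ∫⁻ y in P i, ‖h y‖ₑ * ‖k (x - y) - k (x - i)‖ₑ) := by
          have hm2 : ∀ i : u, AEMeasurable (fun x =>
              (∫⁻ y in Q i, ‖f y‖ₑ * ‖k (x - y) - k (x - i)‖ₑ) +
              ∫⁻ y in P i, ‖h y‖ₑ * ‖k (x - y) - k (x - i)‖ₑ) (volume.restrict Oᶜ) := fun i =>
            ((hmeas hf.measurable).add (hmeas hhm)).aemeasurable
          rw [lintegral_tsum hm2]
          congr 1
          funext i
          exact lintegral_add_left (hmeas hf.measurable) _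
      _ ≤ ∑' i : u, (H * (∫⁻ y in Q i, ‖f y‖ₑ) + H * ∫⁻ y in P i, ‖h y‖ₑ) := by
          refine ENNReal.tsum_le_tsum fun i => add_le_add ?_ ?_
          · refine (lintegral_mono_set (Set.compl_subset_compl.2 (Set.subset_iUnion _ i))).trans ?_
            exact lintegral_compl_ball_cancellation_le hk hf.measurable hH (hr i) (hQm i) (hQs i)
          · refine (lintegral_mono_set (Set.compl_subset_compl.2 (Set.subset_iUnion _ i))).trans ?_
            exact lintegral_compl_ball_cancellation_le hk hhm hH (hr i) (hPm i) (hPs i)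
      _ = H * (∑' i, ∫⁻ y in Q i, ‖f y‖ₑ) + H * ∑' i, ∫⁻ y in P i, ‖h y‖ₑ := by
          rw [ENNReal.tsum_add, ENNReal.tsum_mul_left, ENNReal.tsum_mul_left]
      _ ≤ H * (∫⁻ y, ‖f y‖ₑ) + H * ∫⁻ y, ‖f y‖ₑ := by
          gcongr
          · exact lintegral_iUnion_le_of_disjoint hQm hQd _
          · exact (lintegral_iUnion_le_of_disjoint hPm hPd _).trans hhf
      _ = _ := by ring
  have hsub : {x | 2 * l < ‖convol f k x‖ₑ} ⊆
      {x | l < ‖convol g k x‖ₑ} ∪ (O ∪ ({x | l < ‖convol b k x‖ₑ} ∩ Oᶜ)) := by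
    intro x hx
    by_contra hcon
    simp only [Set.mem_union, Set.mem_inter_iff, Set.mem_ofPred_eq, not_or, not_and, not_lt, 
      Set.mem_compl_iff] at hcon hx
    obtain ⟨h1, h2, h3⟩ := hcon
    have h3 : ‖convol b k x‖ₑ ≤ l := by
      by_contra h4; exact h3 (not_le.1 h4) h2
    have h5 : convol f k x = convol g k x + convol b k x := by
      rw [show b = f - g from rfl, convol_sub hfl hgl' hk hkc]; ring
    rw [h5, two_mul] at hx
    exact absurd (hx.trans_le (enorm_add_le _ _)) (not_lt.2 (add_le_add h1 h3))
  have t1 : l * volume {x | l < ‖convol g k x‖ₑ} ≤ 2 * M * B ^ 2 * ∫⁻ y, ‖f y‖ₑ := by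
    have c1 : l ^ (2:ℝ) * volume {x | l < ‖convol g k x‖ₑ} ≤ ∫⁻ x, ‖convol g k x‖ₑ ^ (2:ℝ) := by
      have := meas_lt_le (μ := volume) (hTg.measurable.enorm.pow_const (2:ℝ)).aemeasurable
        (l := l ^ (2:ℝ))
      simpa only [ENNReal.rpow_lt_rpow_iff (two_pos : (0:ℝ) < 2)] using this
    have c2 : ∫⁻ x, ‖convol g k x‖ₑ ^ (2:ℝ) ≤ B ^ 2 * (M * l * (2 * ∫⁻ y, ‖f y‖ₑ)) := by
      rw [← e2]
      calc _ ≤ (B * eLpNorm g 2 volume) ^ (2:ℝ) := by gcongr; exact hB g hgL2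
        _ = B ^ 2 * ∫⁻ y, ‖g y‖ₑ ^ (2:ℝ) := by
          rw [ENNReal.mul_rpow_of_nonneg _ _ zero_le_two, e2, ENNReal.rpow_two]
        _ ≤ _ := by gcongr
    have c3 : l * (l * volume {x | l < ‖convol g k x‖ₑ}) ≤ l * (2 * M * B ^ 2 * ∫⁻ y, ‖f y‖ₑ) := by
      calc _ = l ^ (2:ℝ) * volume {x | l < ‖convol g k x‖ₑ} := by rw [ENNReal.rpow_two]; ring
        _ ≤ _ := c1.trans c2
        _ = _ := by ring
    exact (ENNReal.mul_le_mul_iff_right hl hl').1 c3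
  have t2 : l * volume O ≤ ENNReal.ofReal (10 ^ n) * ∫⁻ y, ‖f y‖ₑ := by
    refine le_trans ?_ hvol
    gcongr
    exact measure_iUnion_le _
  have t3 : l * volume ({x | l < ‖convol b k x‖ₑ} ∩ Oᶜ) ≤ 2 * H * ∫⁻ y, ‖f y‖ₑ := by
    rw [← Measure.restrict_apply (measurableSet_lt measurable_const hTb.measurable.enorm)]
    exact (meas_lt_le hTb.measurable.enorm.aemeasurable).trans hb3
  calc _ ≤ l * (volume {x | l < ‖convol g k x‖ₑ} + (volume O + volume ({x | l < ‖convol b k x‖ₑ} ∩ Oᶜ))) := by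
        gcongr
        exact (measure_mono hsub).trans ((measure_union_le _ _).trans
          (add_le_add le_rfl (measure_union_le _ _)))
    _ = l * volume {x | l < ‖convol g k x‖ₑ} + (l * volume O +
          l * volume ({x | l < ‖convol b k x‖ₑ} ∩ Oᶜ)) := by ring
    _ ≤ _ := by
        refine (add_le_add t1 (add_le_add t2 t3)).trans (le_of_eq ?_)
        ring

end

section

variable {n : ℕ}

theorem lintegral_Ioc_rpow {a q : ℝ} (ha : 0 < a) (hq : -1 < q) :
    ∫⁻ t in Set.Ioc 0 a, ENNReal.ofReal (t ^ q) = ENNReal.ofReal (a ^ (q + 1) / (q + 1)) := by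
  have hi := (intervalIntegral.intervalIntegrable_rpow' (a := 0) (b := a) hq).1
  rw [← ofReal_integral_eq_lintegral_ofReal hi
    ((ae_restrict_iff' measurableSet_Ioc).2 (Filter.Eventually.of_forall
      fun t ht => Real.rpow_nonneg ht.1.le _)), ← intervalIntegral.integral_of_le ha.le,
    integral_rpow (Or.inl hq), Real.zero_rpow (by linarith), sub_zero]

theorem lintegral_Ioi_rpow {a q : ℝ} (ha : 0 < a) (hq : q < -1) :
    ∫⁻ t in Set.Ioi a, ENNReal.ofReal (t ^ q) = ENNReal.ofReal (-a ^ (q + 1) / (q + 1)) := by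
  rw [← ofReal_integral_eq_lintegral_ofReal (integrableOn_Ioi_rpow_of_lt hq ha)
    ((ae_restrict_iff' measurableSet_Ioi).2 (Filter.Eventually.of_forall
      fun t ht => Real.rpow_nonneg (ha.trans ht).le _)), integral_Ioi_rpow_of_lt hq ha]

/-- The weight describing a weak type bound for the part of a function above height `t` and a
strong `L²` bound for the part below it. -/
def truncWeight (t a : ℝ) : ℝ := t⁻¹ * (if t < a then a else 0) + (t⁻¹) ^ 2 * (min a t) ^ 2

theorem measurable_truncWeight : Measurable fun z : ℝ × ℝ => truncWeight z.1 z.2 := by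
  unfold truncWeight
  refine Measurable.add (measurable_fst.inv.mul ?_) ((measurable_fst.inv.pow_const 2).mul
    ((measurable_snd.min measurable_fst).pow_const 2))
  exact Measurable.ite (measurableSet_lt measurable_fst measurable_snd) measurable_snd
    measurable_const

theorem lintegral_truncWeight_le {p a : ℝ} (hp : 1 < p) (hp2 : p < 2) (ha : 0 ≤ a) :
    ∫⁻ t in Set.Ioi (0:ℝ), ENNReal.ofReal (truncWeight t a) * ENNReal.ofReal (t ^ (p - 1)) ≤
      ENNReal.ofReal (2 / (p - 1) + 1 / (2 - p)) * ENNReal.ofReal (a ^ p) := by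
  rcases ha.eq_or_lt with rfl | ha
  · refine le_of_eq_of_le ?_ (zero_le)
    rw [setLIntegral_congr_fun (g := fun _ => 0) measurableSet_Ioi, lintegral_zero]
    intro t ht
    have ht : 0 < t := ht
    simp [truncWeight, ht.le, ht.not_gt]
  have hp1 : 0 < p - 1 := by linarith
  have hp2' : 0 < 2 - p := by linarith
  have h1 : ∀ t ∈ Set.Ioc 0 a, ENNReal.ofReal (truncWeight t a) * ENNReal.ofReal (t ^ (p - 1)) ≤
      ENNReal.ofReal (2 * a) * ENNReal.ofReal (t ^ (p - 2)) := by
    rintro t ⟨ht, hta⟩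
    rw [← ENNReal.ofReal_mul' (by positivity), ← ENNReal.ofReal_mul (by positivity)]
    refine ENNReal.ofReal_le_ofReal ?_
    have e : t ^ (p - 1) = t * t ^ (p - 2) := by
      rw [← Real.rpow_one_add' ht.le (by linarith)]; congr 1; ring
    rw [e, ← mul_assoc]
    refine mul_le_mul_of_nonneg_right ?_ (by positivity)
    rw [truncWeight, min_eq_right hta]
    have : (if t < a then a else 0) ≤ a := by split_ifs <;> linarith
    calc (t⁻¹ * (if t < a then a else 0) + t⁻¹ ^ 2 * t ^ 2) * t
        = (if t < a then a else 0) + t := by field_simp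
      _ ≤ 2 * a := by linarith
  have h2 : ∀ t ∈ Set.Ioi a, ENNReal.ofReal (truncWeight t a) * ENNReal.ofReal (t ^ (p - 1)) ≤
      ENNReal.ofReal (a ^ 2) * ENNReal.ofReal (t ^ (p - 3)) := by
    intro t hta
    have hta : a < t := hta
    have ht : 0 < t := ha.trans hta
    rw [← ENNReal.ofReal_mul' (by positivity), ← ENNReal.ofReal_mul (by positivity)]
    refine ENNReal.ofReal_le_ofReal (le_of_eq ?_)
    have e : t ^ (p - 1) = t ^ 2 * t ^ (p - 3) := by
      rw [← Real.rpow_natCast, ← Real.rpow_add ht]; congr 1; push_cast; ring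
    rw [e, truncWeight, min_eq_left hta.le, if_neg hta.not_gt]
    field_simp
    ring
  rw [← Set.Ioc_union_Ioi_eq_Ioi ha.le]
  refine (lintegral_union_le _ _ _).trans ?_
  refine (add_le_add (setLIntegral_mono' measurableSet_Ioc h1)
    (setLIntegral_mono' measurableSet_Ioi h2)).trans (le_of_eq ?_)
  rw [lintegral_const_mul' _ _ ofReal_ne_top, lintegral_const_mul' _ _ ofReal_ne_top,
    lintegral_Ioc_rpow ha (by linarith), lintegral_Ioi_rpow ha (by linarith),
    ← ENNReal.ofReal_mul (by positivity), ← ENNReal.ofReal_mul (by positivity),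
    ← ENNReal.ofReal_mul (by positivity), ← ENNReal.ofReal_add]
  · congr 1
    have e1 : a ^ p = a * a ^ (p - 2 + 1) := by
      rw [← Real.rpow_one_add' ha.le (by linarith)]; congr 1; ring
    have e2 : a ^ p = a ^ 2 * a ^ (p - 3 + 1) := by
      rw [← Real.rpow_natCast, ← Real.rpow_add ha]; congr 1; push_cast; ring
    have e3 : -a ^ (p - 3 + 1) / (p - 3 + 1) = a ^ (p - 3 + 1) / (2 - p) := by
      rw [neg_div, ← div_neg]; congr 1; ring
    rw [e3, add_mul]
    nth_rw 1 [e1]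
    rw [e2]
    rw [show p - 2 + 1 = p - 1 by ring]
    ring
  · have : 0 < p - 2 + 1 := by linarith
    positivity
  · have : 0 ≤ -a ^ (p - 3 + 1) / (p - 3 + 1) := 
      div_nonneg_of_nonpos (neg_nonpos.2 (by positivity)) (by linarith)
    positivity

/-- The real interpolation step between a weak type `(1,1)` and a strong type `(2,2)` bound. -/
theorem lintegral_rpow_le_of_truncWeight {α : Type*} [MeasurableSpace α] {μ : Measure α} [SFinite μ]
    {f F : α → ℝ} (hf : Measurable f) (hF : Measurable F) {W : ℝ≥0∞} (hW : W ≠ ⊤)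
    (h : ∀ t, 0 < t → μ {x | t < |F x| / 4} ≤ W * ∫⁻ y, ENNReal.ofReal (truncWeight t |f y|) ∂μ)
    {p : ℝ} (hp : 1 < p) (hp2 : p < 2) :
    ∫⁻ x, ENNReal.ofReal ((|F x| / 4) ^ p) ∂μ ≤
      ENNReal.ofReal p * (W * ENNReal.ofReal (2 / (p - 1) + 1 / (2 - p))) *
        ∫⁻ x, ENNReal.ofReal (|f x| ^ p) ∂μ := by
  have hFm : Measurable fun x => |F x| / 4 := hF.norm.div_const 4
  have hwm : Measurable fun z : ℝ × α => ENNReal.ofReal (truncWeight z.1 |f z.2|) :=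
    (measurable_truncWeight.comp (measurable_fst.prodMk
      (hf.norm.comp measurable_snd))).ennreal_ofReal
  rw [lintegral_rpow_eq_lintegral_meas_lt_mul μ (Filter.Eventually.of_forall fun x => by positivity)
    hFm.aemeasurable (by linarith), mul_assoc]
  gcongr
  calc _ ≤ ∫⁻ t in Set.Ioi (0:ℝ), W * ∫⁻ y, ENNReal.ofReal (truncWeight t |f y|) *
          ENNReal.ofReal (t ^ (p - 1)) ∂μ := by
        refine setLIntegral_mono' measurableSet_Ioi fun t ht => ?_
        rw [lintegral_mul_const' _ _ ofReal_ne_top, ← mul_assoc]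
        gcongr
        exact h t ht
    _ = W * ∫⁻ t in Set.Ioi (0:ℝ), ∫⁻ y, ENNReal.ofReal (truncWeight t |f y|) *
          ENNReal.ofReal (t ^ (p - 1)) ∂μ := lintegral_const_mul' _ _ hW
    _ = W * ∫⁻ y, (∫⁻ t in Set.Ioi (0:ℝ), ENNReal.ofReal (truncWeight t |f y|) *
          ENNReal.ofReal (t ^ (p - 1))) ∂μ := by
        rw [lintegral_lintegral_swap]
        exact (hwm.mul (measurable_fst.pow_const _).ennreal_ofReal).aemeasurable
    _ ≤ W * ∫⁻ y, ENNReal.ofReal (2 / (p - 1) + 1 / (2 - p)) * ENNReal.ofReal (|f y| ^ p) ∂μ := by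
        gcongr with y
        exact lintegral_truncWeight_le hp hp2 (abs_nonneg _)
    _ = _ := by rw [lintegral_const_mul' _ _ ofReal_ne_top, mul_assoc]

theorem lintegral_rpow_convol_le (hn : 1 ≤ n) {k f : EuclideanSpace ℝ (Fin n) → ℝ} (hk : Continuous k)
    (hkc : HasCompactSupport k) {B H : ℝ≥0∞} (hB' : B ≠ ⊤) (hH' : H ≠ ⊤)
    (hB : ∀ f : EuclideanSpace ℝ (Fin n) → ℝ, MemLp f 2 →
      eLpNorm (convol f k) 2 volume ≤ B * eLpNorm f 2 volume)
    (hH : ∀ (y : EuclideanSpace ℝ (Fin n)) (r : ℝ), 0 < r → ‖y‖ ≤ r →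
      ∫⁻ x in {x | 2 * r ≤ ‖x‖}, ‖k (x - y) - k x‖ₑ ≤ H)
    (hf : Continuous f) (hfc : HasCompactSupport f) {p : ℝ} (hp : 1 < p) (hp2 : p < 2) :
    ∫⁻ x, ENNReal.ofReal ((|convol f k x| / 4) ^ p) ≤
      ENNReal.ofReal p * ((2 * ENNReal.ofReal (1 + 5 ^ n) * B ^ 2 + ENNReal.ofReal (10 ^ n) + 2 * H) *
        ENNReal.ofReal (2 / (p - 1) + 1 / (2 - p))) * ∫⁻ x, ENNReal.ofReal (|f x| ^ p) := by
  have hfi : Integrable f := hf.integrable_of_hasCompactSupport hfc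
  set W := 2 * ENNReal.ofReal (1 + 5 ^ n) * B ^ 2 + ENNReal.ofReal (10 ^ n) + 2 * H with hW
  have hWtop : W ≠ ⊤ := by
    simp only [hW, ne_eq, ENNReal.add_eq_top, not_or]
    exact ⟨⟨by finiteness, by finiteness⟩, by finiteness⟩
  have hBW : B ^ 2 ≤ W := by
    have : (1:ℝ≥0∞) ≤ 2 * ENNReal.ofReal (1 + 5 ^ n) := by
      refine one_le_mul one_le_two ?_
      rw [← ENNReal.ofReal_one]
      exact ENNReal.ofReal_le_ofReal (by linarith [pow_pos (by norm_num : (0:ℝ) < 5) n])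
    calc B ^ 2 ≤ 2 * ENNReal.ofReal (1 + 5 ^ n) * B ^ 2 := le_mul_of_one_le_left' this
      _ ≤ W := by rw [hW, add_assoc]; exact le_self_add
  refine lintegral_rpow_le_of_truncWeight hf.measurable
    (continuous_convol hfi.locallyIntegrable hk hkc).measurable hWtop (fun t ht => ?_) hp hp2
  let g : EuclideanSpace ℝ (Fin n) → ℝ := fun x => max (-t) (min (f x) t)
  have hg : Continuous g := continuous_const.max (hf.min continuous_const)
  have hgc : HasCompactSupport g := hfc.comp_left (g := fun a => max (-t) (min a t)) (by simp [ht.le])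
  let b : EuclideanSpace ℝ (Fin n) → ℝ := f - g
  have hb : Continuous b := hf.sub hg
  have hbc : HasCompactSupport b := hfc.sub hgc
  have hgi : Integrable g := hg.integrable_of_hasCompactSupport hgc
  have hbi : Integrable b := hb.integrable_of_hasCompactSupport hbc
  have hga : ∀ x, |g x| = min |f x| t := by
    intro x
    simp only [g]
    rcases le_total 0 (f x) with h | h
    · rw [abs_of_nonneg h, max_eq_right (by have := le_min h ht.le; linarith),
        abs_of_nonneg (le_min h ht.le)]
    · rw [abs_of_nonpos h, min_eq_left (by linarith : f x ≤ t), abs_of_nonpos (max_le (by linarith) h),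
        ← min_neg_neg, neg_neg, min_comm]
  have hba : ∀ x, |b x| ≤ if t < |f x| then |f x| else 0 := by
    intro x
    simp only [b, g, Pi.sub_apply]
    split_ifs with h
    · rcases le_total 0 (f x) with h0 | h0
      · rw [abs_of_nonneg h0] at h ⊢
        rw [min_eq_right h.le, max_eq_right (by linarith), abs_of_nonneg (by linarith)]; linarith
      · rw [abs_of_nonpos h0] at h ⊢
        rw [min_eq_left (by linarith), max_eq_left (by linarith), abs_of_nonpos (by linarith)]; linarith
    · obtain ⟨h1, h2⟩ := abs_le.1 (not_lt.1 h)
      rw [min_eq_left h2, max_eq_right h1, sub_self, abs_zero]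
  set l := ENNReal.ofReal t with hl
  have hl0 : l ≠ 0 := by simpa [hl] using ht
  have hl1 : l ≠ ⊤ := ofReal_ne_top
  have hinv : ENNReal.ofReal t⁻¹ = l⁻¹ := ENNReal.ofReal_inv_of_pos ht
  have w1 := weak_type_convol hn hk hkc hB hH hb hbc hl0 hl1
  rw [← hW] at w1
  have hTg : Continuous (convol g k) := continuous_convol hgi.locallyIntegrable hk hkc
  have e2 : ∀ F : EuclideanSpace ℝ (Fin n) → ℝ, eLpNorm F 2 volume ^ (2:ℝ) = ∫⁻ y, ‖F y‖ₑ ^ (2:ℝ) := by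
    intro F
    have := eLpNorm_nnreal_pow_eq_lintegral (μ := volume) (f := F) (p := 2) two_ne_zero
    simpa using this
  have w2 : l ^ 2 * volume {x | l < ‖convol g k x‖ₑ} ≤ B ^ 2 * ∫⁻ y, ‖g y‖ₑ ^ 2 := by
    have := meas_lt_le (μ := volume) (hTg.measurable.enorm.pow_const (2:ℝ)).aemeasurable
      (l := l ^ (2:ℝ))
    simp only [ENNReal.rpow_lt_rpow_iff (two_pos : (0:ℝ) < 2)] at this
    rw [← e2] at this
    have h2 := ENNReal.rpow_le_rpow (hB g (hg.memLp_of_hasCompactSupport hgc)) zero_le_two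
    rw [ENNReal.mul_rpow_of_nonneg _ _ zero_le_two, e2 g] at h2
    simpa only [ENNReal.rpow_two] using this.trans h2
  have hsub : {x | t < |convol f k x| / 4} ⊆
      {x | 2 * l < ‖convol b k x‖ₑ} ∪ {x | l < ‖convol g k x‖ₑ} := by
    intro x hx
    have hx : t < |convol f k x| / 4 := hx
    by_contra hcon
    simp only [Set.mem_union, Set.mem_ofPred_eq, not_or, not_lt] at hcon
    have h1 : |convol b k x| ≤ 2 * t := by
      have := hcon.1
      rw [hl, ← ofReal_norm, ← ENNReal.ofReal_ofNat, ← ENNReal.ofReal_mul zero_le_two,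
        ENNReal.ofReal_le_ofReal_iff (by positivity)] at this
      exact this
    have h2 : |convol g k x| ≤ t := by
      have := hcon.2
      rw [hl, ← ofReal_norm, ENNReal.ofReal_le_ofReal_iff ht.le] at this
      exact this
    have h5 : convol f k x = convol b k x + convol g k x := by
      rw [show b = f - g from rfl, convol_sub hfi.locallyIntegrable hgi.locallyIntegrable hk hkc]; ring
    have := abs_add_le (convol b k x) (convol g k x)
    rw [← h5] at this
    linarith
  have s1 : volume {x | 2 * l < ‖convol b k x‖ₑ} ≤
      W * ∫⁻ y, ENNReal.ofReal (t⁻¹ * if t < |f y| then |f y| else 0) := by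
    rw [← ENNReal.mul_le_mul_iff_right hl0 hl1]
    refine w1.trans ?_
    rw [mul_left_comm]
    gcongr
    rw [← lintegral_const_mul' _ _ hl1]
    refine lintegral_mono fun y => ?_
    rw [hl, ← ENNReal.ofReal_mul ht.le, ← mul_assoc, mul_inv_cancel₀ ht.ne', one_mul, ← ofReal_norm]
    exact ENNReal.ofReal_le_ofReal (hba y)
  have s2 : volume {x | l < ‖convol g k x‖ₑ} ≤
      W * ∫⁻ y, ENNReal.ofReal ((t⁻¹) ^ 2 * (min |f y| t) ^ 2) := by
    have hl20 : l ^ 2 ≠ 0 := pow_ne_zero _ hl0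
    have hl21 : l ^ 2 ≠ ⊤ := by finiteness
    rw [← ENNReal.mul_le_mul_iff_right hl20 hl21]
    refine w2.trans ?_
    rw [mul_left_comm]
    gcongr
    rw [← lintegral_const_mul' _ _ hl21]
    refine lintegral_mono fun y => ?_
    rw [hl, ← ENNReal.ofReal_pow ht.le, ← ENNReal.ofReal_mul (by positivity), ← mul_assoc, ← mul_pow,
      mul_inv_cancel₀ ht.ne', one_pow, one_mul, ← ofReal_norm, ← ENNReal.ofReal_pow (norm_nonneg _),
      Real.norm_eq_abs, hga]
  refine (measure_mono hsub).trans ((measure_union_le _ _).trans ((add_le_add s1 s2).trans ?_))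
  rw [← mul_add, ← lintegral_add_left]
  · gcongr with y
    rw [← ENNReal.ofReal_add]
    · exact ENNReal.ofReal_le_ofReal le_rfl
    · split_ifs <;> positivity
    · positivity
  · exact ((Measurable.ite (measurableSet_lt measurable_const hf.measurable.norm) hf.measurable.norm
      measurable_const).const_mul _).ennreal_ofReal

end

section

variable {n : ℕ}

theorem eLpNorm_rpow_eq_lintegral {α : Type*} [MeasurableSpace α] {μ : Measure α} {p : ℝ}
    (hp : 0 < p) (F : α → ℝ) :
    eLpNorm F (ENNReal.ofReal p) μ ^ p = ∫⁻ x, ENNReal.ofReal (|F x| ^ p) ∂μ := by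
  have h := eLpNorm_nnreal_pow_eq_lintegral (μ := μ) (f := F) (p := p.toNNReal)
    (by simpa using hp)
  rw [Real.coe_toNNReal _ hp.le] at h
  refine h.trans (lintegral_congr fun x => ?_)
  rw [← ofReal_norm, ENNReal.ofReal_rpow_of_nonneg (norm_nonneg _) hp.le, Real.norm_eq_abs]

theorem eLpNorm_le_of_lintegral {α : Type*} [MeasurableSpace α] {μ : Measure α} {p : ℝ}
    (hp : 0 < p) {f F : α → ℝ} {D : ℝ≥0∞}
    (h : ∫⁻ x, ENNReal.ofReal ((|F x| / 4) ^ p) ∂μ ≤ D * ∫⁻ x, ENNReal.ofReal (|f x| ^ p) ∂μ) :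
    eLpNorm F (ENNReal.ofReal p) μ ≤ 4 * D ^ (1 / p) * eLpNorm f (ENNReal.ofReal p) μ := by
  have e : ∀ x, |F x| / 4 = |((1/4 : ℝ) • F) x| := fun x => by
    simp [abs_mul]; ring
  simp_rw [e] at h
  rw [← eLpNorm_rpow_eq_lintegral hp, ← eLpNorm_rpow_eq_lintegral hp] at h
  have h2 := ENNReal.rpow_le_rpow h (by positivity : 0 ≤ 1 / p)
  rw [ENNReal.mul_rpow_of_nonneg _ _ (by positivity), ← ENNReal.rpow_mul, ← ENNReal.rpow_mul,
    mul_one_div_cancel hp.ne', ENNReal.rpow_one, ENNReal.rpow_one] at h2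
  have e4 : F = (4 : ℝ) • (1/4 : ℝ) • F := by rw [smul_smul]; norm_num
  calc eLpNorm F (ENNReal.ofReal p) μ = eLpNorm ((4 : ℝ) • (1/4 : ℝ) • F) (ENNReal.ofReal p) μ := by rw [← e4]
    _ = 4 * eLpNorm ((1/4 : ℝ) • F) (ENNReal.ofReal p) μ := by
        rw [eLpNorm_const_smul, Real.enorm_eq_ofReal (by norm_num), ENNReal.ofReal_ofNat]
    _ ≤ _ := by rw [mul_assoc]; gcongr

theorem SymbolBound.comp_neg {a A : ℝ} {m : EuclideanSpace ℝ (Fin n) → ℝ} (h : SymbolBound a A m) :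
    SymbolBound a A fun x => m (-x) := by
  intro x hx i hi
  have := (LinearIsometryEquiv.neg ℝ (E := EuclideanSpace ℝ (Fin n))).norm_iteratedFDeriv_comp_right (𝕜 := ℝ) m x i
  refine (le_of_eq this).trans ?_
  simpa using h (-x) (neg_ne_zero.2 hx) i hi

theorem integral_convol_mul {f h k : EuclideanSpace ℝ (Fin n) → ℝ} (hf : Continuous f)
    (hfc : HasCompactSupport f) (hh : Continuous h) (hhc : HasCompactSupport h) (hk : Continuous k) :
    ∫ x, convol f k x * h x = ∫ y, f y * convol h (fun z => k (-z)) y := by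
  have hi : Integrable (Function.uncurry fun x y => f y * k (x - y) * h x)
      ((volume : Measure (EuclideanSpace ℝ (Fin n))).prod volume) := by
    refine Continuous.integrable_of_hasCompactSupport (by fun_prop) ?_
    refine HasCompactSupport.intro (hhc.isCompact.prod hfc.isCompact) ?_
    rintro ⟨x, y⟩ hxy
    rw [Set.mem_prod, not_and_or] at hxy
    rcases hxy with h1 | h1
    · simp [image_eq_zero_of_notMem_tsupport h1]
    · simp [image_eq_zero_of_notMem_tsupport h1]
  simp only [convol, ← integral_mul_const, ← integral_const_mul]
  rw [integral_integral_swap hi]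
  refine integral_congr_ae (Filter.Eventually.of_forall fun y => ?_)
  refine integral_congr_ae (Filter.Eventually.of_forall fun x => ?_)
  simp only [neg_sub]
  ring

theorem eLpNorm_convol_le_of_dual {p q : ℝ} (hpq : p.HolderConjugate q) (hp2 : 2 < p) {k f : EuclideanSpace ℝ (Fin n) → ℝ}
    (hk : Continuous k) (hkc : HasCompactSupport k) {C : ℝ≥0∞}
    (hC : ∀ h : EuclideanSpace ℝ (Fin n) → ℝ, Continuous h → HasCompactSupport h →
      eLpNorm (convol h fun z => k (-z)) (ENNReal.ofReal q) volume ≤ C * eLpNorm h (ENNReal.ofReal q) volume)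
    (hf : Continuous f) (hfc : HasCompactSupport f) :
    eLpNorm (convol f k) (ENNReal.ofReal p) volume ≤ C * eLpNorm f (ENNReal.ofReal p) volume := by
  have hp0 : 0 < p := by linarith
  have hfl := (hf.integrable_of_hasCompactSupport hfc (μ := volume)).locallyIntegrable
  set F := convol f k with hF
  have hFc : Continuous F := continuous_convol hfl hk hkc
  have hFs : HasCompactSupport F := hasCompactSupport_convol hfc hkc
  let h : EuclideanSpace ℝ (Fin n) → ℝ := fun x => F x * |F x| ^ (p - 2)
  have hh : Continuous h := hFc.mul (hFc.abs.rpow_const fun _ => Or.inr (by linarith))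
  have hhc : HasCompactSupport h := hFs.mul_right
  have habs : ∀ x, |h x| = |F x| ^ (p - 1) := by
    intro x
    simp only [h]
    rw [abs_mul, abs_of_nonneg (Real.rpow_nonneg (abs_nonneg _) _),
      ← Real.rpow_one_add' (abs_nonneg _) (by linarith)]
    congr 1; ring
  have hFh : ∀ x, F x * h x = |F x| ^ p := by
    intro x
    simp only [h]
    rw [← mul_assoc, ← abs_mul_abs_self, mul_assoc, ← Real.rpow_one_add' (abs_nonneg _) (by linarith),
      ← Real.rpow_one_add' (abs_nonneg _) (by linarith)]
    congr 1; ring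
  set N := eLpNorm F (ENNReal.ofReal p) volume with hN
  have hNtop : N ≠ ⊤ := (hFc.memLp_of_hasCompactSupport hFs).2.ne
  have hhq : eLpNorm h (ENNReal.ofReal q) volume = N ^ (p - 1) := by
    rw [hN]
    have e1 : eLpNorm h (ENNReal.ofReal q) volume = eLpNorm (fun x => ‖F x‖ ^ (p - 1)) (ENNReal.ofReal q) volume := by
      refine eLpNorm_congr_norm_ae (Filter.Eventually.of_forall fun x => ?_)
      rw [Real.norm_eq_abs, habs, Real.norm_of_nonneg (Real.rpow_nonneg (norm_nonneg _) _), Real.norm_eq_abs]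
    rw [e1, eLpNorm_norm_rpow _ (by linarith), ← ENNReal.ofReal_mul hpq.symm.nonneg, mul_comm, hpq.sub_one_mul_conj]
  have hconj : (ENNReal.ofReal p).HolderConjugate (ENNReal.ofReal q) := hpq.ennrealOfReal
  have hk' : Continuous fun z => k (-z) := hk.comp continuous_neg
  have hkc' : HasCompactSupport fun z => k (-z) := hkc.comp_homeomorph (Homeomorph.neg _)
  have hhl := (hh.integrable_of_hasCompactSupport hhc (μ := volume)).locallyIntegrable
  have key : N ^ p ≤ N ^ (p - 1) * (C * eLpNorm f (ENNReal.ofReal p) volume) := by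
    have i1 : Integrable fun x => F x * h x :=
      (hFc.mul hh).integrable_of_hasCompactSupport hFs.mul_right
    rw [hN, eLpNorm_rpow_eq_lintegral hp0]
    calc ∫⁻ x, ENNReal.ofReal (|F x| ^ p) = ∫⁻ x, ENNReal.ofReal (F x * h x) := by simp_rw [hFh]
      _ = ENNReal.ofReal (∫ x, F x * h x) := by
          refine (ofReal_integral_eq_lintegral_ofReal i1 (Filter.Eventually.of_forall fun x => ?_)).symm
          simp only [hFh]
          exact Real.rpow_nonneg (abs_nonneg _) _
      _ = ENNReal.ofReal (∫ y, f y * convol h (fun z => k (-z)) y) := by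
          rw [integral_convol_mul hf hfc hh hhc hk]
      _ ≤ ‖∫ y, f y * convol h (fun z => k (-z)) y‖ₑ := by
          rw [← ofReal_norm]; exact ENNReal.ofReal_le_ofReal (le_abs_self _)
      _ ≤ ∫⁻ y, ‖f y * convol h (fun z => k (-z)) y‖ₑ := enorm_integral_le_lintegral_enorm _
      _ = eLpNorm (f • convol h fun z => k (-z)) 1 volume := by
          rw [eLpNorm_one_eq_lintegral_enorm]; rfl
      _ ≤ eLpNorm f (ENNReal.ofReal p) volume * eLpNorm (convol h fun z => k (-z)) (ENNReal.ofReal q) volume :=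
          eLpNorm_smul_le_mul_eLpNorm
            (continuous_convol hhl hk' hkc').aestronglyMeasurable hf.aestronglyMeasurable
      _ ≤ eLpNorm f (ENNReal.ofReal p) volume * (C * N ^ (p - 1)) := by
          gcongr
          rw [← hhq]
          exact hC h hh hhc
      _ = _ := by ring
  rcases eq_or_ne N 0 with h0 | h0
  · rw [h0]; exact zero_le
  have e : N ^ p = N ^ (p - 1) * N := by
    conv_rhs => rw [← ENNReal.rpow_one N, ← ENNReal.rpow_mul, one_mul,
      ← ENNReal.rpow_add _ _ h0 hNtop, sub_add_cancel]
  rw [e] at key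
  refine (ENNReal.mul_le_mul_iff_right ?_ ?_).1 key
  · exact (ENNReal.rpow_pos (pos_iff_ne_zero.2 h0) hNtop).ne'
  · exact ENNReal.rpow_ne_top_of_nonneg (by linarith) hNtop

/-- The `Lᵖ` bound, uniform over regularised kernels, for convolution with first derivatives of
kernels satisfying homogeneous symbol bounds of order `1 - n`. -/
theorem exists_eLpNorm_convol_fderiv_le (hn : 2 ≤ n) {p : ℝ} (hp : 1 < p) {A : ℝ} (hA : 0 ≤ A) :
    ∃ C : ℝ≥0∞, C ≠ ⊤ ∧ ∀ (m : EuclideanSpace ℝ (Fin n) → ℝ) (v : EuclideanSpace ℝ (Fin n)),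
      ContDiff ℝ (⊤ : ℕ∞) m → HasCompactSupport m → SymbolBound (1 - n) A m → ‖v‖ ≤ 1 →
      ∀ f : EuclideanSpace ℝ (Fin n) → ℝ, Continuous f → HasCompactSupport f →
        eLpNorm (convol f fun x => fderiv ℝ m x v) (ENNReal.ofReal p) volume ≤
          C * eLpNorm f (ENNReal.ofReal p) volume := by
  obtain ⟨C₁, hC₁, h1⟩ := exists_norm_mul_norm_fourier_le hn
  obtain ⟨C₂, hC₂, h2⟩ := lintegral_compl_ball_enorm_sub_le hn
  have L2 : ∀ (m : EuclideanSpace ℝ (Fin n) → ℝ) (v : EuclideanSpace ℝ (Fin n)),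
      ContDiff ℝ (⊤ : ℕ∞) m → HasCompactSupport m → SymbolBound (1 - n) A m → ‖v‖ ≤ 1 →
      ∀ f : EuclideanSpace ℝ (Fin n) → ℝ, MemLp f 2 →
        eLpNorm (convol f fun x => fderiv ℝ m x v) 2 volume ≤
          ENNReal.ofReal (2 * Real.pi * (C₁ * A)) * eLpNorm f 2 volume := by
    intro m v hm hmc hmA hv f hf
    refine eLpNorm_two_convol_le hf ((hm.fderiv_right (by exact_mod_cast le_top)).clm_apply contDiff_const)
      (hmc.fderiv_apply ℝ v) fun ξ => ?_
    refine (norm_fourier_fderiv_apply_le hm hmc v ξ).trans ?_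
    have := h1 A m hA hm hmc hmA ξ
    have hpi := Real.pi_pos.le
    calc _ ≤ 2 * Real.pi * 1 * (C₁ * A) := by gcongr
      _ = _ := by ring
  have Lp : ∀ q : ℝ, 1 < q → q < 2 → ∃ C : ℝ≥0∞, C ≠ ⊤ ∧ 
      ∀ (m : EuclideanSpace ℝ (Fin n) → ℝ) (v : EuclideanSpace ℝ (Fin n)),
      ContDiff ℝ (⊤ : ℕ∞) m → HasCompactSupport m → SymbolBound (1 - n) A m → ‖v‖ ≤ 1 →
      ∀ f : EuclideanSpace ℝ (Fin n) → ℝ, Continuous f → HasCompactSupport f →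
        eLpNorm (convol f fun x => fderiv ℝ m x v) (ENNReal.ofReal q) volume ≤
          C * eLpNorm f (ENNReal.ofReal q) volume := by
    intro q hq hq2
    set D : ℝ≥0∞ := ENNReal.ofReal q * ((2 * ENNReal.ofReal (1 + 5 ^ n) *
      ENNReal.ofReal (2 * Real.pi * (C₁ * A)) ^ 2 + ENNReal.ofReal (10 ^ n) + 2 * ENNReal.ofReal (C₂ * A)) *
        ENNReal.ofReal (2 / (q - 1) + 1 / (2 - q))) with hD
    have hDtop : D ≠ ⊤ := by
      rw [hD]
      refine ENNReal.mul_ne_top ofReal_ne_top (ENNReal.mul_ne_top ?_ ofReal_ne_top)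
      simp only [ne_eq, ENNReal.add_eq_top, not_or]
      exact ⟨⟨by finiteness, by finiteness⟩, by finiteness⟩
    refine ⟨4 * D ^ (1 / q), ENNReal.mul_ne_top (by finiteness)
      (ENNReal.rpow_ne_top_of_nonneg (by positivity) hDtop), ?_⟩
    intro m v hm hmc hmA hv f hf hfc
    refine eLpNorm_le_of_lintegral (by linarith) ?_
    refine lintegral_rpow_convol_le (by omega)
      ((hm.continuous_fderiv (by simp)).clm_apply continuous_const)
      (hmc.fderiv_apply ℝ v) ofReal_ne_top ofReal_ne_top (L2 m v hm hmc hmA hv) ?_ hf hfc hq hq2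
    intro y r hr hy
    refine (h2 A m v hm hmA y r hr hy).trans (ENNReal.ofReal_le_ofReal ?_)
    gcongr
    exact mul_le_of_le_one_right hA hv
  rcases lt_trichotomy p 2 with hp2 | rfl | hp2
  · exact Lp p hp hp2
  · refine ⟨ENNReal.ofReal (2 * Real.pi * (C₁ * A)), ofReal_ne_top, fun m v hm hmc hmA hv f hf hfc => ?_⟩
    rw [ENNReal.ofReal_ofNat]
    exact L2 m v hm hmc hmA hv f (hf.memLp_of_hasCompactSupport hfc)
  · have hpq := Real.HolderConjugate.conjExponent hp
    obtain ⟨C, hC, h⟩ := Lp (Real.conjExponent p) hpq.symm.lt (by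
      rw [Real.conjExponent, div_lt_iff₀ (by linarith)]; linarith)
    refine ⟨C, hC, fun m v hm hmc hmA hv f hf hfc => ?_⟩
    refine eLpNorm_convol_le_of_dual hpq hp2
      ((hm.continuous_fderiv (by simp)).clm_apply continuous_const)
      (hmc.fderiv_apply ℝ v) (fun g hg hgc => ?_) hf hfc
    have hm' : ContDiff ℝ (⊤ : ℕ∞) fun x => m (-x) := hm.comp contDiff_neg
    have := h (fun x => m (-x)) (-v) hm' (hmc.comp_homeomorph (Homeomorph.neg _)) hmA.comp_neg
      (by rwa [norm_neg]) g hg hgc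
    convert this using 4 with x
    have e := ((hm.differentiable (by simp) (-x)).hasFDerivAt).comp x (hasFDerivAt_id x).neg
    rw [show (fun x => m (-x)) = m ∘ Neg.neg from rfl, HasFDerivAt.fderiv e]
    simp

end

section

variable {n : ℕ}

open Filter Topology

theorem convol_eq_convolution_flip (f k : EuclideanSpace ℝ (Fin n) → ℝ) :
    convol f k = convolution k f (ContinuousLinearMap.lsmul ℝ ℝ).flip volume := by
  rw [convol_eq_convolution, convolution_flip]

theorem fderiv_convol_left {f k : EuclideanSpace ℝ (Fin n) → ℝ} (hf : ContDiff ℝ (⊤ : ℕ∞) f)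
    (hfc : HasCompactSupport f) (hk : LocallyIntegrable k) (x v : EuclideanSpace ℝ (Fin n)) :
    fderiv ℝ (convol f k) x v = convol (fun y => fderiv ℝ f y v) k x := by
  rw [convol_eq_convolution_flip, convol_eq_convolution_flip,
    (hfc.hasFDerivAt_convolution_right (ContinuousLinearMap.lsmul ℝ ℝ).flip hk
      (hf.of_le (by exact_mod_cast le_top)) x).fderiv]
  exact convolution_precompR_apply _ hk (hfc.fderiv ℝ) (hf.continuous_fderiv (by simp)) x v

theorem fderiv_convol_right {f k : EuclideanSpace ℝ (Fin n) → ℝ} (hf : LocallyIntegrable f)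
    (hk : ContDiff ℝ (⊤ : ℕ∞) k) (hkc : HasCompactSupport k) (x v : EuclideanSpace ℝ (Fin n)) :
    fderiv ℝ (convol f k) x v = convol f (fun y => fderiv ℝ k y v) x := by
  rw [convol_eq_convolution, convol_eq_convolution,
    (hkc.hasFDerivAt_convolution_right (ContinuousLinearMap.lsmul ℝ ℝ) hf
      (hk.of_le (by exact_mod_cast le_top)) x).fderiv]
  exact convolution_precompR_apply _ hf (hkc.fderiv ℝ) (hk.continuous_fderiv (by simp)) x v

theorem contDiff_convol {f k : EuclideanSpace ℝ (Fin n) → ℝ} (hf : ContDiff ℝ (⊤ : ℕ∞) f)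
    (hfc : HasCompactSupport f) (hk : LocallyIntegrable k) :
    ContDiff ℝ (⊤ : ℕ∞) (convol f k) := by
  rw [convol_eq_convolution]
  exact hfc.contDiff_convolution_left _ hf hk

/-- A compactly supported function times a kernel of type `1` is integrable. -/
theorem IsKernelOfType.integrable_mul (hn : 2 ≤ n) {K ψ : EuclideanSpace ℝ (Fin n) → ℝ}
    (hK : IsKernelOfType n 1 K) (hψ : Continuous ψ) (hψc : HasCompactSupport ψ) :
    Integrable fun x => ψ x * K x := by
  have hnt : Nontrivial (EuclideanSpace ℝ (Fin n)) := by
    have : NeZero n := ⟨by omega⟩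
    infer_instance
  obtain ⟨A, hA, hKA⟩ := hK.exists_symbolBound
  obtain ⟨M, hM⟩ := hψ.bounded_above_of_compact_support hψc
  obtain ⟨R, hR0, hR⟩ := hψc.isCompact.isBounded.subset_closedBall_lt 0 0
  have hae : ∀ᵐ x : EuclideanSpace ℝ (Fin n), x ∈ ({0}ᶜ : Set (EuclideanSpace ℝ (Fin n))) :=
    compl_mem_ae_iff.2 (measure_singleton 0)
  have hKm : AEStronglyMeasurable K := by
    have := hK.1.continuousOn.aestronglyMeasurable (μ := volume)
      (measurableSet_singleton (0 : EuclideanSpace ℝ (Fin n))).compl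
    rwa [Measure.restrict_eq_self_of_ae_mem hae] at this
  refine ((integrable_rpow_norm_closedBall hn hR0).1.const_mul (M * A)).mono'
    (hψ.aestronglyMeasurable.mul hKm) ?_
  filter_upwards [hae] with x hx
  have hM0 : 0 ≤ M := (norm_nonneg _).trans (hM x)
  by_cases hxR : ‖x‖ ∈ Set.Iic R
  · rw [Set.indicator_of_mem hxR, norm_mul, mul_assoc]
    have := hKA x hx 0 (by norm_num)
    rw [norm_iteratedFDeriv_zero] at this
    refine mul_le_mul (hM x) ?_ (norm_nonneg _) hM0
    simpa using this
  · rw [Set.indicator_of_notMem hxR]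
    have : ψ x = 0 := by
      by_contra h
      exact hxR (by simpa using hR (subset_tsupport _ h))
    simp [this]

/-- A truncated kernel of type `1` is a dominated pointwise limit of test functions obeying uniform
symbol bounds. -/
theorem IsKernelOfType.exists_approx {K ψ : EuclideanSpace ℝ (Fin n) → ℝ}
    (hK : IsKernelOfType n 1 K) (hψ : ContDiff ℝ (⊤ : ℕ∞) ψ) (hψc : HasCompactSupport ψ) :
    ∃ A : ℝ, 0 ≤ A ∧ ∃ m : ℕ → EuclideanSpace ℝ (Fin n) → ℝ,
      (∀ j, ContDiff ℝ (⊤ : ℕ∞) (m j)) ∧ (∀ j, HasCompactSupport (m j)) ∧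
      (∀ j, SymbolBound (1 - n) A (m j)) ∧ (∀ j x, ‖m j x‖ ≤ ‖ψ x * K x‖) ∧
      ∀ x, x ≠ 0 → Tendsto (fun j => m j x) atTop (𝓝 (ψ x * K x)) := by
  let φ : ContDiffBump (0 : EuclideanSpace ℝ (Fin n)) := ⟨1, 2, by norm_num, by norm_num⟩
  have hφ : ContDiff ℝ (⊤ : ℕ∞) φ := φ.contDiff
  obtain ⟨A, hA, hKA⟩ := hK.exists_symbolBound
  obtain ⟨B, hB, hψB⟩ := exists_symbolBound_zero hψ hψc
  obtain ⟨E, hE, hφE⟩ := exists_symbolBound_zero hφ φ.hasCompactSupport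
  have h2 : (2 : WithTop ℕ∞) ≤ ((⊤ : ℕ∞) : WithTop ℕ∞) := by
    exact WithTop.coe_le_coe.2 (le_top : (2 : ℕ∞) ≤ ⊤)
  have hη : ∀ j : ℕ, ContDiff ℝ (⊤ : ℕ∞) fun x => φ (((j : ℝ) + 1) • x) := fun j =>
    hφ.comp (contDiff_const_smul _)
  refine ⟨4 * (1 + E) * (4 * B * A), by positivity,
    fun j x => (1 - φ (((j : ℝ) + 1) • x)) * (ψ x * K x), fun j => ?_, fun j => ?_, fun j => ?_,
    fun j x => ?_, fun x hx => ?_⟩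
  · rw [contDiff_iff_contDiffAt]
    intro x
    rcases eq_or_ne x 0 with rfl | hx
    · have h0 : (fun x => (1 - φ (((j : ℝ) + 1) • x)) * (ψ x * K x)) =ᶠ[𝓝 0] fun _ => 0 := by
        have ht : Tendsto (fun x : EuclideanSpace ℝ (Fin n) => ((j : ℝ) + 1) • x) (𝓝 0) (𝓝 0) := by
          have := (continuous_const_smul ((j : ℝ) + 1)).tendsto (0 : EuclideanSpace ℝ (Fin n))
          rwa [smul_zero] at this
        filter_upwards [ht.eventually φ.eventuallyEq_one] with x hx
        rw [hx]; simp
      exact contDiffAt_const.congr_of_eventuallyEq h0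
    · exact (contDiffAt_const.sub (hη j).contDiffAt).mul (hψ.contDiffAt.mul
        (hK.1.contDiffAt (isOpen_compl_singleton.mem_nhds hx)))
  · exact (hψc.mul_right (f' := K)).mul_left (f := fun x => 1 - φ (((j : ℝ) + 1) • x))
  · have h1 := ((hφE.comp_smul hφ (by positivity : (0 : ℝ) < (j : ℝ) + 1)).one_sub
      ((hη j))).mul (hψB.mul hKA (hψ.of_le h2).contDiffOn (hK.1.of_le h2))
      ((contDiff_const.sub (hη j)).of_le h2).contDiffOn
      ((hψ.of_le h2).contDiffOn.mul (hK.1.of_le h2))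
    simpa using h1
  · rw [norm_mul]
    refine mul_le_of_le_one_left (norm_nonneg _) ?_
    rw [Real.norm_eq_abs, abs_le]
    constructor <;> linarith [φ.nonneg (x := ((j : ℝ) + 1) • x), φ.le_one (x := ((j : ℝ) + 1) • x)]
  · refine tendsto_const_nhds.congr' ?_
    obtain ⟨N, hN⟩ := exists_nat_ge (2 / ‖x‖)
    filter_upwards [eventually_ge_atTop N] with j hj
    rw [φ.zero_of_le_dist]
    · ring
    · have hx' := norm_pos_iff.2 hx
      rw [dist_zero_right, norm_smul, Real.norm_of_nonneg (by positivity)]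
      rw [div_le_iff₀ hx'] at hN
      have : (N : ℝ) ≤ j := by exact_mod_cast hj
      change (2 : ℝ) ≤ _
      nlinarith

theorem exists_eLpNorm_convol_fderiv_kernel_le (hn : 2 ≤ n) {p : ℝ} (hp : 1 < p)
    {K ψ : EuclideanSpace ℝ (Fin n) → ℝ}
    (hK : IsKernelOfType n 1 K) (hψ : ContDiff ℝ (⊤ : ℕ∞) ψ) (hψc : HasCompactSupport ψ) :
    ∃ C : ℝ≥0∞, C ≠ ⊤ ∧ ∀ (g : EuclideanSpace ℝ (Fin n) → ℝ) (v : EuclideanSpace ℝ (Fin n)),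
      ContDiff ℝ (⊤ : ℕ∞) g → HasCompactSupport g → ‖v‖ ≤ 1 →
      eLpNorm (convol (fun y => fderiv ℝ g y v) fun x => ψ x * K x) (ENNReal.ofReal p) volume ≤
        C * eLpNorm g (ENNReal.ofReal p) volume := by
  have hnt : Nontrivial (EuclideanSpace ℝ (Fin n)) := by
    have : NeZero n := ⟨by omega⟩
    infer_instance
  obtain ⟨A, hA, m, hm, hmc, hmA, hmle, hlim⟩ := hK.exists_approx hψ hψc
  obtain ⟨C, hC, h⟩ := exists_eLpNorm_convol_fderiv_le hn hp hA
  refine ⟨C, hC, fun g v hg hgc hv => ?_⟩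
  have hgl := (hg.continuous.integrable_of_hasCompactSupport hgc (μ := volume)).locallyIntegrable
  have hd : Continuous fun y => fderiv ℝ g y v :=
    (hg.continuous_fderiv (by simp)).clm_apply continuous_const
  have hdc : HasCompactSupport fun y => fderiv ℝ g y v := hgc.fderiv_apply ℝ v
  have hdl := (hd.integrable_of_hasCompactSupport hdc (μ := volume)).locallyIntegrable
  obtain ⟨M, hM⟩ := hd.bounded_above_of_compact_support hdc
  have hL := hK.integrable_mul hn hψ.continuous hψc
  refine (Lp.eLpNorm_lim_le_liminf_eLpNorm
    (f := fun j => convol (fun y => fderiv ℝ g y v) (m j))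
    (fun j => (continuous_convol hdl (hm j).continuous (hmc j)).aestronglyMeasurable) _
    (ae_of_all _ fun x => ?_)).trans ?_
  · refine tendsto_integral_of_dominated_convergence (fun y => M * ‖ψ (x - y) * K (x - y)‖)
      (fun j => (hd.mul ((hm j).continuous.comp (continuous_const.sub continuous_id))).aestronglyMeasurable)
      ((hL.comp_sub_left x).norm.const_mul M) (fun j => ae_of_all _ fun y => ?_) ?_
    · rw [norm_mul]
      exact mul_le_mul (hM y) (hmle j _) (norm_nonneg _) ((norm_nonneg _).trans (hM y))
    · have hae : ∀ᵐ y : EuclideanSpace ℝ (Fin n), y ∈ ({x}ᶜ : Set (EuclideanSpace ℝ (Fin n))) :=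
        compl_mem_ae_iff.2 (measure_singleton x)
      filter_upwards [hae] with y hy
      exact (hlim (x - y) (sub_ne_zero.2 fun h => hy h.symm)).const_mul _
  · refine (liminf_le_liminf (v := fun _ => C * eLpNorm g (ENNReal.ofReal p) volume)
      (Eventually.of_forall fun j => ?_)).trans (by simp)
    have e : convol (fun y => fderiv ℝ g y v) (m j) = convol g fun x => fderiv ℝ (m j) x v := by
      ext x
      rw [← fderiv_convol_right hgl (hm j) (hmc j) x v, ← fderiv_convol_left hg hgc
        ((hm j).continuous.integrable_of_hasCompactSupport (hmc j)).locallyIntegrable x v]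
    rw [e]
    exact h (m j) v (hm j) (hmc j) (hmA j) hv g hg.continuous hgc

end

section

variable {n : ℕ}

/-- Young's inequality `L^p * L^1 ⊆ L^p`. -/
theorem eLpNorm_convol_le {p : ℝ} (hp : 1 < p) {f k : EuclideanSpace ℝ (Fin n) → ℝ}
    (hf : AEStronglyMeasurable f) (hki : Integrable k) :
    eLpNorm (convol f k) (ENNReal.ofReal p) volume ≤
      eLpNorm k 1 volume * eLpNorm f (ENNReal.ofReal p) volume := by
  have hp0 : 0 < p := by linarith
  have hpq := Real.HolderConjugate.conjExponent hp
  have hk := hki.aestronglyMeasurable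
  set q := Real.conjExponent p
  set N : ℝ≥0∞ := eLpNorm k 1 volume with hN
  rw [eLpNorm_eq_lintegral_rpow_enorm_toReal (by simpa using hp0) ofReal_ne_top,
    eLpNorm_eq_lintegral_rpow_enorm_toReal (by simpa using hp0) ofReal_ne_top,
    ENNReal.toReal_ofReal hp0.le]
  have hkx : ∀ x, ∫⁻ y, ‖k (x - y)‖ₑ = N := fun x => by
    rw [lintegral_sub_left_eq_self (fun y => ‖k y‖ₑ) x, hN, eLpNorm_one_eq_lintegral_enorm]
  have hky : ∀ y, ∫⁻ x, ‖k (x - y)‖ₑ = N := fun y => by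
    rw [lintegral_sub_right_eq_self (fun y => ‖k y‖ₑ) y, hN, eLpNorm_one_eq_lintegral_enorm]
  have hk2 : AEMeasurable (fun z : EuclideanSpace ℝ (Fin n) × EuclideanSpace ℝ (Fin n) =>
      ‖k (z.1 - z.2)‖ₑ) (volume.prod volume) :=
    (hk.comp_quasiMeasurePreserving
      (quasiMeasurePreserving_sub_of_right_invariant volume volume)).enorm
  have hkm : ∀ x, AEMeasurable fun y => ‖k (x - y)‖ₑ := fun x =>
    (hk.comp_measurePreserving (Measure.measurePreserving_sub_left volume x)).enorm
  have hfm : AEMeasurable fun y => ‖f y‖ₑ := hf.enorm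
  have hpt : ∀ x, ‖convol f k x‖ₑ ^ p ≤
      N ^ (p - 1) * ∫⁻ y, ‖f y‖ₑ ^ p * ‖k (x - y)‖ₑ := fun x => by
    have h1 : ‖convol f k x‖ₑ ≤ ∫⁻ y, ‖f y‖ₑ * ‖k (x - y)‖ₑ :=
      (enorm_integral_le_lintegral_enorm _).trans_eq (by simp_rw [enorm_mul])
    have h2 := ENNReal.lintegral_mul_le_Lp_mul_Lq volume hpq
      (hfm.mul ((hkm x).pow_const (1 / p))) ((hkm x).pow_const (1 / q))
    have h3 : ∀ y, (((fun y => ‖f y‖ₑ) * fun y => ‖k (x - y)‖ₑ ^ (1 / p)) * fun y =>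
        ‖k (x - y)‖ₑ ^ (1 / q)) y = ‖f y‖ₑ * ‖k (x - y)‖ₑ := fun y => by
      simp only [Pi.mul_apply]
      rw [mul_assoc, ← ENNReal.rpow_add_of_nonneg _ _ (by positivity [hp0]) (one_div_nonneg.2 hpq.symm.nonneg),
        one_div, one_div, hpq.inv_add_inv_eq_one, ENNReal.rpow_one]
    have h4 : ∀ y, ((fun y => ‖f y‖ₑ) * fun y => ‖k (x - y)‖ₑ ^ (1 / p)) y ^ p =
        ‖f y‖ₑ ^ p * ‖k (x - y)‖ₑ := fun y => by
      simp only [Pi.mul_apply]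
      rw [ENNReal.mul_rpow_of_nonneg _ _ hp0.le, ← ENNReal.rpow_mul, one_div_mul_cancel hp0.ne',
        ENNReal.rpow_one]
    have h5 : ∀ y, (‖k (x - y)‖ₑ ^ (1 / q)) ^ q = ‖k (x - y)‖ₑ := fun y => by
      rw [← ENNReal.rpow_mul, one_div_mul_cancel hpq.symm.ne_zero, ENNReal.rpow_one]
    simp_rw [h3, h4, h5, hkx] at h2
    have h6 := ENNReal.rpow_le_rpow (h1.trans h2) hp0.le
    rw [ENNReal.mul_rpow_of_nonneg _ _ hp0.le, ← ENNReal.rpow_mul, ← ENNReal.rpow_mul,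
      one_div_mul_cancel hp0.ne', ENNReal.rpow_one, mul_comm] at h6
    convert h6 using 3
    rw [one_div, ← hpq.one_sub_inv, sub_mul, inv_mul_cancel₀ hp0.ne', one_mul]
  have hT : ∫⁻ x, ‖convol f k x‖ₑ ^ p ≤ N ^ p * ∫⁻ y, ‖f y‖ₑ ^ p := by
    have hNt : N ≠ ⊤ := (memLp_one_iff_integrable.2 hki).2.ne
    have hfp : AEMeasurable (fun z : EuclideanSpace ℝ (Fin n) × EuclideanSpace ℝ (Fin n) =>
        ‖f z.2‖ₑ ^ p) (volume.prod volume) :=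
      (hfm.pow_const p).comp_quasiMeasurePreserving Measure.quasiMeasurePreserving_snd
    calc ∫⁻ x, ‖convol f k x‖ₑ ^ p
        ≤ ∫⁻ x, N ^ (p - 1) * ∫⁻ y, ‖f y‖ₑ ^ p * ‖k (x - y)‖ₑ := lintegral_mono hpt
      _ = N ^ (p - 1) * ∫⁻ x, (∫⁻ y, ‖f y‖ₑ ^ p * ‖k (x - y)‖ₑ) :=
          lintegral_const_mul' _ _ (ENNReal.rpow_ne_top_of_nonneg (by linarith) hNt)
      _ = N ^ (p - 1) * ∫⁻ y, (∫⁻ x, ‖f y‖ₑ ^ p * ‖k (x - y)‖ₑ) := by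
          rw [lintegral_lintegral_swap (hfp.mul hk2)]
      _ = N ^ (p - 1) * ∫⁻ y, ‖f y‖ₑ ^ p * N := by
          congr 2 with y
          have hm : AEMeasurable fun x => ‖k (x - y)‖ₑ :=
            (hk.comp_measurePreserving (measurePreserving_sub_right volume y)).enorm
          rw [lintegral_const_mul'' _ hm, hky]
      _ = N ^ p * ∫⁻ y, ‖f y‖ₑ ^ p := by
          rw [lintegral_mul_const' _ _ hNt, mul_comm _ N, ← mul_assoc]
          congr 1
          nth_rewrite 2 [← ENNReal.rpow_one N]
          rw [← ENNReal.rpow_add_of_nonneg _ _ (by linarith) zero_le_one, sub_add_cancel]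
  refine (ENNReal.rpow_le_rpow hT (by positivity)).trans_eq ?_
  rw [ENNReal.mul_rpow_of_nonneg _ _ (by positivity), ← ENNReal.rpow_mul,
    mul_one_div_cancel hp0.ne', ENNReal.rpow_one]

end

section

variable {n : ℕ}

theorem contDiff_fderiv_apply_const {g : EuclideanSpace ℝ (Fin n) → ℝ}
    (hg : ContDiff ℝ (⊤ : ℕ∞) g) (v : EuclideanSpace ℝ (Fin n)) :
    ContDiff ℝ (⊤ : ℕ∞) fun y => fderiv ℝ g y v :=
  (hg.fderiv_right (by exact_mod_cast le_top)).clm_apply contDiff_const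

theorem norm_iteratedFDeriv_succ_le_sum {u : EuclideanSpace ℝ (Fin n) → ℝ}
    (hu : ContDiff ℝ (⊤ : ℕ∞) u) (k : ℕ) (x : EuclideanSpace ℝ (Fin n)) :
    ‖iteratedFDeriv ℝ (k + 1) u x‖ ≤
      ∑ j : Fin n, ‖iteratedFDeriv ℝ k (fun y => fderiv ℝ u y (EuclideanSpace.single j 1)) x‖ := by
  let T : Fin n → ℝ →L[ℝ] (EuclideanSpace ℝ (Fin n) →L[ℝ] ℝ) := fun j =>
    ContinuousLinearMap.toSpanSingleton ℝ (EuclideanSpace.proj j)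
  have hT : ∀ j, ‖T j‖ ≤ 1 := fun j => by
    rw [ContinuousLinearMap.norm_toSpanSingleton]
    refine ContinuousLinearMap.opNorm_le_bound _ zero_le_one fun y => ?_
    rw [one_mul]
    exact PiLp.norm_apply_le y j
  have hd := fun j : Fin n => contDiff_fderiv_apply_const hu (EuclideanSpace.single j (1 : ℝ))
  have e : fderiv ℝ u = fun y => ∑ j : Fin n,
      (T j ∘ fun y => fderiv ℝ u y (EuclideanSpace.single j 1)) y := by
    ext y v
    conv_lhs => rw [← (EuclideanSpace.basisFun (Fin n) ℝ).sum_repr v]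
    simp [T, mul_comm]
  have hk : ((k : ℕ∞) : WithTop ℕ∞) ≤ ((⊤ : ℕ∞) : WithTop ℕ∞) := by exact_mod_cast le_top
  have e2 : iteratedFDeriv ℝ k (fderiv ℝ u) x = ∑ j : Fin n, iteratedFDeriv ℝ k
      (T j ∘ fun y => fderiv ℝ u y (EuclideanSpace.single j 1)) x := by
    conv_lhs => rw [e]
    rw [iteratedFDeriv_fun_sum_apply fun j _ => ((T j).contDiff.comp (hd j)).contDiffAt.of_le hk]
  rw [← norm_iteratedFDeriv_fderiv, e2]
  refine (norm_sum_le _ _).trans (Finset.sum_le_sum fun j _ => ?_)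
  refine ((T j).norm_iteratedFDeriv_comp_left (hd j).contDiffAt hk).trans ?_
  exact mul_le_of_le_one_left (norm_nonneg _) (hT j)

theorem norm_iteratedFDeriv_fderiv_apply_le {u : EuclideanSpace ℝ (Fin n) → ℝ}
    (hu : ContDiff ℝ (⊤ : ℕ∞) u) (k : ℕ) {v : EuclideanSpace ℝ (Fin n)} (hv : ‖v‖ ≤ 1)
    (x : EuclideanSpace ℝ (Fin n)) :
    ‖iteratedFDeriv ℝ k (fun y => fderiv ℝ u y v) x‖ ≤ ‖iteratedFDeriv ℝ (k + 1) u x‖ := by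
  rw [← norm_iteratedFDeriv_fderiv]
  refine (norm_iteratedFDeriv_clm_apply_const
    (hu.fderiv_right (m := (⊤ : ℕ∞)) (by exact_mod_cast le_top)).contDiffAt
    (by exact_mod_cast le_top)).trans ?_
  exact mul_le_of_le_one_left (norm_nonneg _) hv

theorem aestronglyMeasurable_iteratedFDeriv {u : EuclideanSpace ℝ (Fin n) → ℝ}
    (hu : ContDiff ℝ (⊤ : ℕ∞) u) (k : ℕ) : AEStronglyMeasurable (iteratedFDeriv ℝ k u) :=
  (hu.continuous_iteratedFDeriv (by exact_mod_cast le_top)).aestronglyMeasurable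

theorem eLpNorm_iteratedFDeriv_succ_le_sum {p : ℝ≥0∞} (hp : 1 ≤ p)
    {u : EuclideanSpace ℝ (Fin n) → ℝ} (hu : ContDiff ℝ (⊤ : ℕ∞) u) (k : ℕ) :
    eLpNorm (iteratedFDeriv ℝ (k + 1) u) p volume ≤ ∑ j : Fin n,
      eLpNorm (iteratedFDeriv ℝ k fun y => fderiv ℝ u y (EuclideanSpace.single j 1)) p volume := by
  refine (eLpNorm_mono_real (norm_iteratedFDeriv_succ_le_sum hu k)).trans ?_
  have h := eLpNorm_sum_le (μ := volume) (p := p) (s := Finset.univ)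
    (f := fun (j : Fin n) x => ‖iteratedFDeriv ℝ k
      (fun y => fderiv ℝ u y (EuclideanSpace.single j (1 : ℝ))) x‖) (fun j _ =>
      (aestronglyMeasurable_iteratedFDeriv (contDiff_fderiv_apply_const hu _) k).norm) hp
  simp_rw [eLpNorm_norm] at h
  refine le_of_eq_of_le (congrArg (eLpNorm · p volume) ?_) h
  ext x
  simp

theorem eLpNorm_iteratedFDeriv_zero {p : ℝ≥0∞} {μ : Measure (EuclideanSpace ℝ (Fin n))}
    (u : EuclideanSpace ℝ (Fin n) → ℝ) :
    eLpNorm (iteratedFDeriv ℝ 0 u) p μ = eLpNorm u p μ :=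
  eLpNorm_congr_norm_ae (ae_of_all _ fun x => by simp)

/-- A first-order estimate for convolution with `L` propagates to all derivatives. -/
theorem eLpNorm_iteratedFDeriv_succ_convol_le {p : ℝ≥0∞} (hp : 1 ≤ p)
    {L : EuclideanSpace ℝ (Fin n) → ℝ} (hL : LocallyIntegrable L) {C : ℝ≥0∞}
    (h : ∀ (g : EuclideanSpace ℝ (Fin n) → ℝ) (v : EuclideanSpace ℝ (Fin n)),
      ContDiff ℝ (⊤ : ℕ∞) g → HasCompactSupport g → ‖v‖ ≤ 1 →
      eLpNorm (convol (fun y => fderiv ℝ g y v) L) p volume ≤ C * eLpNorm g p volume) (k : ℕ) :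
    ∀ g : EuclideanSpace ℝ (Fin n) → ℝ, ContDiff ℝ (⊤ : ℕ∞) g → HasCompactSupport g →
      eLpNorm (iteratedFDeriv ℝ (k + 1) (convol g L)) p volume ≤
        n ^ (k + 1) * C * eLpNorm (iteratedFDeriv ℝ k g) p volume := by
  have hv : ∀ j : Fin n, ‖EuclideanSpace.single j (1 : ℝ)‖ ≤ 1 := fun j => by simp
  induction k with
  | zero =>
    intro g hg hgc
    refine (eLpNorm_iteratedFDeriv_succ_le_sum hp (contDiff_convol hg hgc hL) 0).trans ?_
    simp_rw [eLpNorm_iteratedFDeriv_zero, fderiv_convol_left hg hgc hL]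
    refine (Finset.sum_le_sum fun j _ => h g _ hg hgc (hv j)).trans ?_
    simp [mul_assoc]
  | succ k ih =>
    intro g hg hgc
    refine (eLpNorm_iteratedFDeriv_succ_le_sum hp (contDiff_convol hg hgc hL) (k + 1)).trans ?_
    simp_rw [fderiv_convol_left hg hgc hL]
    refine (Finset.sum_le_sum fun j _ => (ih _ (contDiff_fderiv_apply_const hg _)
      (hgc.fderiv_apply ℝ _)).trans (mul_le_mul_right (eLpNorm_mono
        (norm_iteratedFDeriv_fderiv_apply_le hg k (hv j))) _)).trans ?_
    simp only [Finset.sum_const, Finset.card_univ, Fintype.card_fin, nsmul_eq_mul]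
    rw [pow_succ' _ (k + 1)]
    simp [mul_assoc]

theorem exists_eLpNorm_iteratedFDeriv_mul_le {p : ℝ≥0∞} (hp : 1 ≤ p)
    {χ : EuclideanSpace ℝ (Fin n) → ℝ} (hχ : ContDiff ℝ (⊤ : ℕ∞) χ) (hχc : HasCompactSupport χ)
    (k : ℕ) :
    ∃ C : ℝ≥0∞, C ≠ ⊤ ∧ ∀ f : EuclideanSpace ℝ (Fin n) → ℝ, ContDiff ℝ (⊤ : ℕ∞) f →
      eLpNorm (iteratedFDeriv ℝ k fun x => χ x * f x) p volume ≤
        C * ∑ i ∈ Finset.range (k + 1), eLpNorm (iteratedFDeriv ℝ i f) p volume := by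
  have hB : ∀ i : ℕ, ∃ B : ℝ, ∀ x, ‖iteratedFDeriv ℝ i χ x‖ ≤ B := fun i =>
    (hχ.continuous_iteratedFDeriv (by exact_mod_cast le_top)).bounded_above_of_compact_support
      (hχc.iteratedFDeriv i)
  choose B hB using hB
  have hB0 : ∀ i, 0 ≤ B i := fun i => (norm_nonneg _).trans (hB i 0)
  set M : ℝ := ∑ i ∈ Finset.range (k + 1), (k.choose i) * B i
  have hM : 0 ≤ M := Finset.sum_nonneg fun i _ => mul_nonneg (by positivity) (hB0 i)
  refine ⟨ENNReal.ofReal M, ofReal_ne_top, fun f hf => ?_⟩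
  have hpt : ∀ x, ‖iteratedFDeriv ℝ k (fun x => χ x * f x) x‖ ≤
      M * ‖∑ i ∈ Finset.range (k + 1), ‖iteratedFDeriv ℝ i f x‖‖ := fun x => by
    refine (norm_iteratedFDeriv_mul_le hχ hf x (n := k) (by exact_mod_cast le_top)).trans ?_
    rw [Real.norm_of_nonneg (Finset.sum_nonneg fun i _ => norm_nonneg _),
      ← Finset.sum_range_reflect (fun i => ‖iteratedFDeriv ℝ i f x‖), Finset.mul_sum]
    refine Finset.sum_le_sum fun i hi => ?_
    rw [add_tsub_cancel_right]
    refine mul_le_mul_of_nonneg_right ?_ (norm_nonneg _)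
    refine (mul_le_mul_of_nonneg_left (hB i x) (by positivity)).trans ?_
    exact Finset.single_le_sum (f := fun i => (k.choose i : ℝ) * B i)
      (fun i _ => mul_nonneg (by positivity) (hB0 i)) hi
  refine (eLpNorm_le_mul_eLpNorm_of_ae_le_mul (ae_of_all _ hpt) p).trans (mul_le_mul_right ?_ _)
  have h := eLpNorm_sum_le (μ := volume) (p := p) (s := Finset.range (k + 1))
    (f := fun i x => ‖iteratedFDeriv ℝ i f x‖) (fun i _ =>
      (aestronglyMeasurable_iteratedFDeriv hf i).norm) hp
  simp_rw [eLpNorm_norm] at h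
  refine le_of_eq_of_le (congrArg (eLpNorm · p volume) ?_) h
  ext x
  simp

end

/-- **Local Sobolev mapping property of truncated kernels of type 1** (Theorem 3.19 i),
Euclidean case): for `1 < p < ∞`, `s ≥ 1`, a fixed smooth compactly supported `χ₀`, a
kernel `K` of type `1`, a cut-off `ψ ≡ 1` near the origin, and a bounded open `D`,
there is `C` such that `‖(χ₀ f) ∗ (ψK)‖_{W^{s,p}(D)} ≤ C ‖f‖_{W^{s-1,p}(ℝⁿ)}` for every
smooth `f` with finite `W^{s-1,p}` norm. -/
theorem truncated_kernel_sobolev (n : ℕ) (hn : 2 ≤ n) (p : ℝ) (hp1 : 1 < p)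
    (s : ℕ) (hs : 1 ≤ s)
    (χ₀ : EuclideanSpace ℝ (Fin n) → ℝ) (hχ₀ : ContDiff ℝ (⊤ : ℕ∞) χ₀)
    (hχ₀c : HasCompactSupport χ₀)
    (K : EuclideanSpace ℝ (Fin n) → ℝ) (hK : IsKernelOfType n 1 K)
    (ψ : EuclideanSpace ℝ (Fin n) → ℝ) (hψ : ContDiff ℝ (⊤ : ℕ∞) ψ)
    (hψc : HasCompactSupport ψ) (hψ1 : ∀ᶠ x in nhds 0, ψ x = 1)
    (D : Set (EuclideanSpace ℝ (Fin n))) (hDo : IsOpen D)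
    (hDb : Bornology.IsBounded D) :
    ∃ C : ℝ, 0 < C ∧
      ∀ f : EuclideanSpace ℝ (Fin n) → ℝ, ContDiff ℝ (⊤ : ℕ∞) f →
        (∀ k ∈ Finset.range s,
          eLpNorm (iteratedFDeriv ℝ k f) (ENNReal.ofReal p) volume < ⊤) →
        ∑ k ∈ Finset.range (s + 1),
            eLpNorm
              (iteratedFDeriv ℝ k
                (fun z => ∫ y, (χ₀ y * f y) * (ψ (z - y) * K (z - y))))
              (ENNReal.ofReal p) (volume.restrict D) ≤
          ENNReal.ofReal C *
            ∑ k ∈ Finset.range s,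
              eLpNorm (iteratedFDeriv ℝ k f) (ENNReal.ofReal p) volume := by
  have hp : 1 ≤ ENNReal.ofReal p := ENNReal.one_le_ofReal.2 hp1.le
  have hL := hK.integrable_mul hn hψ.continuous hψc
  obtain ⟨C, hC, h⟩ := exists_eLpNorm_convol_fderiv_kernel_le hn hp1 hK hψ hψc
  choose B hB hχ using exists_eLpNorm_iteratedFDeriv_mul_le hp hχ₀ hχ₀c
  have hstep : ∀ k, ∃ E : ℝ≥0∞, E ≠ ⊤ ∧ (k < s + 1 → ∀ f : EuclideanSpace ℝ (Fin n) → ℝ,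
      ContDiff ℝ (⊤ : ℕ∞) f →
      eLpNorm (iteratedFDeriv ℝ k (convol (fun y => χ₀ y * f y) fun x => ψ x * K x))
        (ENNReal.ofReal p) volume ≤
      E * ∑ k ∈ Finset.range s, eLpNorm (iteratedFDeriv ℝ k f) (ENNReal.ofReal p) volume) := by
    intro k
    have hsum : ∀ (k : ℕ) (f : EuclideanSpace ℝ (Fin n) → ℝ), k < s → ContDiff ℝ (⊤ : ℕ∞) f →
        eLpNorm (iteratedFDeriv ℝ k fun x => χ₀ x * f x) (ENNReal.ofReal p) volume ≤
        B k * ∑ i ∈ Finset.range s, eLpNorm (iteratedFDeriv ℝ i f) (ENNReal.ofReal p) volume :=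
      fun k f hk hf => (hχ k f hf).trans (mul_le_mul_right
        (Finset.sum_le_sum_of_subset (Finset.range_subset_range.2 hk)) _)
    rcases k with _ | k
    · refine ⟨eLpNorm (fun x => ψ x * K x) 1 volume * B 0,
        ENNReal.mul_ne_top (memLp_one_iff_integrable.2 hL).2.ne (hB 0), fun _ f hf => ?_⟩
      rw [eLpNorm_iteratedFDeriv_zero, mul_assoc]
      refine (eLpNorm_convol_le hp1 (hχ₀.mul hf).continuous.aestronglyMeasurable hL).trans
        (mul_le_mul_right ?_ _)
      rw [← eLpNorm_iteratedFDeriv_zero]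
      exact hsum 0 f hs hf
    · refine ⟨n ^ (k + 1) * C * B k, ENNReal.mul_ne_top (ENNReal.mul_ne_top (by finiteness) hC) (hB k),
        fun hk f hf => ?_⟩
      rw [mul_assoc _ (B k)]
      exact (eLpNorm_iteratedFDeriv_succ_convol_le hp hL.locallyIntegrable h k _ (hχ₀.mul hf)
        hχ₀c.mul_right).trans (mul_le_mul_right (hsum k f (by omega) hf) _)
  choose E hE hstep using hstep
  have hEt : ∑ k ∈ Finset.range (s + 1), E k ≠ ⊤ := ENNReal.sum_ne_top.2 fun k _ => hE k
  refine ⟨(∑ k ∈ Finset.range (s + 1), E k).toReal + 1, by positivity, fun f hf _ => ?_⟩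
  calc _ ≤ ∑ k ∈ Finset.range (s + 1), E k *
        ∑ k ∈ Finset.range s, eLpNorm (iteratedFDeriv ℝ k f) (ENNReal.ofReal p) volume :=
        Finset.sum_le_sum fun k hk => (eLpNorm_mono_measure _ Measure.restrict_le_self).trans
          (hstep k (Finset.mem_range.1 hk) f hf)
    _ ≤ _ := by
        rw [← Finset.sum_mul]
        gcongr
        rw [ENNReal.le_ofReal_iff_toReal_le hEt (by positivity)]
        linarith
end
end
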